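/- For every finite simple matroid M of rank r+1, the element ω = Σ_{∅ ≠ F ∈ 𝓕} |F|·|E∖F| · x_F of A¹_ℝ is fixed by every automorphism g ∈ G, and for every integer k with 0 ≤ 2k < r the multiplication map A^k_ℝ → A^{k+1}_ℝ, a ↦ a·ω, is an injective ℝ-linear G-equivariant map. -/

import Mathlib

open Finset

/-- A finite simple matroid, presented by its lattice of flats and rank function. -/
structure SimpleFlatMatroid (E : Type*) [Fintype E] [DecidableEq E] where
  /-- the collection of flats -/
  flats : Finset (Finset E)
  /-- the rank function -/
  rk : Finset E → ℕ
  /-- (F1): the ground set is a flat -/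
  ground_mem : (Finset.univ : Finset E) ∈ flats
  /-- (F2): flats are closed under intersection -/
  inter_mem : ∀ F ∈ flats, ∀ F' ∈ flats, F ∩ F' ∈ flats
  /-- (F3): for a flat `F` and `i ∉ F` there is a unique flat containing `i` covering `F` -/
  cover_axiom : ∀ F ∈ flats, ∀ i : E, i ∉ F →
    ∃! F' : Finset E, F' ∈ flats ∧ i ∈ F' ∧ F ⊂ F' ∧
      ¬ ∃ F'' ∈ flats, F ⊂ F'' ∧ F'' ⊂ F'
  /-- simplicity: no loops, i.e. `∅` is a flat -/
  empty_mem : (∅ : Finset E) ∈ flats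
  /-- simplicity: no parallel elements, i.e. all singletons are flats -/
  singleton_mem : ∀ i : E, ({i} : Finset E) ∈ flats
  /-- normalization of the rank function -/
  rk_empty : rk ∅ = 0
  /-- the rank function increases by one along covers of flats -/
  rk_cover : ∀ F ∈ flats, ∀ F' ∈ flats, F ⊂ F' →
    (¬ ∃ F'' ∈ flats, F ⊂ F'' ∧ F'' ⊂ F') → rk F' = rk F + 1

namespace SimpleFlatMatroid

variable {E : Type*} [Fintype E] [DecidableEq E]

/-- We encode a (squarefree-or-not) monomial in the variables `x_F` as the function
sending each `F` to the exponent of `x_F`.  `prevFlat m F` is the union of all flats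
in the support of `m` strictly contained in `F`; when the support of `m` is a chain
this is the predecessor of `F` in the support (or `∅` if there is none). -/
def prevFlat (m : Finset E → ℕ) (F : Finset E) : Finset E :=
  Finset.univ.sup fun F' => if m F' ≠ 0 ∧ F' ⊂ F then F' else ∅

/-- The total degree of a monomial. -/
def deg (m : Finset E → ℕ) : ℕ := ∑ F : Finset E, m F

variable (M : SimpleFlatMatroid E)

/-- `m` is an FY-monomial: its support is a chain `F₁ ⊊ ⋯ ⊊ F_ℓ` of nonempty flats
with `m Fᵢ ≤ rk(Fᵢ) - rk(Fᵢ₋₁) - 1` for all `i` (with `F₀ := ∅`). -/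
def IsFY (m : Finset E → ℕ) : Prop :=
  (∀ F : Finset E, m F ≠ 0 → F ∈ M.flats ∧ F ≠ ∅) ∧
  (∀ F F' : Finset E, m F ≠ 0 → m F' ≠ 0 → F ⊆ F' ∨ F' ⊆ F) ∧
  (∀ F : Finset E, m F ≠ 0 → m F + M.rk (prevFlat m F) + 1 ≤ M.rk F)

/-- The set `FY^k` of FY-monomials of total degree `k`, as a type. -/
abbrev FYk (k : ℕ) : Type _ := {m : Finset E → ℕ // M.IsFY m ∧ deg m = k}

/-- `g` is an automorphism of the matroid: a permutation of the ground set carrying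
flats to flats. -/
def IsAut (g : Equiv.Perm E) : Prop := ∀ F ∈ M.flats, F.image g ∈ M.flats

/-- The action of a permutation `g` on monomials:
`g ⋅ (x_{F₁}^{m₁} ⋯ x_{F_ℓ}^{m_ℓ}) = x_{g F₁}^{m₁} ⋯ x_{g F_ℓ}^{m_ℓ}`. -/
def mact (g : Equiv.Perm E) (m : Finset E → ℕ) : Finset E → ℕ :=
  fun F => m (F.image (g⁻¹ : Equiv.Perm E))

end SimpleFlatMatroid

namespace SimpleFlatMatroid

variable {E : Type*} [Fintype E] [DecidableEq E] (M : SimpleFlatMatroid E)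

/-- The index type of the variables of the Chow ring: nonempty flats of `M`. -/
abbrev FlatVar : Type _ := {F : Finset E // F ∈ M.flats ∧ F ≠ ∅}

/-- The polynomial ring `S = ℤ[x_F : ∅ ≠ F ∈ 𝓕]`. -/
abbrev ChowPoly : Type _ := MvPolynomial (FlatVar M) ℤ

/-- The ideal `I + J`, where `I` is generated by the products `x_F x_{F'}` over
incomparable pairs of nonempty flats, and `J` is generated by the linear forms
`∑_{F ∋ a} x_F`, one for each element `a` of the ground set. -/
noncomputable def chowIdeal : Ideal (ChowPoly M) :=
  Ideal.span
    ({p | ∃ F F' : FlatVar M, ¬ F.1 ⊆ F'.1 ∧ ¬ F'.1 ⊆ F.1 ∧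
        p = MvPolynomial.X F * MvPolynomial.X F'} ∪
     {p | ∃ a : E, p = ∑ F : FlatVar M, if a ∈ F.1 then MvPolynomial.X F else 0})

/-- The Chow ring `A(M) = S/(I+J)`. -/
abbrev ChowRing : Type _ := ChowPoly M ⧸ chowIdeal M

/-- The quotient map `S → A(M)`. -/
noncomputable def chowMk : ChowPoly M →ₐ[ℤ] ChowRing M :=
  Ideal.Quotient.mkₐ ℤ (chowIdeal M)

/-- The degree-`k` graded component `A^k` of the Chow ring, i.e. the image of the
homogeneous degree-`k` polynomials under the quotient map. -/
noncomputable def chowComp (k : ℕ) : Submodule ℤ (ChowRing M) :=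
  (MvPolynomial.homogeneousSubmodule (FlatVar M) ℤ k).map (chowMk M).toLinearMap

/-- The polynomial `x_{F₁}^{m₁} ⋯ x_{F_ℓ}^{m_ℓ}` in `S` corresponding to a monomial
given as an exponent function on flats. -/
noncomputable def FYpoly (m : Finset E → ℕ) : ChowPoly M :=
  MvPolynomial.monomial (Finsupp.equivFunOnFinite.symm fun F : FlatVar M => m F.1) 1

/-- The action of an automorphism `g` on the polynomial ring `S`, by `x_F ↦ x_{g F}`. -/
noncomputable def autRename (g : Equiv.Perm E) (hg : M.IsAut g) :
    ChowPoly M →ₐ[ℤ] ChowPoly M :=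
  MvPolynomial.rename fun F : FlatVar M =>
    (⟨F.1.image g, hg F.1 F.2.1, by
        simpa [Finset.image_eq_empty] using F.2.2⟩ : FlatVar M)

/-- The class in `A^k` of a homogeneous polynomial of degree `k`. -/
noncomputable def clsOf {k : ℕ} (p : ChowPoly M)
    (hp : p ∈ MvPolynomial.homogeneousSubmodule (FlatVar M) ℤ k) : chowComp M k :=
  ⟨chowMk M p, Submodule.mem_map_of_mem hp⟩


/-- The variable `x_E` corresponding to the ground set. -/
noncomputable def xE [Nonempty E] : ChowPoly M :=
  MvPolynomial.X (⟨Finset.univ, M.ground_mem, Finset.univ_nonempty.ne_empty⟩ : FlatVar M)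


/-- Renaming variables along an automorphism preserves homogeneity. -/
theorem autRename_mem_homogeneousSubmodule {k : ℕ} (g : Equiv.Perm E) (hg : M.IsAut g)
    {p : ChowPoly M} (hp : p ∈ MvPolynomial.homogeneousSubmodule (FlatVar M) ℤ k) :
    autRename M g hg p ∈ MvPolynomial.homogeneousSubmodule (FlatVar M) ℤ k := by
  rw [MvPolynomial.mem_homogeneousSubmodule] at hp ⊢
  exact hp.rename_isHomogeneous

end SimpleFlatMatroid

namespace SimpleFlatMatroid

variable {E : Type*} [Fintype E] [DecidableEq E] (M : SimpleFlatMatroid E)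

/-- The polynomial ring `S_ℝ = ℝ[x_F : ∅ ≠ F ∈ 𝓕]`. -/
abbrev ChowPolyR : Type _ := MvPolynomial (FlatVar M) ℝ

/-- The ideal `I_ℝ + J_ℝ` of `S_ℝ`, with the same generators as `I + J`. -/
noncomputable def chowIdealR : Ideal (ChowPolyR M) :=
  Ideal.span
    ({p | ∃ F F' : FlatVar M, ¬ F.1 ⊆ F'.1 ∧ ¬ F'.1 ⊆ F.1 ∧
        p = MvPolynomial.X F * MvPolynomial.X F'} ∪
     {p | ∃ a : E, p = ∑ F : FlatVar M, if a ∈ F.1 then MvPolynomial.X F else 0})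

/-- The real Chow ring `A(M)_ℝ = A(M) ⊗_ℤ ℝ`, realized as `S_ℝ/(I_ℝ + J_ℝ)`. -/
abbrev ChowRingR : Type _ := ChowPolyR M ⧸ chowIdealR M

/-- The quotient map `S_ℝ → A(M)_ℝ`. -/
noncomputable def chowMkR : ChowPolyR M →ₐ[ℝ] ChowRingR M :=
  Ideal.Quotient.mkₐ ℝ (chowIdealR M)

/-- The degree-`k` graded component `A^k_ℝ = A^k ⊗_ℤ ℝ`. -/
noncomputable def chowCompR (k : ℕ) : Submodule ℝ (ChowRingR M) :=
  (MvPolynomial.homogeneousSubmodule (FlatVar M) ℝ k).map (chowMkR M).toLinearMap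

/-- The action of an automorphism `g` on `S_ℝ`, by `x_F ↦ x_{g F}`. -/
noncomputable def autRenameR (g : Equiv.Perm E) (hg : M.IsAut g) :
    ChowPolyR M →ₐ[ℝ] ChowPolyR M :=
  MvPolynomial.rename fun F : FlatVar M =>
    (⟨F.1.image g, hg F.1 F.2.1, by
        simpa [Finset.image_eq_empty] using F.2.2⟩ : FlatVar M)

end SimpleFlatMatroid

namespace ChowHL
open MvPolynomial

/-- Hodge-Riemann relations for a functional on a polynomial ring. -/
def HR {ι : Type*} (l : MvPolynomial ι ℝ →ₗ[ℝ] ℝ) (w : MvPolynomial ι ℝ) (d : ℕ) : Prop :=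
  ∀ k m, 2 * k + m = d → ∀ a : MvPolynomial ι ℝ, a.IsHomogeneous k →
    (∀ j, j + 1 = k → ∀ b : MvPolynomial ι ℝ, b.IsHomogeneous j → l (a * b * w ^ (m + 1)) = 0) →
    0 ≤ (-1) ^ k * l (a * a * w ^ m) ∧
    (l (a * a * w ^ m) = 0 → ∀ c : MvPolynomial ι ℝ, c.IsHomogeneous (k + m) → l (a * c) = 0)

variable {ι : Type*}

theorem pderiv_hom0 {a : MvPolynomial ι ℝ} (i : ι) (ha : a.IsHomogeneous 0) :
    pderiv i a = 0 := by
  rw [← totalDegree_zero_iff_isHomogeneous] at ha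
  rw [totalDegree_eq_zero_iff_eq_C.1 ha, pderiv_C]

theorem pow_rule (i : ι) (w : MvPolynomial ι ℝ) (κ : ℝ) (hw : pderiv i w = C κ) (p : MvPolynomial ι ℝ)
    (m : ℕ) : pderiv i (p * w ^ (m+1)) = pderiv i p * w ^ (m+1) + ((m+1) * κ) • (p * w ^ m) := by
  rw [pderiv_mul, pderiv_pow, hw, smul_eq_C_mul]
  simp
  ring

set_option maxHeartbeats 1000000 in
theorem HR_deriv (l l' : MvPolynomial ι ℝ →ₗ[ℝ] ℝ) (w : MvPolynomial ι ℝ) (d : ℕ)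
    (hw : w.IsHomogeneous 1) (i : ι) (κ ρ : ℝ) (hκ : 0 < κ) (hρ : 0 < ρ)
    (hdw : pderiv i w = C κ) (hl : ∀ p, l' p = ρ * l (pderiv i p))
    (hX : ∀ p, l' (X i * p) = l p) (H : HR l w d) : HR l' w (d + 1) := by
  intro k m hkm a ha hprim
  have hwp : ∀ n, (w ^ n).IsHomogeneous n := fun n => by simpa using hw.pow n
  rcases k with _ | j
  · -- k = 0
    obtain rfl : m = d + 1 := by omega
    have hb : pderiv i a = 0 := pderiv_hom0 i ha
    have h1 := H 0 d (by omega) a ha (fun j hj => by omega)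
    have h2 : l' (a * a * w ^ (d + 1)) = ρ * ((d + 1) * κ * l (a * a * w ^ d)) := by
      rw [hl, pow_rule i w κ hdw, pderiv_mul, hb]; simp
    rw [h2]
    refine ⟨by have := h1.1; simp at this ⊢; positivity, fun h0 c hc => ?_⟩
    have h3 : l (a * a * w ^ d) = 0 := by
      have : (d + 1 : ℝ) * κ ≠ 0 := by positivity
      rcases mul_eq_zero.1 h0 with h | h
      · exact absurd h hρ.ne'
      · exact (mul_eq_zero.1 h).resolve_left this
    rw [hl, pderiv_mul, hb, zero_mul, zero_add, h1.2 h3 _ (by simpa using hc.pderiv), mul_zero]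
  · set b := pderiv i a with hbdef
    have hb : b.IsHomogeneous j := by simpa using ha.pderiv (i := i)
    have h1 : ∀ q, q + 1 = j → ∀ c : MvPolynomial ι ℝ, c.IsHomogeneous q →
        l (a * c * w ^ (m + 1)) = 0 := by
      intro q hq c hc
      have := hprim j rfl (X i * c) (by have := (isHomogeneous_X ℝ i).mul hc; rwa [add_comm, hq] at this)
      rw [← hX, ← this]; congr 1; ring
    have h2 : ∀ c : MvPolynomial ι ℝ, c.IsHomogeneous j →
        l (b * c * w ^ (m + 1)) + (m + 1) * κ * l (a * c * w ^ m) = 0 := by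
      intro c hc
      have h := hprim j rfl c hc
      rw [hl, pow_rule i w κ hdw, pderiv_mul, ← hbdef, add_mul] at h
      have h0 : l (a * pderiv i c * w ^ (m + 1)) = 0 := by
        rcases j with _ | q
        · rw [pderiv_hom0 i hc]; simp
        · exact h1 q rfl _ (by simpa using hc.pderiv)
      rw [map_add, map_add, h0, map_smul, add_zero, smul_eq_mul] at h
      exact (mul_eq_zero.1 h).resolve_left hρ.ne'
    have hbprim := H j (m + 1) (by omega) b hb (fun q hq c hc => by
      have := h2 (c * w) (by have := hc.mul hw; rwa [hq] at this)
      have e1 : b * (c * w) * w ^ (m + 1) = b * c * w ^ (m + 1 + 1) := by ring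
      have e2 : a * (c * w) * w ^ m = a * c * w ^ (m + 1) := by ring
      rw [e1, e2, h1 q hq c hc] at this
      simpa using this)
    have hX2 := h2 b hb
    have hm1 : (0:ℝ) < (m + 1) * κ := by positivity
    have hval : pderiv i (a * a) = 2 * (a * b) := by rw [pderiv_mul, ← hbdef]; ring
    set Q := l (b * b * w ^ (m + 1)) with hQ
    set Y := l (a * b * w ^ m) with hY
    have hYQ : Y = - Q / ((m + 1) * κ) := by field_simp; linarith
    rcases m with _ | m'
    · have hv : l' (a * a * w ^ 0) = ρ * (2 * Y) := by
        rw [hl, pow_zero, mul_one, hval, hY, pow_zero, mul_one, two_mul, map_add]; ring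
      rw [hv, hYQ]
      simp only [Nat.cast_zero, zero_add, one_mul] at *
      refine ⟨?_, fun h0 c hc => ?_⟩
      · have := hbprim.1
        rw [pow_succ]
        have : (-1) ^ j * -1 * (ρ * (2 * (-Q / κ))) = 2 * ρ / κ * ((-1) ^ j * Q) := by ring
        rw [this]; positivity
      · have hQ0 : Q = 0 := by
          have : ρ * (2 * (-Q / κ)) = - (2 * ρ / κ) * Q := by ring
          rw [this] at h0
          have h' : -(2 * ρ / κ) ≠ 0 := by
            have : 0 < 2 * ρ / κ := by positivity
            exact neg_ne_zero.2 (ne_of_gt this)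
          exact (mul_eq_zero.1 h0).resolve_left h'
        have hn := hbprim.2 hQ0
        rw [hl, pderiv_mul, map_add, ← hbdef, hn c (by simpa using hc)]
        have h3 := h2 (pderiv i c) (by simpa using hc.pderiv (i := i))
        rw [mul_assoc, hn (pderiv i c * w ^ 1) (by
          have := (hc.pderiv (i := i)).mul (hwp 1); simpa using this)] at h3
        simp only [pow_zero, mul_one, zero_add] at h3
        rw [(mul_eq_zero.1 h3).resolve_left hκ.ne']; simp
    · set s : ℝ := 1 / (((m' + 1 : ℕ) + 1 : ℝ) * κ) with hs
      have hspos : 0 < s := by positivity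
      set p := a + s • (w * b) with hp
      have hph : p.IsHomogeneous (j + 1) := by
        refine ha.add ?_
        have := hw.mul hb
        rw [smul_eq_C_mul]
        exact (by rw [add_comm] at this; exact this.C_mul s)
      have hpprim := H (j + 1) m' (by omega) p hph (fun q hq c hc => by
        obtain rfl : q = j := by omega
        have := h2 c hc
        have e1 : p * c * w ^ (m' + 1) = a * c * w ^ (m' + 1) + s • (b * c * w ^ (m' + 1 + 1)) := by
          rw [hp, smul_eq_C_mul, smul_eq_C_mul]; ring
        rw [e1, map_add, map_smul, smul_eq_mul, hs]
        field_simp; linarith)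
      set P := l (p * p * w ^ m') with hP
      have hPe : P = l (a * a * w ^ m') + 2 * s * Y + s ^ 2 * Q := by
        have : p * p * w ^ m' = a * a * w ^ m' + (2 * s) • (a * b * w ^ (m' + 1)) +
            (s ^ 2) • (b * b * w ^ (m' + 1 + 1)) := by
          rw [hp]; simp only [smul_eq_C_mul, map_mul, map_pow, map_ofNat]; ring
        rw [hP, this, map_add, map_add, map_smul, map_smul]; rfl
      have hv : l' (a * a * w ^ (m' + 1)) = ρ * (2 * Y + (m' + 1) * κ * l (a * a * w ^ m')) := by
        rw [hl, pow_rule i w κ hdw, hval, map_add, map_smul, two_mul, add_mul, map_add]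
        simp only [smul_eq_mul]; rw [← hY]; ring
      have hv2 : l' (a * a * w ^ (m' + 1)) =
          ρ * ((m' + 1) * κ * P + ((m' + 1 + 2) * s / (m' + 2)) * (- Q)) := by
        rw [hv, hPe, hYQ, hs]; push_cast; field_simp; ring
      rw [hv2]
      have hP1 := hpprim.1
      have hQ1 := hbprim.1
      set A : ℝ := ρ * ((m' + 1) * κ) with hA
      set B : ℝ := ρ * ((m' + 1 + 2) * s / (m' + 2)) with hB
      have hApos : 0 < A := by positivity
      have hBpos : 0 < B := by positivity
      have hre : ρ * ((m' + 1) * κ * P + ((m' + 1 + 2) * s / (m' + 2)) * (- Q)) =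
        A * P - B * Q := by rw [hA, hB]; ring
      rw [hre]
      have hsg : (-1) ^ (j + 1) * (A * P - B * Q) =
          A * ((-1) ^ (j + 1) * P) + B * ((-1) ^ j * Q) := by ring
      refine ⟨by rw [hsg]; positivity, fun h0 c hc => ?_⟩
      have hz : A * ((-1) ^ (j + 1) * P) + B * ((-1) ^ j * Q) = 0 := by rw [← hsg, h0, mul_zero]
      have hP2 : 0 ≤ A * ((-1) ^ (j + 1) * P) := by positivity
      have hQ2 : 0 ≤ B * ((-1) ^ j * Q) := by positivity
      have hP0 : P = 0 := by
        have : A * ((-1) ^ (j + 1) * P) = 0 := by linarith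
        simpa [hApos.ne'] using this
      have hQ0 : Q = 0 := by
        have : B * ((-1) ^ j * Q) = 0 := by linarith
        simpa [hBpos.ne'] using this
      have hbn := hbprim.2 hQ0
      have hpn := hpprim.2 hP0
      have han : ∀ c : MvPolynomial ι ℝ, c.IsHomogeneous (j + 1 + m') → l (a * c) = 0 := by
        intro c hc
        have e1 := hpn c hc
        have e2 := hbn (w * c) (by have := hw.mul hc; convert this using 1; omega)
        have : p * c = a * c + s • (b * (w * c)) := by
          rw [hp, smul_eq_C_mul, smul_eq_C_mul]; ring
        rw [this, map_add, map_smul, e2] at e1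
        simpa using e1
      rw [hl, pderiv_mul, map_add, ← hbdef, hbn c (by convert hc using 1; omega),
        han (pderiv i c) (by have := hc.pderiv (i := i); convert this using 1; omega)]
      simp

theorem HR_coeff [Fintype ι] (κ : ι → ℝ) (hκ : ∀ i, 0 < κ i) (n : ι →₀ ℕ) :
    HR (lcoeff ℝ n) (∑ i, C (κ i) * X i) n.degree := by
  classical
  have hw : (∑ i, C (κ i) * X i : MvPolynomial ι ℝ).IsHomogeneous 1 :=
    IsHomogeneous.sum _ _ _ fun i _ => (isHomogeneous_X ℝ i).C_mul _
  obtain ⟨N, hN⟩ : ∃ N, n.degree = N := ⟨_, rfl⟩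
  rw [hN]
  induction N generalizing n with
  | zero =>
    have hn : n = 0 := (Finsupp.degree_eq_zero_iff n).1 hN
    subst hn
    intro k m hkm a ha _
    obtain ⟨rfl, rfl⟩ : k = 0 ∧ m = 0 := by omega
    obtain ⟨x, rfl⟩ : ∃ x, a = C x := by
      rw [← totalDegree_zero_iff_isHomogeneous] at ha
      exact ⟨_, totalDegree_eq_zero_iff_eq_C.1 ha⟩
    simp only [pow_zero, mul_one, one_mul, lcoeff_apply, coeff_C_mul, coeff_zero_C]
    refine ⟨mul_self_nonneg x, fun h c _ => ?_⟩
    rw [mul_self_eq_zero.1 h, zero_mul]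
  | succ N ih =>
    obtain ⟨i, hi⟩ : ∃ i, n i ≠ 0 := by
      by_contra h
      push Not at h
      have : n = 0 := by ext i; exact h i
      simp [this] at hN
    obtain ⟨n', rfl⟩ : ∃ n', n = n' + Finsupp.single i 1 := by
      refine ⟨n - Finsupp.single i 1, (tsub_add_cancel_of_le ?_).symm⟩
      rw [Finsupp.single_le_iff]; omega
    have hd : n'.degree = N := by
      rw [map_add, Finsupp.degree_single] at hN; omega
    refine HR_deriv (lcoeff ℝ n') _ _ N hw i (κ i) (1 / (n' i + 1)) (hκ i) (by positivity) ?_ ?_ ?_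
      (ih n' hd)
    · rw [map_sum, Finset.sum_eq_single i]
      · simp
      · intro j _ hj; simp [pderiv_X_of_ne hj]
      · simp
    · intro p
      have : (n' i + 1 : ℝ) ≠ 0 := by positivity
      rw [lcoeff_apply, lcoeff_apply, coeff_pderiv]; field_simp
    · intro p
      rw [lcoeff_apply, lcoeff_apply, mul_comm, coeff_mul_X]
end ChowHL

namespace ChowHL
open Matrix

theorem pd_propagate {α : Type*} [Fintype α] [DecidableEq α] (H : ℝ → Matrix α α ℝ)
    (hc : ContinuousOn H (Set.Icc 0 1)) (hs : ∀ t, (H t)ᵀ = H t)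
    (hn : ∀ t ∈ Set.Ioc (0:ℝ) 1, ∀ v, H t *ᵥ v = 0 → v = 0)
    (h0 : ∀ v, v ≠ 0 → 0 < v ⬝ᵥ H 0 *ᵥ v) :
    ∀ t ∈ Set.Icc (0:ℝ) 1, ∀ v, v ≠ 0 → 0 < v ⬝ᵥ H t *ᵥ v := by
  set Q : ℝ × (α → ℝ) → ℝ := fun p => p.2 ⬝ᵥ H p.1 *ᵥ p.2 with hQ
  have hQc : ContinuousOn Q (Set.Icc 0 1 ×ˢ Set.univ) := by
    have h1 : ContinuousOn (fun p : ℝ × (α → ℝ) => H p.1) (Set.Icc 0 1 ×ˢ Set.univ) :=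
      hc.comp continuousOn_fst (fun p hp => hp.1)
    rw [continuousOn_iff_continuous_domRestrict] at h1 ⊢
    have h2 : Continuous (fun p : (Set.Icc (0:ℝ) 1 ×ˢ (Set.univ : Set (α → ℝ)) : Set _) => p.1.2) := by
      fun_prop
    exact h2.dotProduct (h1.matrix_mulVec h2)
  set K := (Set.Icc (0:ℝ) 1 ×ˢ Metric.sphere (0 : α → ℝ) 1) ∩ Q ⁻¹' Set.Iic 0 with hK
  have hcomp : IsCompact (Set.Icc (0:ℝ) 1 ×ˢ Metric.sphere (0 : α → ℝ) 1) :=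
    isCompact_Icc.prod (isCompact_sphere _ _)
  have hKc : IsCompact K := by
    refine hcomp.of_isClosed_subset ?_ Set.inter_subset_left
    exact ContinuousOn.preimage_isClosed_of_isClosed
      (hQc.mono (Set.prod_mono le_rfl (Set.subset_univ _))) hcomp.isClosed isClosed_Iic
  have hKe : K = ∅ := by
    by_contra hne
    rw [← Ne, ← Set.nonempty_iff_ne_empty] at hne
    obtain ⟨⟨t0, v0⟩, hm, hmin⟩ := hKc.exists_isMinOn hne continuous_fst.continuousOn
    obtain ⟨⟨ht0, hv0⟩, hq⟩ := hm
    simp only at ht0 hv0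
    have hv0' : v0 ≠ 0 := by
      rintro rfl; simp at hv0
    have hq' : v0 ⬝ᵥ H t0 *ᵥ v0 ≤ 0 := hq
    have htp : 0 < t0 := by
      rcases lt_or_eq_of_le ht0.1 with h | h
      · exact h
      · subst h; exact absurd (h0 v0 hv0') (not_lt.2 hq')
    have hlt : ∀ t ∈ Set.Ico 0 t0, ∀ v, 0 ≤ v ⬝ᵥ H t *ᵥ v := by
      intro t ht v
      by_contra hneg
      push Not at hneg
      have hv : v ≠ 0 := by rintro rfl; simp at hneg
      have hnv : ‖v‖ ≠ 0 := norm_ne_zero_iff.2 hv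
      have hmem : ((t, ‖v‖⁻¹ • v) : ℝ × (α → ℝ)) ∈ K := by
        refine ⟨⟨⟨ht.1, ht.2.le.trans ht0.2⟩, ?_⟩, ?_⟩
        · simp [norm_smul, hnv]
        · change (‖v‖⁻¹ • v) ⬝ᵥ H t *ᵥ (‖v‖⁻¹ • v) ≤ 0
          rw [mulVec_smul, smul_dotProduct, dotProduct_smul, smul_eq_mul, smul_eq_mul, ← mul_assoc]
          exact mul_nonpos_of_nonneg_of_nonpos (mul_self_nonneg _) hneg.le
      have := hmin hmem
      simp only [Set.mem_ofPred_eq] at this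
      exact absurd ht.2 (not_lt.2 this)
    have hpsd : ∀ v, 0 ≤ v ⬝ᵥ H t0 *ᵥ v := by
      intro v
      have hct : ContinuousOn (fun t => v ⬝ᵥ H t *ᵥ v) (Set.Icc 0 1) :=
        hQc.comp (f := fun t => (t, v)) (by fun_prop) (fun t ht => ⟨ht, trivial⟩)
      have h1 : ContinuousWithinAt (fun t => v ⬝ᵥ H t *ᵥ v) (Set.Ico 0 t0) t0 :=
        (hct t0 ht0).mono (fun t ht => ⟨ht.1, ht.2.le.trans ht0.2⟩)
      have h2 : t0 ∈ closure (Set.Ico 0 t0) := by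
        rw [closure_Ico htp.ne]; exact ⟨htp.le, le_rfl⟩
      have := ContinuousWithinAt.closure_le h2 continuousWithinAt_const h1
        (fun t ht => hlt t ht v)
      exact this
    have hPS : (H t0).PosSemidef := by
      refine PosSemidef.of_dotProduct_mulVec_nonneg ?_ (fun x => by simpa using hpsd x)
      rw [IsHermitian, conjTranspose_eq_transpose_of_trivial, hs]
    have := (hPS.dotProduct_mulVec_zero_iff v0).1 (by simpa using le_antisymm hq' (hpsd v0))
    exact hv0' (hn t0 ⟨htp, ht0.2⟩ v0 this)
  intro t ht v hv
  by_contra hneg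
  push Not at hneg
  have hnv : ‖v‖ ≠ 0 := norm_ne_zero_iff.2 hv
  have hmem : ((t, ‖v‖⁻¹ • v) : ℝ × (α → ℝ)) ∈ K := by
    refine ⟨⟨ht, ?_⟩, ?_⟩
    · simp [norm_smul, hnv]
    · change (‖v‖⁻¹ • v) ⬝ᵥ H t *ᵥ (‖v‖⁻¹ • v) ≤ 0
      rw [mulVec_smul, smul_dotProduct, dotProduct_smul, smul_eq_mul, smul_eq_mul, ← mul_assoc]
      exact mul_nonpos_of_nonneg_of_nonpos (mul_self_nonneg _) hneg
  rw [hKe] at hmem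
  exact hmem

theorem path_lemma {α β : Type*} [Fintype α] [DecidableEq α] [Fintype β] [DecidableEq β]
    (A : ℝ → Matrix α α ℝ) (B : ℝ → Matrix β α ℝ) (C : ℝ → Matrix β β ℝ)
    (hA : Continuous A) (hB : Continuous B) (hC : Continuous C)
    (hAs : ∀ t, (A t)ᵀ = A t) (hCs : ∀ t, (C t)ᵀ = C t)
    (hCn : ∀ t ∈ Set.Icc (0:ℝ) 1, ∀ v, C t *ᵥ v = 0 → v = 0)
    (hAn : ∀ t ∈ Set.Ioc (0:ℝ) 1, ∀ v, A t *ᵥ v = 0 → v = 0)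
    (hc : ∀ t ∈ Set.Ioc (0:ℝ) 1, ∀ u, ∃ c, A t *ᵥ c = (B t)ᵀ *ᵥ u ∧ B t *ᵥ c = C t *ᵥ u)
    (h0 : ∀ v u, C 0 *ᵥ u = B 0 *ᵥ v → 0 ≤ v ⬝ᵥ A 0 *ᵥ v - u ⬝ᵥ C 0 *ᵥ u ∧
      (v ⬝ᵥ A 0 *ᵥ v = 0 → u = 0 → v = 0)) :
    ∀ t ∈ Set.Icc (0:ℝ) 1, ∀ v, v ≠ 0 → B t *ᵥ v = 0 → 0 < v ⬝ᵥ A t *ᵥ v := by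
  have hdet : ∀ t ∈ Set.Icc (0:ℝ) 1, (C t).det ≠ 0 := by
    intro t ht h
    obtain ⟨v, hv, h⟩ := exists_mulVec_eq_zero_iff.2 h
    exact hv (hCn t ht v h)
  set H : ℝ → Matrix α α ℝ := fun t =>
    A t - (B t)ᵀ * (C t)⁻¹ * B t + ((C t)⁻¹ * B t)ᵀ * ((C t)⁻¹ * B t) with hH
  have hinv : ContinuousOn (fun t => (C t)⁻¹) (Set.Icc 0 1) := by
    have : (fun t => (C t)⁻¹) = fun t => ((C t).det)⁻¹ • (C t).adjugate := by
      funext t; rw [Matrix.inv_def, Ring.inverse_eq_inv']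
    rw [this]
    exact (ContinuousOn.inv₀ hC.matrix_det.continuousOn hdet).smul hC.matrix_adjugate.continuousOn
  have hHc : ContinuousOn H (Set.Icc 0 1) := by
    rw [continuousOn_iff_continuous_domRestrict] at hinv ⊢
    have e1 : Continuous (fun t : Set.Icc (0:ℝ) 1 => A t) := hA.comp continuous_subtype_val
    have e2 : Continuous (fun t : Set.Icc (0:ℝ) 1 => B t) := hB.comp continuous_subtype_val
    have e3 : Continuous (fun t : Set.Icc (0:ℝ) 1 => (C t)⁻¹) := hinv
    exact (e1.sub ((e2.matrix_transpose.matrix_mul e3).matrix_mul e2)).add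
      ((e3.matrix_mul e2).matrix_transpose.matrix_mul (e3.matrix_mul e2))
  have hCis : ∀ t, ((C t)⁻¹)ᵀ = (C t)⁻¹ := fun t => by rw [transpose_nonsing_inv, hCs]
  have hHs : ∀ t, (H t)ᵀ = H t := by
    intro t
    simp only [hH, transpose_add, transpose_sub, transpose_mul, hAs, hCis, transpose_transpose,
      Matrix.mul_assoc]
  have hval : ∀ t v x, x ⬝ᵥ H t *ᵥ v = x ⬝ᵥ A t *ᵥ v - (B t *ᵥ x) ⬝ᵥ ((C t)⁻¹ *ᵥ (B t *ᵥ v))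
      + ((C t)⁻¹ *ᵥ (B t *ᵥ x)) ⬝ᵥ ((C t)⁻¹ *ᵥ (B t *ᵥ v)) := by
    intro t v x
    simp only [hH, add_mulVec, sub_mulVec, dotProduct_add, dotProduct_sub, Matrix.mul_assoc]
    congr 1
    · congr 1
      rw [← mulVec_mulVec, dotProduct_mulVec, vecMul_transpose, mulVec_mulVec]
    · rw [← mulVec_mulVec, dotProduct_mulVec, vecMul_transpose, mulVec_mulVec, mulVec_mulVec]
  have hCC : ∀ t ∈ Set.Icc (0:ℝ) 1, ∀ y, C t *ᵥ ((C t)⁻¹ *ᵥ y) = y := by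
    intro t ht y
    rw [mulVec_mulVec, mul_nonsing_inv _ (isUnit_iff_ne_zero.2 (hdet t ht)), one_mulVec]
  have hCC' : ∀ t ∈ Set.Icc (0:ℝ) 1, ∀ y, (C t)⁻¹ *ᵥ (C t *ᵥ y) = y := by
    intro t ht y
    rw [mulVec_mulVec, nonsing_inv_mul _ (isUnit_iff_ne_zero.2 (hdet t ht)), one_mulVec]
  have key := pd_propagate H hHc hHs ?_ ?_
  · intro t ht v hv hBv
    have := key t ht v hv
    rw [hval, hBv] at this
    simpa using this
  · intro t ht v hv
    have htI : t ∈ Set.Icc (0:ℝ) 1 := ⟨ht.1.le, ht.2⟩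
    set u := (C t)⁻¹ *ᵥ (B t *ᵥ v) with hu
    obtain ⟨c, hc1, hc2⟩ := hc t ht u
    have h1 := hval t v c
    rw [hv, dotProduct_zero, ← hu, hc2, hCC' t htI] at h1
    have h2 : c ⬝ᵥ A t *ᵥ v = u ⬝ᵥ B t *ᵥ v := by
      rw [dotProduct_mulVec, ← mulVec_transpose, hAs, hc1, mulVec_transpose, ← dotProduct_mulVec]
    have h3 : (C t *ᵥ u) ⬝ᵥ u = u ⬝ᵥ B t *ᵥ v := by
      rw [dotProduct_comm, hu, hCC t htI]
    rw [h2, h3, sub_self, zero_add] at h1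
    have hu0 : u = 0 := dotProduct_self_eq_zero.1 h1.symm
    have hBv : B t *ᵥ v = 0 := by rw [← hCC t htI (B t *ᵥ v), ← hu, hu0, mulVec_zero]
    apply hAn t ht
    apply dotProduct_self_eq_zero.1
    have := hval t v (A t *ᵥ v)
    rw [hv, hBv] at this
    simpa using this.symm
  · intro v hv
    have h0I : (0:ℝ) ∈ Set.Icc (0:ℝ) 1 := by simp
    rw [hval]
    set u := (C 0)⁻¹ *ᵥ (B 0 *ᵥ v) with hu
    have hCu : C 0 *ᵥ u = B 0 *ᵥ v := hCC 0 h0I _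
    obtain ⟨h1, h2⟩ := h0 v u hCu
    rw [hCu] at h1
    rw [dotProduct_comm] at h1
    have h3 : 0 ≤ u ⬝ᵥ u := by
      simp only [dotProduct]; exact Finset.sum_nonneg fun i _ => mul_self_nonneg _
    rw [dotProduct_comm u] at h1
    by_cases hu0 : u = 0
    · rw [hu0] at h1 ⊢
      simp only [dotProduct_zero, sub_zero, add_zero] at h1 ⊢
      rw [dotProduct_comm] at h1
      refine lt_of_le_of_ne h1 (fun h => hv (h2 h.symm hu0))
    · have : u ⬝ᵥ u ≠ 0 := fun h => hu0 (dotProduct_self_eq_zero.1 h)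
      have : 0 < u ⬝ᵥ u := lt_of_le_of_ne h3 this.symm
      rw [dotProduct_comm v]
      linarith
end ChowHL

namespace ChowHL
open SimpleFlatMatroid MvPolynomial

variable {E : Type*} [Fintype E] [DecidableEq E] (M : SimpleFlatMatroid E)

theorem exists_cl {H : Finset E} (hH : H ∈ M.flats) {a : E} (ha : a ∉ H) :
    ∃ K ∈ M.flats, a ∈ K ∧ H ⊂ K ∧ M.rk K = M.rk H + 1 ∧
      ∀ G ∈ M.flats, H ⊆ G → a ∈ G → K ⊆ G := by
  obtain ⟨K, ⟨hK, haK, hHK, hno⟩, _⟩ := SimpleFlatMatroid.cover_axiom M H hH a ha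
  refine ⟨K, hK, haK, hHK, M.rk_cover H hH K hK hHK hno, fun G hG hHG haG => ?_⟩
  by_contra hne
  apply hno
  refine ⟨K ∩ G, M.inter_mem K hK G hG, ?_, ?_⟩
  · rw [Finset.ssubset_iff_of_subset (Finset.subset_inter hHK.1 hHG)]
    exact ⟨a, Finset.mem_inter.2 ⟨haK, haG⟩, ha⟩
  · refine Finset.ssubset_iff_subset_ne.2 ⟨Finset.inter_subset_left, fun h => hne ?_⟩
    rw [← h]; exact Finset.inter_subset_right

theorem rk_lt {H G : Finset E} (hH : H ∈ M.flats) (hG : G ∈ M.flats) (h : H ⊂ G) :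
    M.rk H < M.rk G := by
  obtain ⟨N, hN⟩ : ∃ N, G.card - H.card = N := ⟨_, rfl⟩
  induction N using Nat.strong_induction_on generalizing H with
  | _ N ih =>
    obtain ⟨a, haG, haH⟩ := Finset.exists_of_ssubset h
    obtain ⟨K, hK, haK, hHK, hrk, hmin⟩ := exists_cl M hH haH
    have hKG := hmin G hG h.1 haG
    rcases eq_or_ssubset_of_subset hKG with rfl | hKG'
    · omega
    · have h1 := Finset.card_lt_card hHK
      have h2 := Finset.card_lt_card hKG'
      have := ih (G.card - K.card) (by omega) hK hKG' rfl
      omega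

theorem rk_le {H G : Finset E} (hH : H ∈ M.flats) (hG : G ∈ M.flats) (h : H ⊆ G) :
    M.rk H ≤ M.rk G := by
  rcases eq_or_ssubset_of_subset h with rfl | h
  · rfl
  · exact (rk_lt M hH hG h).le

theorem exists_basis {P G : Finset E} (hP : P ∈ M.flats) (hG : G ∈ M.flats) (h : P ⊆ G) :
    ∃ B ⊆ G, Disjoint B P ∧ M.rk P + B.card = M.rk G ∧
      ∀ K ∈ M.flats, P ⊆ K → B ⊆ K → G ⊆ K := by
  obtain ⟨N, hN⟩ : ∃ N, G.card - P.card = N := ⟨_, rfl⟩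
  induction N using Nat.strong_induction_on generalizing P with
  | _ N ih =>
    rcases eq_or_ssubset_of_subset h with rfl | h'
    · exact ⟨∅, by simp, by simp, by simp, fun K _ h _ => h⟩
    obtain ⟨a, haG, haH⟩ := Finset.exists_of_ssubset h'
    obtain ⟨K, hK, haK, hHK, hrk, hmin⟩ := exists_cl M hP haH
    have hKG := hmin G hG h haG
    have h1 := Finset.card_lt_card hHK
    have h2 := Finset.card_le_card hKG
    obtain ⟨B, hB, hd, hc, hcl⟩ := ih (G.card - K.card) (by omega) hK hKG rfl
    have haB : a ∉ B := fun hh => Finset.disjoint_left.1 hd hh haK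
    refine ⟨insert a B, Finset.insert_subset haG hB, ?_, ?_, ?_⟩
    · rw [Finset.disjoint_insert_left]
      exact ⟨haH, hd.mono_right hHK.1⟩
    · rw [Finset.card_insert_of_notMem haB]; omega
    · intro L hL hPL hBL
      rw [Finset.insert_subset_iff] at hBL
      exact hcl L hL (hmin L hL hPL hBL.1) hBL.2

/-- Sum of the variables of flats strictly above `G`. -/
noncomputable def BB (G : Finset E) : ChowPolyR M :=
  ∑ F : FlatVar M, if G ⊂ F.1 then X F else 0

/-- The linear relation at `a`. -/
noncomputable def LL (a : E) : ChowPolyR M :=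
  ∑ F : FlatVar M, if a ∈ F.1 then X F else 0

open Classical in
/-- The degree functional of the matroid contracted at `H`. -/
noncomputable def DD (H : Finset E) : ChowPolyR M →ₗ[ℝ] ℝ :=
  (basisMonomials (FlatVar M) ℝ).constr ℝ fun m =>
    (if m = 0 ∧ H = Finset.univ then 1 else 0) +
    ∑ G : FlatVar M, if h : H ⊂ G.1 ∧ m G ≠ 0 ∧ ∀ F, m F ≠ 0 → G.1 ⊆ F.1 then
      (-1) ^ (m G - 1) * ((m G - 1).choose (M.rk G.1 - M.rk H - 1) : ℝ) *
        DD G.1 (BB M G.1 ^ (m G - (M.rk G.1 - M.rk H)) * monomial (m.erase G) 1) else 0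
termination_by (Finset.univ : Finset E).card - H.card
decreasing_by
  have h1 := Finset.card_lt_card h.1
  have h2 := Finset.card_le_univ G.1
  rw [← Finset.card_univ] at h2
  omega

open Classical in
theorem DD_monomial (H : Finset E) (m : FlatVar M →₀ ℕ) : DD M H (monomial m 1) =
    (if m = 0 ∧ H = Finset.univ then 1 else 0) +
    ∑ G : FlatVar M, if H ⊂ G.1 ∧ m G ≠ 0 ∧ ∀ F, m F ≠ 0 → G.1 ⊆ F.1 then
      (-1) ^ (m G - 1) * ((m G - 1).choose (M.rk G.1 - M.rk H - 1) : ℝ) *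
        DD M G.1 (BB M G.1 ^ (m G - (M.rk G.1 - M.rk H)) * monomial (m.erase G) 1) else 0 := by
  rw [DD]
  have : (monomial m (1:ℝ)) = basisMonomials (FlatVar M) ℝ m := by simp
  rw [this, Module.Basis.constr_basis]
  simp

variable {M}

theorem lin_ext {ι : Type*} {l l' : MvPolynomial ι ℝ →ₗ[ℝ] ℝ} {q q' : MvPolynomial ι ℝ}
    (h : ∀ m, l (q * monomial m 1) = l' (q' * monomial m 1)) (p : MvPolynomial ι ℝ) :
    l (q * p) = l' (q' * p) := by
  have : l ∘ₗ LinearMap.mulLeft ℝ q = l' ∘ₗ LinearMap.mulLeft ℝ q' := by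
    apply (basisMonomials ι ℝ).ext
    intro m
    simpa using h m
  exact LinearMap.congr_fun this p

theorem lin_ext0 {ι : Type*} {l : MvPolynomial ι ℝ →ₗ[ℝ] ℝ} {q : MvPolynomial ι ℝ}
    (h : ∀ m, l (q * monomial m 1) = 0) (p : MvPolynomial ι ℝ) :
    l (q * p) = 0 := by
  have := lin_ext (l := l) (l' := 0) (q := q) (q' := 0) (by simpa using h) p
  simpa using this

theorem DD_Z {H : Finset E} {F : FlatVar M} (h : ¬ H ⊂ F.1) (p : ChowPolyR M) :
    DD M H (X F * p) = 0 := by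
  classical
  apply lin_ext0
  intro m
  rw [X, monomial_mul, one_mul, DD_monomial, if_neg, zero_add]
  · apply Finset.sum_eq_zero
    intro G _
    rw [if_neg]
    rintro ⟨h1, h2, h3⟩
    exact h (h1.trans_subset (h3 F (by simp)))
  · rintro ⟨h1, -⟩
    have := DFunLike.congr_fun h1 F
    simp at this

theorem mono_split {ι : Type*} (m : ι →₀ ℕ) (F : ι) (h : m F ≠ 0) :
    (monomial m 1 : MvPolynomial ι ℝ) = X F * monomial (m - Finsupp.single F 1) 1 := by
  rw [X, monomial_mul, one_mul, add_tsub_cancel_of_le]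
  rw [Finsupp.single_le_iff]; omega

theorem mono_split2 {ι : Type*} (m : ι →₀ ℕ) (F F' : ι) (hne : F ≠ F') (h : m F ≠ 0) (h' : m F' ≠ 0) :
    ∃ q : MvPolynomial ι ℝ, (monomial m 1 : MvPolynomial ι ℝ) = X F * (X F' * q) := by
  classical
  have h2 : (m - Finsupp.single F 1 : ι →₀ ℕ) F' ≠ 0 := by
    simpa [Finsupp.single_apply, hne] using h'
  exact ⟨_, by rw [mono_split m F h, mono_split _ F' h2]⟩

theorem DD_I (H : Finset E) {F F' : FlatVar M} (h1 : ¬ F.1 ⊆ F'.1) (h2 : ¬ F'.1 ⊆ F.1)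
    (p : ChowPolyR M) : DD M H (X F * (X F' * p)) = 0 := by
  classical
  obtain ⟨N, hN⟩ : ∃ N, (Finset.univ : Finset E).card - H.card = N := ⟨_, rfl⟩
  have hne : F ≠ F' := by rintro rfl; exact h1 subset_rfl
  induction N using Nat.strong_induction_on generalizing H p with
  | _ N ih =>
  rw [← mul_assoc]
  apply lin_ext0
  intro m
  obtain ⟨m', hm', hF, hF'⟩ : ∃ m', (X F * X F' * monomial m 1 : ChowPolyR M) = monomial m' 1 ∧
      m' F ≠ 0 ∧ m' F' ≠ 0 := by
    refine ⟨Finsupp.single F 1 + Finsupp.single F' 1 + m, ?_, by simp, by simp⟩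
    simp [X, monomial_mul]
  rw [hm', DD_monomial, if_neg, zero_add]
  · apply Finset.sum_eq_zero
    intro G _
    split_ifs with hG
    · obtain ⟨g1, g2, g3⟩ := hG
      have e1 : F ≠ G := by rintro rfl; exact h1 (g3 F' hF')
      have e2 : F' ≠ G := by rintro rfl; exact h2 (g3 F hF)
      obtain ⟨q, hq⟩ := mono_split2 (m'.erase G) F F' hne (by simpa [Finsupp.erase_ne e1] using hF)
        (by simpa [Finsupp.erase_ne e2] using hF')
      rw [hq]
      have c1 := Finset.card_lt_card g1
      have c2 := Finset.card_le_univ G.1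
      rw [← Finset.card_univ] at c2
      rw [mul_left_comm, mul_left_comm _ (X F'), ih _ (by omega) G.1 _ rfl, mul_zero]
    · rfl
  · rintro ⟨h1, -⟩
    have := DFunLike.congr_fun h1 F
    simp at this
    exact hF this

/-- polynomials in the variables not below `G`. -/
noncomputable def Sup (M : SimpleFlatMatroid E) (G : Finset E) : Subalgebra ℝ (ChowPolyR M) :=
  supported ℝ {F : FlatVar M | ¬ F.1 ⊆ G}

theorem X_mem_Sup {G : Finset E} {F : FlatVar M} (h : ¬ F.1 ⊆ G) : (X F : ChowPolyR M) ∈ Sup M G :=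
  (X_mem_supported (R := ℝ)).2 h

theorem BB_mem_Sup (G : Finset E) : BB M G ∈ Sup M G := by
  refine Subalgebra.sum_mem _ fun F _ => ?_
  split_ifs with h
  · exact X_mem_Sup h.2
  · exact zero_mem _

theorem Sup_mono {G G' : Finset E} (h : G ⊆ G') : Sup M G' ≤ Sup M G :=
  supported_mono fun _ hF hF' => hF (hF'.trans h)

theorem DD_R_mono {H : Finset E} {G : FlatVar M} (hHG : H ⊂ G.1) (e : ℕ) (m : FlatVar M →₀ ℕ)
    (hm : ∀ F, m F ≠ 0 → ¬ F.1 ⊆ G.1) :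
    DD M H (X G ^ (e + 1) * monomial m 1) = (-1) ^ e * (e.choose (M.rk G.1 - M.rk H - 1) : ℝ) *
      DD M G.1 (BB M G.1 ^ (e + 1 - (M.rk G.1 - M.rk H)) * monomial m 1) := by
  classical
  by_cases hall : ∀ F, m F ≠ 0 → G.1 ⊆ F.1
  · have hG0 : m G = 0 := by
      by_contra h; exact hm G h subset_rfl
    set m' := Finsupp.single G (e + 1) + m with hm'
    have hmG : m' G = e + 1 := by simp [hm', hG0]
    have hmF : ∀ F, F ≠ G → m' F = m F := fun F hF => by simp [hm', hF.symm]
    have he : m'.erase G = m := by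
      ext F
      by_cases hF : F = G
      · subst hF; simp [hG0]
      · rw [Finsupp.erase_ne hF, hmF F hF]
    have : (X G ^ (e + 1) * monomial m 1 : ChowPolyR M) = monomial m' 1 := by
      rw [X_pow_eq_monomial, monomial_mul, one_mul]
    rw [this, DD_monomial, if_neg, zero_add, Finset.sum_eq_single G, if_pos, hmG, he]
    · rfl
    · refine ⟨hHG, by omega, fun F hF => ?_⟩
      by_cases hFG : F = G
      · rw [hFG]
      · exact hall F (by rwa [hmF F hFG] at hF)
    · intro G' _ hne
      rw [if_neg]
      rintro ⟨h1, h2, h3⟩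
      rw [hmF G' hne] at h2
      exact hm G' h2 (h3 G (by omega))
    · simp
    · rintro ⟨h, -⟩
      rw [h] at hmG; simp at hmG
  · push Not at hall
    obtain ⟨F, hF, hGF⟩ := hall
    rw [mono_split m F hF, pow_succ, mul_assoc, mul_comm, mul_assoc, mul_assoc,
      DD_I H hGF (hm F hF), mul_left_comm, DD_Z (fun h => hGF h.1), mul_zero]

theorem DD_R {H : Finset E} {G : FlatVar M} (hHG : H ⊂ G.1) (e : ℕ) (q : ChowPolyR M)
    (hq : q ∈ Sup M G.1) :
    DD M H (X G ^ (e + 1) * q) = (-1) ^ e * (e.choose (M.rk G.1 - M.rk H - 1) : ℝ) *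
      DD M G.1 (BB M G.1 ^ (e + 1 - (M.rk G.1 - M.rk H)) * q) := by
  classical
  rw [q.as_sum, Finset.mul_sum, Finset.mul_sum, map_sum, map_sum, Finset.mul_sum]
  apply Finset.sum_congr rfl
  intro m hm
  have h1 : monomial m (coeff m q) = coeff m q • (monomial m (1:ℝ)) := by
    rw [smul_monomial, smul_eq_mul, mul_one]
  rw [h1, mul_smul_comm, mul_smul_comm, map_smul, map_smul, DD_R_mono hHG]
  · simp only [smul_eq_mul]; ring
  · intro F hF
    have := (mem_supported).1 hq
    exact this (by
      rw [Finset.mem_coe, mem_vars_iff_mem_support]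
      exact ⟨m, hm, Finsupp.mem_support_iff.2 hF⟩)
end ChowHL

namespace ChowHL
open SimpleFlatMatroid MvPolynomial

variable {E : Type*} [Fintype E] [DecidableEq E] {M : SimpleFlatMatroid E}

theorem exists_min_chain (s : Finset (FlatVar M)) (hs : s.Nonempty)
    (hc : ∀ F ∈ s, ∀ F' ∈ s, F.1 ⊆ F'.1 ∨ F'.1 ⊆ F.1) : ∃ G ∈ s, ∀ F ∈ s, G.1 ⊆ F.1 := by
  obtain ⟨G, hG, hmin⟩ := s.exists_min_image (fun F => F.1.card) hs
  refine ⟨G, hG, fun F hF => ?_⟩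
  rcases hc G hG F hF with h | h
  · exact h
  · rw [Finset.eq_of_subset_of_card_le h (hmin F hF)]

theorem DD_L_aux1 {H : Finset E} (hH : H ∈ M.flats) {a : E} (ha : a ∉ H) (G : FlatVar M)
    (hHG : H ⊂ G.1) (haG : a ∈ G.1) (e : ℕ) (Q : ChowPolyR M) (hQ : Q ∈ Sup M G.1) :
    DD M H (LL M a * (X G ^ (e + 1) * Q)) = 0 := by
  classical
  obtain ⟨K, hK, haK, hHK, hrk, hmin⟩ := exists_cl M hH ha
  let K' : FlatVar M := ⟨K, hK, fun h => by simp [h] at haK⟩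
  have hKG : K ⊆ G.1 := hmin G.1 G.2.1 hHG.1 haG
  set ρ := M.rk G.1 - M.rk H with hρ
  have hρ1 := rk_lt M hH G.2.1 hHG
  set V := DD M G.1 (BB M G.1 ^ (e + 2 - ρ) * Q) with hV
  set T1 := DD M H (X G ^ (e + 2) * Q) with hT1
  set T3 := DD M K (X G ^ (e + 1) * Q) with hT3
  have hterm : ∀ F : FlatVar M, DD M H ((if a ∈ F.1 then X F else 0) * (X G ^ (e + 1) * Q)) =
      (if F = G then T1 else 0) +
      DD M H (X G ^ (e + 1) * ((if G.1 ⊂ F.1 then X F else 0) * Q)) +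
      (if F = K' then (if K' ≠ G then T3 else 0) else 0) := by
    intro F
    by_cases h1 : F = G
    · subst h1
      rw [if_pos haG, if_pos rfl, if_neg (fun h => h.2 subset_rfl)]
      have : (if F = K' then (if K' ≠ F then T3 else 0) else 0) = 0 := by
        split_ifs with h2 h3
        · exact absurd h2.symm h3
        · rfl
        · rfl
      rw [this, hT1]; simp only [zero_mul, mul_zero, map_zero, add_zero]
      congr 1; ring
    · rw [if_neg h1]
      by_cases h2 : G.1 ⊂ F.1
      · rw [if_pos (h2.1 haG), if_pos h2, if_neg, zero_add, add_zero]
        · congr 1; ring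
        · rintro rfl; exact h2.2 hKG
      · rw [if_neg h2]
        have h3 : ¬ G.1 ⊆ F.1 := fun h => h2 ⟨h, fun h' => h1 (Subtype.ext (h'.antisymm h))⟩
        simp only [zero_mul, mul_zero, map_zero, add_zero, zero_add]
        by_cases h4 : a ∈ F.1
        · rw [if_pos h4]
          by_cases h5 : F.1 ⊆ G.1
          · have h5' : F.1 ⊂ G.1 := ⟨h5, h3⟩
            by_cases h6 : H ⊂ F.1
            · have hR := DD_R (M := M) h6 0 (X G ^ (e + 1) * Q)
                (mul_mem (pow_mem (X_mem_Sup h3) _) (Sup_mono h5 hQ))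
              rw [zero_add, pow_one] at hR
              rw [hR]
              have hKF := hmin F.1 F.2.1 h6.1 h4
              by_cases h7 : F = K'
              · have h8 : K' ≠ G := h7 ▸ h1
                rw [if_pos h7, if_pos h8, h7]
                have : M.rk K'.1 - M.rk H = 1 := by change M.rk K - _ = _; omega
                rw [this]; simp; rfl
              · rw [if_neg h7]
                have h8 : K ⊂ F.1 := ⟨hKF, fun h => h7 (Subtype.ext (h.antisymm hKF))⟩
                have := rk_lt M hK F.2.1 h8
                rw [Nat.choose_eq_zero_of_lt (by omega)]; simp
            · rw [DD_Z h6, if_neg]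
              rintro rfl; exact h6 hHK
          · rw [pow_succ', mul_assoc, DD_I H h5 h3, if_neg]
            rintro rfl; exact h5 hKG
        · rw [if_neg h4, if_neg]
          · simp
          · rintro rfl; exact h4 haK
  rw [LL, Finset.sum_mul, map_sum, Finset.sum_congr rfl (fun F _ => hterm F),
    Finset.sum_add_distrib, Finset.sum_add_distrib, Finset.sum_ite_eq', if_pos (Finset.mem_univ _),
    ← map_sum, ← Finset.mul_sum, ← Finset.sum_mul, Finset.sum_ite_eq', if_pos (Finset.mem_univ _)]
  change T1 + DD M H (X G ^ (e + 1) * (BB M G.1 * Q)) + _ = 0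
  rw [DD_R hHG e _ (mul_mem (BB_mem_Sup _) hQ), hT1, DD_R hHG (e + 1) _ hQ, ← hρ]
  change _ * V + _ + _ = 0
  have hmid : (e.choose (ρ - 1) : ℝ) * DD M G.1 (BB M G.1 ^ (e + 1 - ρ) * (BB M G.1 * Q)) =
      (e.choose (ρ - 1) : ℝ) * V := by
    by_cases h : ρ ≤ e + 1
    · rw [hV, ← mul_assoc (BB M G.1 ^ _), ← pow_succ]
      congr 5; omega
    · rw [Nat.choose_eq_zero_of_lt (by omega)]; simp
  rw [mul_assoc ((-1) ^ e), hmid]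
  by_cases hKG' : K' = G
  · have : ρ = 1 := by rw [hρ, ← hKG']; change M.rk K - _ = _; omega
    rw [if_neg (by simpa using hKG'), this]; simp; ring
  · have hss : K ⊂ G.1 := ⟨hKG, fun h => hKG' (Subtype.ext (hKG.antisymm h))⟩
    rw [if_pos hKG', hT3, DD_R hss e _ hQ]
    have := rk_lt M hK G.2.1 hss
    obtain ⟨s, hs⟩ : ∃ s, ρ = s + 2 := ⟨ρ - 2, by omega⟩
    have e1 : M.rk G.1 - M.rk K = s + 1 := by omega
    have e2 : e + 1 - (s + 1) = e + 2 - ρ := by omega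
    rw [e1, e2, ← hV, hs]
    simp only [Nat.add_sub_cancel, show s + 2 - 1 = s + 1 by omega, Nat.choose_succ_succ]
    push_cast; ring

theorem DD_L {H : Finset E} (hH : H ∈ M.flats) {a : E} (ha : a ∉ H) (T : FlatVar M)
    (hT : T.1 = Finset.univ) (p : ChowPolyR M) : DD M H (X T * LL M a * p) = 0 := by
  classical
  obtain ⟨N, hN⟩ : ∃ N, (Finset.univ : Finset E).card - H.card = N := ⟨_, rfl⟩
  induction N using Nat.strong_induction_on generalizing H p with
  | _ N ih =>
  apply lin_ext0
  intro m
  obtain ⟨m0, hm0, hT0⟩ : ∃ m0, (X T * LL M a * monomial m 1 : ChowPolyR M) =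
      LL M a * monomial m0 1 ∧ m0 T ≠ 0 := by
    refine ⟨Finsupp.single T 1 + m, ?_, by simp⟩
    have : (monomial (Finsupp.single T 1 + m) 1 : ChowPolyR M) = X T * monomial m 1 := by
      simp [X, monomial_mul]
    rw [this]; ring
  rw [hm0]
  by_cases hch : ∀ F ∈ m0.support, ∀ F' ∈ m0.support, F.1 ⊆ F'.1 ∨ F'.1 ⊆ F.1
  swap
  · push Not at hch
    obtain ⟨F, hF, F', hF', h1, h2⟩ := hch
    rw [Finsupp.mem_support_iff] at hF hF'
    obtain ⟨q, hq⟩ := mono_split2 m0 F F' (by rintro rfl; exact h1 subset_rfl) hF hF'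
    rw [hq, mul_left_comm, mul_left_comm _ (X F'), DD_I H h1 h2]
  by_cases hab : ∀ F ∈ m0.support, H ⊂ F.1
  swap
  · push Not at hab
    obtain ⟨F, hF, h1⟩ := hab
    rw [Finsupp.mem_support_iff] at hF
    rw [mono_split m0 F hF, mul_left_comm, DD_Z h1]
  obtain ⟨G, hG, hGmin⟩ := exists_min_chain m0.support ⟨T, by simpa using hT0⟩ hch
  have hHG := hab G hG
  rw [Finsupp.mem_support_iff] at hG
  obtain ⟨e, he⟩ := Nat.exists_eq_succ_of_ne_zero hG
  set Q : ChowPolyR M := monomial (m0.erase G) 1 with hQ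
  have hP : (monomial m0 1 : ChowPolyR M) = X G ^ (e + 1) * Q := by
    rw [hQ, X_pow_eq_monomial, monomial_mul, one_mul]
    rw [← Nat.succ_eq_add_one, ← he, Finsupp.single_add_erase G m0]
  have hQS : Q ∈ Sup M G.1 := by
    rw [Sup, mem_supported, hQ, vars_monomial one_ne_zero]
    intro F hF
    simp only [Finsupp.support_erase, Finset.coe_erase, Set.mem_sdiff, Finset.mem_coe,
      Set.mem_singleton_iff] at hF
    exact fun h => hF.2 (Subtype.ext (h.antisymm (hGmin F hF.1)))
  rw [hP]
  by_cases haG : a ∈ G.1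
  · exact DD_L_aux1 hH ha G hHG haG e Q hQS
  · have hTG : T ≠ G := by rintro rfl; rw [hT] at haG; simp at haG
    have hterm : ∀ F : FlatVar M, DD M H ((if a ∈ F.1 then X F else 0) * (X G ^ (e + 1) * Q)) =
        (-1) ^ e * (e.choose (M.rk G.1 - M.rk H - 1) : ℝ) *
      DD M G.1 (BB M G.1 ^ (e + 1 - (M.rk G.1 - M.rk H)) * ((if a ∈ F.1 then X F else 0) * Q)) := by
      intro F
      by_cases h1 : a ∈ F.1
      · rw [if_pos h1]
        have h3 : ¬ F.1 ⊆ G.1 := fun h => haG (h h1)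
        by_cases h2 : G.1 ⊆ F.1
        · rw [mul_left_comm, DD_R hHG e _ (mul_mem (X_mem_Sup h3) hQS)]
        · rw [pow_succ', mul_assoc, DD_I H h3 h2, mul_left_comm, DD_Z (fun h => h2 h.1), mul_zero]
      · simp [h1]
    rw [LL, Finset.sum_mul, map_sum, Finset.sum_congr rfl (fun F _ => hterm F), ← Finset.mul_sum,
      ← map_sum, ← Finset.mul_sum, ← Finset.sum_mul]
    have hTQ : Q = X T * monomial (m0.erase G - Finsupp.single T 1) 1 := by
      rw [hQ, mono_split]
      rwa [Finsupp.erase_ne hTG]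
    have c1 := Finset.card_lt_card hHG
    have c2 := Finset.card_le_univ G.1
    rw [← Finset.card_univ] at c2
    have := ih _ (by omega) G.2.1 haG
      (BB M G.1 ^ (e + 1 - (M.rk G.1 - M.rk H)) * monomial (m0.erase G - Finsupp.single T 1) 1) rfl
    rw [hTQ]
    rw [LL] at this
    convert mul_zero _ using 2
    rw [← this]; congr 1; ring
end ChowHL

namespace ChowHL
open SimpleFlatMatroid MvPolynomial

theorem binom_inv (g r : ℕ) :
    ∑ i ∈ Finset.range (g + 1), (-1 : ℝ) ^ i * (g.choose i : ℝ) * (i.choose r : ℝ) =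
      if g = r then (-1) ^ g else 0 := by
  have h : (∑ i ∈ Finset.range (g + 1), (Polynomial.C ((-1 : ℝ) ^ i * (g.choose i : ℝ))) *
      (1 + Polynomial.X) ^ i) = Polynomial.C ((-1) ^ g) * Polynomial.X ^ g := by
    have h1 : (-Polynomial.X : Polynomial ℝ) ^ g = (-(1 + Polynomial.X) + 1) ^ g := by
      congr 1; ring
    rw [map_pow, map_neg, map_one, ← mul_pow, neg_one_mul, h1, add_pow]
    apply Finset.sum_congr rfl
    intro i _
    rw [neg_pow (1 + Polynomial.X : Polynomial ℝ)]
    simp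
    ring
  have := congrArg (fun p => Polynomial.coeff p r) h
  simp only [Polynomial.finsetSum_coeff, Polynomial.coeff_C_mul, Polynomial.coeff_one_add_X_pow,
    Polynomial.coeff_X_pow] at this
  rw [this]
  simp [eq_comm]

variable {E : Type*} [Fintype E] [DecidableEq E] {M : SimpleFlatMatroid E}

theorem DD_ideal {T : FlatVar M} (hT : T.1 = Finset.univ) {q : ChowPolyR M}
    (hq : q ∈ chowIdealR M) : DD M ∅ (X T * q) = 0 := by
  suffices h : ∀ c, DD M ∅ (X T * (c * q)) = 0 by simpa using h 1
  unfold chowIdealR at hq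
  induction hq using Submodule.span_induction with
  | mem x hx =>
    intro c
    rcases hx with ⟨F, F', h1, h2, rfl⟩ | ⟨a, rfl⟩
    · have : X T * (c * (X F * X F')) = X F * (X F' * (X T * c)) := by ring
      rw [this, DD_I _ h1 h2]
    · rw [mul_comm c, ← mul_assoc]
      exact DD_L M.empty_mem (by simp) T hT c
  | zero => simp
  | add x y _ _ hx hy =>
    intro c
    rw [mul_add, mul_add, map_add, hx, hy, add_zero]
  | smul a x _ hx =>
    intro c
    rw [smul_eq_mul, ← mul_assoc c]; exact hx _

/-- nef generator. -/
noncomputable def hh (M : SimpleFlatMatroid E) (Q : Finset E) : ChowPolyR M :=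
  ∑ L : FlatVar M, if Q ⊆ L.1 then - X L else 0

theorem hh_eq (Q : FlatVar M) : hh M Q.1 = - X Q - BB M Q.1 := by
  classical
  rw [hh, BB]
  have : ∀ L : FlatVar M, (if Q.1 ⊆ L.1 then - X L else 0 : ChowPolyR M) =
      (if L = Q then - X L else 0) - (if Q.1 ⊂ L.1 then X L else 0) := by
    intro L
    by_cases h : L = Q
    · subst h; simp
    · rw [if_neg h]
      by_cases h2 : Q.1 ⊆ L.1
      · rw [if_pos h2, if_pos ⟨h2, fun h' => h (Subtype.ext (h'.antisymm h2))⟩]; simp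
      · rw [if_neg h2, if_neg (fun h => h2 h.1)]; simp
  rw [Finset.sum_congr rfl (fun L _ => this L), Finset.sum_sub_distrib, Finset.sum_ite_eq',
    if_pos (Finset.mem_univ _)]

open Classical in
/-- The adapted variables. -/
noncomputable def uu (σ : Finset (FlatVar M)) (G : FlatVar M) : ChowPolyR M :=
  if G ∈ σ then hh M G.1 else - X G

open Classical in
noncomputable def yy (σ : Finset (FlatVar M)) (g : FlatVar M → ℕ) (G : FlatVar M) : ChowPolyR M :=
  (if G ∈ σ then X G else 1) * uu σ G ^ g G

noncomputable def YY (σ : Finset (FlatVar M)) (g : FlatVar M → ℕ) (P : Finset E) : ChowPolyR M :=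
  ∏ G : FlatVar M, if P ⊂ G.1 then yy σ g G else 1

noncomputable def ZZ (σ : Finset (FlatVar M)) (g : FlatVar M → ℕ) (P : Finset E) : ℝ :=
  DD M P (YY σ g P)

theorem uu_mem_Sup (σ : Finset (FlatVar M)) {P : Finset E} {G : FlatVar M} (h : ¬ G.1 ⊆ P) :
    uu σ G ∈ Sup M P := by
  unfold uu
  split_ifs
  · rw [hh]
    refine Subalgebra.sum_mem _ fun F _ => ?_
    split_ifs with h1
    · exact neg_mem (X_mem_Sup fun h2 => h (h1.trans h2))
    · exact zero_mem _
  · exact neg_mem (X_mem_Sup h)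

theorem YY_mem_Sup (σ : Finset (FlatVar M)) (g : FlatVar M → ℕ) (P : Finset E) :
    YY σ g P ∈ Sup M P := by
  refine Subalgebra.prod_mem _ fun G _ => ?_
  split_ifs with h
  · refine mul_mem ?_ (pow_mem (uu_mem_Sup σ h.2) _)
    split_ifs
    · exact X_mem_Sup h.2
    · exact one_mem _
  · exact one_mem _

theorem ZZ_univ (σ : Finset (FlatVar M)) (g : FlatVar M → ℕ) : ZZ σ g Finset.univ = 1 := by
  classical
  have h : ∀ G : FlatVar M, ¬ (Finset.univ ⊂ G.1) := fun G h => h.2 (Finset.subset_univ _)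
  rw [ZZ, YY]
  simp only [h, if_false, Finset.prod_const_one]
  have := DD_monomial M Finset.univ 0
  rw [show (1 : ChowPolyR M) = monomial 0 1 from rfl, this]
  simp

theorem yy_dvd (σ : Finset (FlatVar M)) (g : FlatVar M → ℕ) (G : FlatVar M)
    (h : g G ≠ 0 ∨ G ∈ σ) : X G ∣ yy σ g G := by
  unfold yy uu
  by_cases hG : G ∈ σ
  · rw [if_pos hG]; exact dvd_mul_right _ _
  · have := h.resolve_right hG
    rw [if_neg hG, if_neg hG, one_mul]
    exact (dvd_neg.2 dvd_rfl).trans (dvd_pow_self _ this)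

theorem ZZ_incomp (σ : Finset (FlatVar M)) (g : FlatVar M → ℕ) (P : Finset E) {F F' : FlatVar M}
    (hF : P ⊂ F.1) (hF' : P ⊂ F'.1) (h : g F ≠ 0 ∨ F ∈ σ) (h' : g F' ≠ 0 ∨ F' ∈ σ)
    (hne : ZZ σ g P ≠ 0) : F.1 ⊆ F'.1 ∨ F'.1 ⊆ F.1 := by
  classical
  by_contra hc
  push Not at hc
  apply hne
  have hFF : F' ≠ F := by rintro rfl; exact hc.1 subset_rfl
  rw [ZZ, YY, ← Finset.mul_prod_erase _ _ (Finset.mem_univ F), ← Finset.mul_prod_erase _ _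
    (Finset.mem_erase.2 ⟨hFF, Finset.mem_univ F'⟩), if_pos hF, if_pos hF']
  obtain ⟨q, hq⟩ := yy_dvd σ g F h
  obtain ⟨q', hq'⟩ := yy_dvd σ g F' h'
  rw [hq, hq', mul_assoc, mul_left_comm q, mul_assoc, DD_I P hc.1 hc.2]

theorem YY_split (σ : Finset (FlatVar M)) (g : FlatVar M → ℕ) (P : Finset E) (G : FlatVar M)
    (hG : P ⊂ G.1) (hmin : ∀ F : FlatVar M, P ⊂ F.1 → (g F ≠ 0 ∨ F ∈ σ) → G.1 ⊆ F.1) :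
    YY σ g P = yy σ g G * YY σ g G.1 := by
  classical
  rw [YY, YY, ← Finset.mul_prod_erase _ _ (Finset.mem_univ G), if_pos hG,
    ← Finset.mul_prod_erase (s := Finset.univ) (f := fun F => if G.1 ⊂ F.1 then _ else _)
      (Finset.mem_univ G), if_neg (fun h => h.2 subset_rfl), one_mul]
  congr 1
  apply Finset.prod_congr rfl
  intro F hF
  have hFG := (Finset.mem_erase.1 hF).1
  by_cases h2 : G.1 ⊂ F.1
  · rw [if_pos h2, if_pos (hG.trans h2)]
  · rw [if_neg h2]
    split_ifs with h3
    · have : ¬ (g F ≠ 0 ∨ F ∈ σ) := fun h =>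
        h2 ⟨hmin F h3 h, fun h' => hFG (Subtype.ext (h'.antisymm (hmin F h3 h)))⟩
      push Not at this
      rw [yy, this.1, if_neg this.2]; simp
    · rfl

theorem ZZ_notmem (σ : Finset (FlatVar M)) (g : FlatVar M → ℕ) {P : Finset E} (hP : P ∈ M.flats)
    (G : FlatVar M)
    (hG : P ⊂ G.1) (hmin : ∀ F : FlatVar M, P ⊂ F.1 → (g F ≠ 0 ∨ F ∈ σ) → G.1 ⊆ F.1)
    (hGσ : G ∉ σ) (hg : g G ≠ 0) :
    (g G < M.rk G.1 - M.rk P → ZZ σ g P = 0) ∧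
    (g G = M.rk G.1 - M.rk P → ZZ σ g P = - ZZ σ g G.1) := by
  have hrk := rk_lt M hP G.2.1 hG
  obtain ⟨e, he⟩ := Nat.exists_eq_succ_of_ne_zero hg
  have h1 : ZZ σ g P = (-1) ^ (e + 1) * ((-1) ^ e * (e.choose (M.rk G.1 - M.rk P - 1) : ℝ) *
      DD M G.1 (BB M G.1 ^ (e + 1 - (M.rk G.1 - M.rk P)) * YY σ g G.1)) := by
    rw [ZZ, YY_split σ g P G hG hmin, yy, if_neg hGσ, one_mul, uu, if_neg hGσ, he,
      Nat.succ_eq_add_one, neg_pow, ← DD_R hG e _ (YY_mem_Sup σ g G.1)]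
    rw [show ((-1) ^ (e + 1) * X G ^ (e + 1) * YY σ g G.1 : ChowPolyR M) =
      ((-1 : ℝ) ^ (e + 1)) • (X G ^ (e + 1) * YY σ g G.1) by rw [smul_eq_C_mul]; simp; ring,
      map_smul, smul_eq_mul]
  rw [h1, he]
  refine ⟨fun h => ?_, fun h => ?_⟩
  · rw [Nat.choose_eq_zero_of_lt (by omega)]; simp
  · rw [← h, ZZ]
    simp
    rw [← mul_assoc, ← pow_add]
    have : Odd (e + 1 + e) := ⟨e, by ring⟩
    rw [this.neg_one_pow]; ring

theorem ZZ_mem (σ : Finset (FlatVar M)) (g : FlatVar M → ℕ) {P : Finset E} (hP : P ∈ M.flats)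
    (G : FlatVar M)
    (hG : P ⊂ G.1) (hmin : ∀ F : FlatVar M, P ⊂ F.1 → (g F ≠ 0 ∨ F ∈ σ) → G.1 ⊆ F.1)
    (hGσ : G ∈ σ) :
    ZZ σ g P = if g G + 1 = M.rk G.1 - M.rk P then ZZ σ g G.1 else 0 := by
  have hrk := rk_lt M hP G.2.1 hG
  set e := g G with he
  set ρ := M.rk G.1 - M.rk P with hρ
  have h1 : YY σ g P = ∑ i ∈ Finset.range (e + 1), ((-1 : ℝ) ^ e * (e.choose i : ℝ)) •
      (X G ^ (i + 1) * (BB M G.1 ^ (e - i) * YY σ g G.1)) := by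
    rw [YY_split σ g P G hG hmin, yy, if_pos hGσ, uu, if_pos hGσ, hh_eq, ← he,
      show (- X G - BB M G.1 : ChowPolyR M) = - (X G + BB M G.1) by ring, neg_pow, add_pow,
      Finset.mul_sum, Finset.mul_sum, Finset.sum_mul]
    apply Finset.sum_congr rfl
    intro i _
    rw [smul_eq_C_mul]
    simp
    ring
  rw [ZZ, h1, map_sum]
  have h2 : ∀ i ∈ Finset.range (e + 1), DD M P (((-1 : ℝ) ^ e * (e.choose i : ℝ)) •
      (X G ^ (i + 1) * (BB M G.1 ^ (e - i) * YY σ g G.1))) =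
      (-1) ^ e * DD M G.1 (BB M G.1 ^ (e + 1 - ρ) * YY σ g G.1) *
        ((-1 : ℝ) ^ i * (e.choose i : ℝ) * (i.choose (ρ - 1) : ℝ)) := by
    intro i hi
    rw [Finset.mem_range] at hi
    rw [map_smul, DD_R hG i _ (mul_mem (pow_mem (BB_mem_Sup _) _) (YY_mem_Sup σ g G.1)), ← hρ]
    by_cases h : ρ ≤ i + 1
    · rw [← mul_assoc (BB M G.1 ^ _), ← pow_add, show i + 1 - ρ + (e - i) = e + 1 - ρ by omega]
      simp only [smul_eq_mul]; ring
    · rw [Nat.choose_eq_zero_of_lt (show i < ρ - 1 by omega)]; simp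
  rw [Finset.sum_congr rfl h2, ← Finset.mul_sum, binom_inv]
  by_cases h3 : e + 1 = ρ
  · rw [if_pos (by omega), if_pos h3, ZZ, show e + 1 - ρ = 0 by omega]
    simp only [pow_zero, one_mul]
    rw [mul_right_comm, ← pow_add, Even.neg_one_pow ⟨e, rfl⟩, one_mul]
  · rw [if_neg (by omega), if_neg h3, mul_zero]
end ChowHL

namespace ChowHL
open SimpleFlatMatroid MvPolynomial

variable {E : Type*} [Fintype E] [DecidableEq E] {M : SimpleFlatMatroid E}

/-- support of an exponent together with `σ`. -/
def tau (σ : Finset (FlatVar M)) (e : FlatVar M → ℕ) : Finset (FlatVar M) :=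
  Finset.univ.filter fun F => e F ≠ 0 ∨ F ∈ σ

theorem mem_tau {σ : Finset (FlatVar M)} {e : FlatVar M → ℕ} {F : FlatVar M} :
    F ∈ tau σ e ↔ e F ≠ 0 ∨ F ∈ σ := by simp [tau]

/-- predecessor of `G` in a chain. -/
def prv (τ : Finset (FlatVar M)) (G : Finset E) : Finset E :=
  τ.sup fun F => if F.1 ⊂ G then F.1 else ∅

def Chn (τ : Finset (FlatVar M)) : Prop := ∀ F ∈ τ, ∀ F' ∈ τ, F.1 ⊆ F'.1 ∨ F'.1 ⊆ F.1

/-- the socle exponent of a chain. -/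
def full (σ τ : Finset (FlatVar M)) (G : FlatVar M) : ℕ :=
  if G ∈ τ then M.rk G.1 - M.rk (prv τ G.1) - (if G ∈ σ then 1 else 0) else 0

def FY (σ : Finset (FlatVar M)) (e : FlatVar M → ℕ) : Prop :=
  Chn (tau σ e) ∧ ∀ G ∈ tau σ e, e G + M.rk (prv (tau σ e) G.1) + 1 ≤ M.rk G.1

def Bs (τ : Finset (FlatVar M)) (P : Finset E) : Prop := P = ∅ ∨ ∃ P' ∈ τ, P'.1 = P

theorem prv_eq {τ : Finset (FlatVar M)} (hτ : Chn τ) {P G : Finset E} (hP : Bs τ P) (hPG : P ⊂ G)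
    (hno : ∀ F ∈ τ, P ⊂ F.1 → ¬ F.1 ⊂ G) : prv τ G = P := by
  apply le_antisymm
  · apply Finset.sup_le
    intro F hF
    split_ifs with h
    · have hcmp : F.1 ⊆ P ∨ P ⊆ F.1 := by
        rcases hP with rfl | ⟨P', hP', rfl⟩
        · right; simp
        · exact hτ F hF P' hP'
      rcases hcmp with h1 | h1
      · exact h1
      · by_contra h2
        exact hno F hF ⟨h1, h2⟩ h
    · simp
  · rcases hP with rfl | ⟨P', hP', rfl⟩
    · simp
    · have := Finset.le_sup (f := fun F : FlatVar M => if F.1 ⊂ G then F.1 else ∅) hP'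
      rw [if_pos hPG] at this
      exact this

theorem exists_next {τ : Finset (FlatVar M)} {P : Finset E}
    (hτ : ∀ F ∈ τ, ∀ F' ∈ τ, P ⊂ F.1 → P ⊂ F'.1 → F.1 ⊆ F'.1 ∨ F'.1 ⊆ F.1)
    {T : FlatVar M} (hT : T.1 = Finset.univ) (hTτ : T ∈ τ) (hP : P ≠ Finset.univ) :
    ∃ G ∈ τ, P ⊂ G.1 ∧ ∀ F ∈ τ, P ⊂ F.1 → G.1 ⊆ F.1 := by
  obtain ⟨G, hG, hmin⟩ := exists_min_chain (τ.filter fun F => P ⊂ F.1)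
    ⟨T, Finset.mem_filter.2 ⟨hTτ, by
      rw [hT]; exact (Finset.ssubset_univ_iff).2 hP⟩⟩
    (fun F hF F' hF' => hτ F (Finset.mem_filter.1 hF).1 F' (Finset.mem_filter.1 hF').1
      (Finset.mem_filter.1 hF).2 (Finset.mem_filter.1 hF').2)
  rw [Finset.mem_filter] at hG
  exact ⟨G, hG.1, hG.2, fun F hF hPF => hmin F (Finset.mem_filter.2 ⟨hF, hPF⟩)⟩

theorem card_dec {P G : Finset E} (h : P ⊂ G) : (Finset.univ : Finset E).card - G.card <
    (Finset.univ : Finset E).card - P.card := by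
  have h1 := Finset.card_lt_card h
  have h2 := Finset.card_le_univ G
  rw [← Finset.card_univ] at h2
  omega

theorem full_notmem {σ τ : Finset (FlatVar M)} {G : FlatVar M} (h : G ∉ τ) : full σ τ G = 0 := by
  rw [full, if_neg h]

theorem V1_aux {σ : Finset (FlatVar M)} {T : FlatVar M} (hT : T.1 = Finset.univ) (hTσ : T ∈ σ)
    (g e e' : FlatVar M → ℕ) (he : ∀ F, e F ≠ 0 → g F ≠ 0) (he' : ∀ F, e' F ≠ 0 → g F ≠ 0)
    (hc : Chn (tau σ e)) (hc' : Chn (tau σ e')) (P : Finset E) (hP : P ∈ M.flats)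
    (hb : Bs (tau σ e) P) (hb' : Bs (tau σ e') P) (hne : ZZ σ g P ≠ 0) :
    (∃ G0 : FlatVar M, P ⊂ G0.1 ∧ full σ (tau σ e) G0 + full σ (tau σ e') G0 < 2 * g G0 ∧
      ∀ F : FlatVar M, P ⊂ F.1 → F.1 ⊂ G0.1 →
        2 * g F = full σ (tau σ e) F + full σ (tau σ e') F) ∨
    (∀ F : FlatVar M, P ⊂ F.1 → g F = full σ (tau σ e) F ∧ g F = full σ (tau σ e') F) := by
  obtain ⟨N, hN⟩ : ∃ N, (Finset.univ : Finset E).card - P.card = N := ⟨_, rfl⟩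
  induction N using Nat.strong_induction_on generalizing P with
  | _ N ih =>
  by_cases hPu : P = Finset.univ
  · right
    intro F hF
    exact absurd (Finset.subset_univ _) (hPu ▸ hF.2)
  obtain ⟨G, hG, hPG, hmin⟩ := exists_next (τ := tau σ g) (P := P)
    (fun F hF F' hF' h h' => ZZ_incomp σ g P h h' (mem_tau.1 hF) (mem_tau.1 hF') hne) hT
    (mem_tau.2 (Or.inr hTσ)) hPu
  have hmin' : ∀ F : FlatVar M, P ⊂ F.1 → (g F ≠ 0 ∨ F ∈ σ) → G.1 ⊆ F.1 :=
    fun F h h' => hmin F (mem_tau.2 h') h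
  have hrk := rk_lt M hP G.2.1 hPG
  have sub : ∀ F ∈ tau σ e, F ∈ tau σ g := fun F hF =>
    mem_tau.2 ((mem_tau.1 hF).imp (he F) id)
  have sub' : ∀ F ∈ tau σ e', F ∈ tau σ g := fun F hF =>
    mem_tau.2 ((mem_tau.1 hF).imp (he' F) id)
  have hp : prv (tau σ e) G.1 = P := prv_eq hc hb hPG fun F hF h1 h2 =>
    h2.2 (hmin F (sub F hF) h1)
  have hp' : prv (tau σ e') G.1 = P := prv_eq hc' hb' hPG fun F hF h1 h2 =>
    h2.2 (hmin F (sub' F hF) h1)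
  -- flats between are not in the supports
  have hoff : ∀ F : FlatVar M, P ⊂ F.1 → ¬ G.1 ⊆ F.1 →
      g F = 0 ∧ full σ (tau σ e) F = 0 ∧ full σ (tau σ e') F = 0 := by
    intro F h1 h2
    have h3 : F ∉ tau σ g := fun h => h2 (hmin F h h1)
    refine ⟨?_, full_notmem fun h => h3 (sub F h), full_notmem fun h => h3 (sub' F h)⟩
    by_contra h4
    exact h3 (mem_tau.2 (Or.inl h4))
  have recur : G ∈ tau σ e → G ∈ tau σ e' → ZZ σ g G.1 ≠ 0 → g G = full σ (tau σ e) G →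
      g G = full σ (tau σ e') G → (∃ G0 : FlatVar M, P ⊂ G0.1 ∧ full σ (tau σ e) G0 + full σ (tau σ e') G0 < 2 * g G0 ∧
      ∀ F : FlatVar M, P ⊂ F.1 → F.1 ⊂ G0.1 →
        2 * g F = full σ (tau σ e) F + full σ (tau σ e') F) ∨
    (∀ F : FlatVar M, P ⊂ F.1 → g F = full σ (tau σ e) F ∧ g F = full σ (tau σ e') F) := by
    intro h1 h2 h3 h4 h5
    rcases ih _ (hN ▸ card_dec hPG) G.1 G.2.1 (Or.inr ⟨G, h1, rfl⟩) (Or.inr ⟨G, h2, rfl⟩) h3 rfl with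
      ⟨G0, k1, k2, k3⟩ | k
    · left
      refine ⟨G0, hPG.trans k1, k2, fun F hF hF' => ?_⟩
      by_cases hGF : G.1 ⊆ F.1
      · rcases eq_or_ssubset_of_subset hGF with hh | hh
        · have : G = F := Subtype.ext hh
          subst this; omega
        · exact k3 F hh hF'
      · obtain ⟨z1, z2, z3⟩ := hoff F hF hGF
        omega
    · right
      intro F hF
      by_cases hGF : G.1 ⊆ F.1
      · rcases eq_or_ssubset_of_subset hGF with hh | hh
        · have : G = F := Subtype.ext hh
          subst this; exact ⟨h4, h5⟩
        · exact k F hh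
      · obtain ⟨z1, z2, z3⟩ := hoff F hF hGF
        omega
  by_cases hGσ : G ∈ σ
  · have h1 : G ∈ tau σ e := mem_tau.2 (Or.inr hGσ)
    have h2 : G ∈ tau σ e' := mem_tau.2 (Or.inr hGσ)
    rw [ZZ_mem σ g hP G hPG hmin' hGσ] at hne
    split_ifs at hne with h3
    · refine recur h1 h2 hne ?_ ?_
      · rw [full, if_pos h1, hp, if_pos hGσ]; omega
      · rw [full, if_pos h2, hp', if_pos hGσ]; omega
    · exact absurd rfl hne
  · have hgG : g G ≠ 0 := (mem_tau.1 hG).resolve_right hGσ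
    obtain ⟨z1, z2⟩ := ZZ_notmem σ g hP G hPG hmin' hGσ hgG
    have hge : M.rk G.1 - M.rk P ≤ g G := by
      by_contra h; exact hne (z1 (by omega))
    have f1 : full σ (tau σ e) G = if G ∈ tau σ e then M.rk G.1 - M.rk P else 0 := by
      rw [full, hp, if_neg hGσ, Nat.sub_zero]
    have f2 : full σ (tau σ e') G = if G ∈ tau σ e' then M.rk G.1 - M.rk P else 0 := by
      rw [full, hp', if_neg hGσ, Nat.sub_zero]
    by_cases hlt : full σ (tau σ e) G + full σ (tau σ e') G < 2 * g G
    · left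
      refine ⟨G, hPG, hlt, fun F hF hF' => ?_⟩
      obtain ⟨z1, z2, z3⟩ := hoff F hF (fun h => hF'.2 h)
      omega
    · have m1 : G ∈ tau σ e := by
        by_contra h; rw [f1, f2, if_neg h] at hlt; split_ifs at hlt <;> omega
      have m2 : G ∈ tau σ e' := by
        by_contra h; rw [f1, f2, if_neg h] at hlt; split_ifs at hlt <;> omega
      rw [f1, f2, if_pos m1, if_pos m2] at hlt
      have hgeq : g G = M.rk G.1 - M.rk P := by omega
      refine recur m1 m2 ?_ (by rw [f1, if_pos m1, hgeq]) (by rw [f2, if_pos m2, hgeq])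
      intro h; rw [z2 hgeq, h] at hne; simp at hne

theorem sum_split (f : FlatVar M → ℕ) (P : Finset E) (G : FlatVar M)
    (hG : P ⊂ G.1) (hmin : ∀ F : FlatVar M, P ⊂ F.1 → f F ≠ 0 → G.1 ⊆ F.1) :
    (∑ F : FlatVar M, if P ⊂ F.1 then f F else 0) =
      f G + ∑ F : FlatVar M, if G.1 ⊂ F.1 then f F else 0 := by
  classical
  rw [← Finset.add_sum_erase _ _ (Finset.mem_univ G), if_pos hG,
    ← Finset.add_sum_erase (s := Finset.univ) (f := fun F => if G.1 ⊂ F.1 then _ else _)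
      (h := Finset.mem_univ G), if_neg (fun h => h.2 subset_rfl), zero_add]
  congr 1
  apply Finset.sum_congr rfl
  intro F hF
  have hFG := (Finset.mem_erase.1 hF).1
  by_cases h2 : G.1 ⊂ F.1
  · rw [if_pos h2, if_pos (hG.trans h2)]
  · rw [if_neg h2]
    split_ifs with h3
    · by_contra h
      exact h2 ⟨hmin F h3 h, fun h' => hFG (Subtype.ext (h'.antisymm (hmin F h3 h)))⟩
    · rfl

theorem V2_aux {σ τ : Finset (FlatVar M)} {T : FlatVar M} (hT : T.1 = Finset.univ) (hTσ : T ∈ σ)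
    (hστ : σ ⊆ τ) (hc : Chn τ) (P : Finset E) (hP : P ∈ M.flats) (hb : Bs τ P) :
    ZZ σ (full σ τ) P = (-1) ^ (∑ F : FlatVar M, if P ⊂ F.1 then
      (if F ∈ τ ∧ F ∉ σ then 1 else 0) else 0) ∧
    (∑ F : FlatVar M, if P ⊂ F.1 then full σ τ F else 0) +
      (∑ F : FlatVar M, if P ⊂ F.1 then (if F ∈ σ then 1 else 0) else 0) + M.rk P =
      M.rk Finset.univ := by
  obtain ⟨N, hN⟩ : ∃ N, (Finset.univ : Finset E).card - P.card = N := ⟨_, rfl⟩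
  induction N using Nat.strong_induction_on generalizing P with
  | _ N ih =>
  by_cases hPu : P = Finset.univ
  · subst hPu
    have h : ∀ G : FlatVar M, ¬ (Finset.univ ⊂ G.1) := fun G h => h.2 (Finset.subset_univ _)
    simp [h, ZZ_univ]
  obtain ⟨G, hG, hPG, hmin⟩ := exists_next (τ := τ) (P := P)
    (fun F hF F' hF' h h' => hc F hF F' hF') hT (hστ hTσ) hPu
  have hfm : ∀ F, full σ τ F ≠ 0 ∨ F ∈ σ → F ∈ τ := by
    rintro F (h | h)
    · by_contra h'; exact h (full_notmem h')
    · exact hστ h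
  have hmin' : ∀ F : FlatVar M, P ⊂ F.1 → (full σ τ F ≠ 0 ∨ F ∈ σ) → G.1 ⊆ F.1 :=
    fun F h h' => hmin F (hfm F h') h
  have hrk := rk_lt M hP G.2.1 hPG
  have hp : prv τ G.1 = P := prv_eq hc hb hPG fun F hF h1 h2 => h2.2 (hmin F hF h1)
  obtain ⟨i1, i2⟩ := ih _ (hN ▸ card_dec hPG) G.1 G.2.1 (Or.inr ⟨G, hG, rfl⟩) rfl
  rw [sum_split (full σ τ) P G hPG (fun F h h' => hmin' F h (Or.inl h')),
    sum_split (fun F => if F ∈ σ then 1 else 0) P G hPG (fun F h h' => hmin' F h (Or.inr (by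
      by_contra h2; exact h' (if_neg h2)))),
    sum_split (fun F => if F ∈ τ ∧ F ∉ σ then 1 else 0) P G hPG (fun F h h' => hmin F (by
      by_contra h2; exact h' (if_neg fun h3 => h2 h3.1)) h)]
  by_cases hGσ : G ∈ σ
  · have hf : full σ τ G + 1 = M.rk G.1 - M.rk P := by
      rw [full, if_pos hG, hp, if_pos hGσ]; omega
    rw [ZZ_mem σ _ hP G hPG hmin' hGσ, if_pos hf, i1, if_neg (by tauto), zero_add, if_pos hGσ]
    exact ⟨rfl, by omega⟩
  · have hf : full σ τ G = M.rk G.1 - M.rk P := by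
      rw [full, if_pos hG, hp, if_neg hGσ]; omega
    rw [(ZZ_notmem σ _ hP G hPG hmin' hGσ (by omega)).2 hf, i1, if_pos ⟨hG, hGσ⟩, if_neg hGσ]
    refine ⟨by rw [pow_add, pow_one]; ring, by omega⟩

/-- The degree functional along a chain. -/
noncomputable def ll (σ : Finset (FlatVar M)) : ChowPolyR M →ₗ[ℝ] ℝ :=
  DD M ∅ ∘ₗ LinearMap.mulLeft ℝ (∏ F ∈ σ, X F)

theorem ll_apply (σ : Finset (FlatVar M)) (p : ChowPolyR M) :
    ll σ p = DD M ∅ ((∏ F ∈ σ, X F) * p) := rfl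

/-- monomials in adapted variables. -/
noncomputable def um (σ : Finset (FlatVar M)) (g : FlatVar M → ℕ) : ChowPolyR M :=
  ∏ F : FlatVar M, uu σ F ^ g F

theorem empty_ss (F : FlatVar M) : ∅ ⊂ F.1 := Finset.empty_ssubset.2 (Finset.nonempty_iff_ne_empty.2 F.2.2)

theorem ll_um (σ : Finset (FlatVar M)) (g : FlatVar M → ℕ) : ll σ (um σ g) = ZZ σ g ∅ := by
  classical
  rw [ll_apply, ZZ, YY, um]
  congr 1
  simp only [empty_ss, if_true, yy, Finset.prod_mul_distrib]
  congr 1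
  rw [Finset.prod_ite_mem, Finset.univ_inter]

theorem ll_ideal {σ : Finset (FlatVar M)} {T : FlatVar M} (hT : T.1 = Finset.univ) (hTσ : T ∈ σ)
    {q : ChowPolyR M} (hq : (∏ F ∈ σ.erase T, X F) * q ∈ chowIdealR M) : ll σ q = 0 := by
  rw [ll_apply, ← Finset.mul_prod_erase _ _ hTσ, mul_assoc, DD_ideal hT hq]

theorem ll_insert {σ : Finset (FlatVar M)} {F : FlatVar M} (hF : F ∉ σ) (p : ChowPolyR M) :
    ll (insert F σ) p = ll σ (X F * p) := by
  rw [ll_apply, ll_apply, Finset.prod_insert hF]; congr 1; ring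

theorem ll_full {σ τ : Finset (FlatVar M)} {T : FlatVar M} (hT : T.1 = Finset.univ) (hTσ : T ∈ σ)
    (hστ : σ ⊆ τ) (hc : Chn τ) : ll σ (um σ (full σ τ)) = (-1) ^ (τ \ σ).card := by
  rw [ll_um, (V2_aux hT hTσ hστ hc ∅ M.empty_mem (Or.inl rfl)).1]
  congr 1
  simp only [empty_ss, if_true]
  rw [Finset.sum_boole]
  simp only [Nat.cast_id]
  congr 1
  ext F; simp

theorem sum_full {σ τ : Finset (FlatVar M)} {T : FlatVar M} (hT : T.1 = Finset.univ) (hTσ : T ∈ σ)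
    (hστ : σ ⊆ τ) (hc : Chn τ) : ∑ F, full σ τ F + σ.card = M.rk Finset.univ := by
  have := (V2_aux hT hTσ hστ hc ∅ M.empty_mem (Or.inl rfl)).2
  simp only [empty_ss, if_true, M.rk_empty] at this
  simpa using this
end ChowHL

namespace ChowHL
open SimpleFlatMatroid MvPolynomial

variable {E : Type*} [Fintype E] [DecidableEq E] {M : SimpleFlatMatroid E}

/-- base of the weights -/
def Wb (M : SimpleFlatMatroid E) : ℕ :=
  2 * M.rk Finset.univ * Fintype.card (FlatVar M) + 2

/-- weights -/
def Mw (M : SimpleFlatMatroid E) (j : ℕ) : ℕ := Wb M ^ (Fintype.card E + 1 - j)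

/-- exponent defect -/
def exd (σ : Finset (FlatVar M)) (e e' g : FlatVar M → ℕ) : ℤ :=
  ∑ G : FlatVar M, (Mw M G.1.card : ℤ) *
    (2 * g G - full σ (tau σ e) G - full σ (tau σ e') G)

theorem full_le (σ τ : Finset (FlatVar M)) (G : FlatVar M) : full σ τ G ≤ M.rk Finset.univ := by
  have := rk_le M G.2.1 M.ground_mem (Finset.subset_univ _)
  rw [full]; split_ifs <;> omega

theorem V1 {σ : Finset (FlatVar M)} {T : FlatVar M} (hT : T.1 = Finset.univ) (hTσ : T ∈ σ)
    (g e e' : FlatVar M → ℕ) (he : ∀ F, e F ≠ 0 → g F ≠ 0) (he' : ∀ F, e' F ≠ 0 → g F ≠ 0)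
    (hc : Chn (tau σ e)) (hc' : Chn (tau σ e')) (hne : ll σ (um σ g) ≠ 0) :
    0 < exd σ e e' g ∨ (g = full σ (tau σ e) ∧ g = full σ (tau σ e')) := by
  classical
  rw [ll_um] at hne
  rcases V1_aux hT hTσ g e e' he he' hc hc' ∅ M.empty_mem (Or.inl rfl) (Or.inl rfl) hne with
    ⟨G0, -, h2, h3⟩ | h
  swap
  · right
    exact ⟨funext fun F => (h F (empty_ss F)).1, funext fun F => (h F (empty_ss F)).2⟩
  left
  have sub : ∀ F ∈ tau σ e, F ∈ tau σ g := fun F hF =>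
    mem_tau.2 ((mem_tau.1 hF).imp (he F) id)
  have sub' : ∀ F ∈ tau σ e', F ∈ tau σ g := fun F hF =>
    mem_tau.2 ((mem_tau.1 hF).imp (he' F) id)
  set R := M.rk Finset.univ with hR
  set n := Fintype.card E with hn
  have hG0n : G0.1.card ≤ n := Finset.card_le_univ _
  set w : ℤ := (Wb M : ℤ) ^ (n - G0.1.card) with hw
  have hWpos : (1:ℤ) ≤ Wb M := by
    have : 1 ≤ Wb M := by unfold Wb; omega
    exact_mod_cast this
  have hwpos : 0 < w := by positivity
  have hMG0 : (Mw M G0.1.card : ℤ) = Wb M * w := by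
    rw [Mw, hw, ← hn, show n + 1 - G0.1.card = (n - G0.1.card) + 1 by omega]; push_cast; ring
  have hterm : ∀ F : FlatVar M, (if F = G0 then (Wb M : ℤ) * w else 0) - w * (2 * R) ≤
      (Mw M F.1.card : ℤ) * (2 * g F - full σ (tau σ e) F - full σ (tau σ e') F) := by
    intro F
    have hwR : 0 ≤ w * (2 * R) := by positivity
    by_cases h : F = G0
    · subst h
      rw [if_pos rfl, hMG0]
      have : (1:ℤ) ≤ 2 * g F - full σ (tau σ e) F - full σ (tau σ e') F := by omega
      nlinarith [mul_nonneg (le_trans zero_le_one hWpos) hwpos.le]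
    · rw [if_neg h]
      by_cases h4 : F.1 ⊂ G0.1
      · have := h3 F (empty_ss F) h4
        have h5 : (2 * g F - full σ (tau σ e) F - full σ (tau σ e') F : ℤ) = 0 := by omega
        rw [h5]; linarith
      · by_cases h5 : G0.1 ⊆ F.1
        · have h6 : G0.1 ⊂ F.1 := ⟨h5, fun h' => h (Subtype.ext (h'.antisymm h5))⟩
          have hcard := Finset.card_lt_card h6
          have hM : (Mw M F.1.card : ℤ) ≤ w := by
            rw [Mw, hw]; push_cast
            exact pow_le_pow_right₀ hWpos (by omega)
          have f1 := full_le σ (tau σ e) F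
          have f2 := full_le σ (tau σ e') F
          have f3 : -(2 * R : ℤ) ≤ 2 * g F - full σ (tau σ e) F - full σ (tau σ e') F := by omega
          have hM0 : (0:ℤ) ≤ Mw M F.1.card := by positivity
          have := mul_le_mul_of_nonneg_left f3 hM0
          have h7 : (Mw M F.1.card : ℤ) * (2 * R) ≤ w * (2 * R) :=
            mul_le_mul_of_nonneg_right hM (by positivity)
          linarith
        · have hnF : F ∉ tau σ g := by
            intro hF
            rcases ZZ_incomp σ g ∅ (empty_ss F) (empty_ss G0) (mem_tau.1 hF)
              (Or.inl (by omega)) hne with h7 | h7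
            · exact h4 ⟨h7, h5⟩
            · exact h5 h7
          have z0 : g F = 0 := by
            by_contra hz; exact hnF (mem_tau.2 (Or.inl hz))
          rw [z0, full_notmem (fun h => hnF (sub F h)), full_notmem (fun h => hnF (sub' F h))]
          simp; exact hwR
  have hsum := Finset.sum_le_sum fun F (_ : F ∈ Finset.univ) => hterm F
  rw [Finset.sum_sub_distrib, Finset.sum_ite_eq', if_pos (Finset.mem_univ _), Finset.sum_const,
    Finset.card_univ, nsmul_eq_mul] at hsum
  refine lt_of_lt_of_le ?_ hsum
  have : (Wb M : ℤ) = 2 * R * Fintype.card (FlatVar M) + 2 := by rw [Wb]; push_cast; rfl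
  rw [this]
  nlinarith

/-- `x_P`, with `x_∅ = 1`. -/
noncomputable def xx (M : SimpleFlatMatroid E) (P : Finset E) : ChowPolyR M :=
  if h : P ∈ M.flats ∧ P ≠ ∅ then X ⟨P, h⟩ else 1

theorem LL_mem (a : E) : LL M a ∈ chowIdealR M :=
  Ideal.subset_span (Or.inr ⟨a, rfl⟩)

theorem XX_mem {F F' : FlatVar M} (h1 : ¬ F.1 ⊆ F'.1) (h2 : ¬ F'.1 ⊆ F.1) :
    (X F * X F' : ChowPolyR M) ∈ chowIdealR M :=
  Ideal.subset_span (Or.inl ⟨F, F', h1, h2, rfl⟩)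

theorem xx_mul_mem {P : Finset E} {K : FlatVar M} (h1 : ¬ P ⊆ K.1)
    (h2 : ¬ K.1 ⊆ P) (hP : P ∈ M.flats) : xx M P * X K ∈ chowIdealR M := by
  have hne : P ≠ ∅ := by rintro rfl; simp at h1
  rw [xx, dif_pos ⟨hP, hne⟩]
  exact XX_mem h1 h2

theorem xx_val (K : FlatVar M) : xx M K.1 = X K := by rw [xx, dif_pos K.2]

theorem nilp (n : ℕ) : ∀ P ∈ M.flats, ∀ B : Finset E, (B \ P).card = n → 1 ≤ n →
    xx M P * hh M B ^ n ∈ chowIdealR M := by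
  classical
  induction n using Nat.strong_induction_on with
  | _ n ih =>
  intro P hP B hB hn
  obtain ⟨a, ha⟩ : (B \ P).Nonempty := Finset.card_pos.1 (by omega)
  rw [Finset.mem_sdiff] at ha
  obtain ⟨n', rfl⟩ : ∃ n', n = n' + 1 := ⟨n - 1, by omega⟩
  have h1 : hh M B = - LL M a + ∑ K : FlatVar M, if a ∈ K.1 ∧ ¬ B ⊆ K.1 then X K else 0 := by
    rw [hh, LL, ← Finset.sum_neg_distrib, ← Finset.sum_add_distrib]
    apply Finset.sum_congr rfl
    intro K _
    by_cases hBK : B ⊆ K.1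
    · rw [if_pos hBK, if_pos (hBK ha.1), if_neg (by tauto), add_zero]
    · rw [if_neg hBK]
      by_cases haK : a ∈ K.1
      · rw [if_pos haK, if_pos ⟨haK, hBK⟩]; ring
      · rw [if_neg haK, if_neg (by tauto)]; ring
  have h2 : xx M P * hh M B ^ (n' + 1) = - (xx M P * hh M B ^ n') * LL M a +
      ∑ K : FlatVar M, xx M P * hh M B ^ n' * (if a ∈ K.1 ∧ ¬ B ⊆ K.1 then X K else 0) := by
    rw [← Finset.mul_sum, pow_succ]
    linear_combination (xx M P * hh M B ^ n') * h1
  rw [h2]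
  refine add_mem (Ideal.mul_mem_left _ _ (LL_mem a)) (Ideal.sum_mem _ fun K _ => ?_)
  split_ifs with h3
  swap
  · simp
  obtain ⟨haK, hBK⟩ := h3
  have hKP : ¬ K.1 ⊆ P := fun h => ha.2 (h haK)
  by_cases hPK : P ⊆ K.1
  · have c1 : (B \ K.1).card < (B \ P).card := by
      apply Finset.card_lt_card
      refine ⟨Finset.sdiff_subset_sdiff subset_rfl hPK, fun h => ?_⟩
      have := h (Finset.mem_sdiff.2 ha)
      rw [Finset.mem_sdiff] at this
      exact this.2 haK
    have c2 : 0 < (B \ K.1).card := by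
      rw [Finset.card_pos, Finset.sdiff_nonempty]; exact hBK
    have := ih _ (by omega) K.1 K.2.1 B rfl c2
    rw [xx_val] at this
    rw [show n' = (B \ K.1).card + (n' - (B \ K.1).card) by omega, pow_add,
      show xx M P * (hh M B ^ (B \ K.1).card * hh M B ^ (n' - (B \ K.1).card)) * X K =
        xx M P * hh M B ^ (n' - (B \ K.1).card) * (X K * hh M B ^ (B \ K.1).card) by ring]
    exact Ideal.mul_mem_left _ _ this
  · rw [mul_right_comm]
    exact Ideal.mul_mem_right _ _ (xx_mul_mem hPK hKP hP)

theorem nilp_flat {P G : Finset E} (hP : P ∈ M.flats) (hG : G ∈ M.flats) (h : P ⊂ G) :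
    xx M P * hh M G ^ (M.rk G - M.rk P) ∈ chowIdealR M := by
  classical
  obtain ⟨B, hBG, hd, hc, hcl⟩ := exists_basis M hP hG h.1
  have hrk := rk_lt M hP hG h
  have h1 := nilp (M := M) B.card P hP B (by rw [Finset.sdiff_eq_self_of_disjoint hd]) (by omega)
  have h2 : xx M P * (hh M G - hh M B) ∈ chowIdealR M := by
    rw [hh, hh, ← Finset.sum_sub_distrib, Finset.mul_sum]
    refine Ideal.sum_mem _ fun K _ => ?_
    by_cases hGK : G ⊆ K.1
    · rw [if_pos hGK, if_pos (hBG.trans hGK)]; simp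
    · rw [if_neg hGK]
      split_ifs with hBK
      · rw [zero_sub, neg_neg]
        refine xx_mul_mem (fun h => hGK (hcl K.1 K.2.1 h hBK)) (fun h => ?_) hP
        have : B = ∅ := by
          rw [Finset.eq_empty_iff_forall_notMem]
          exact fun b hb => Finset.disjoint_left.1 hd hb (h (hBK hb))
        rw [this] at hc; simp at hc; omega
      · simp
  rw [show M.rk G - M.rk P = B.card by omega]
  obtain ⟨q, hq⟩ := sub_dvd_pow_sub_pow (hh M G) (hh M B) B.card
  rw [show xx M P * hh M G ^ B.card = q * (xx M P * (hh M G - hh M B)) + xx M P * hh M B ^ B.card by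
    rw [eq_add_of_sub_eq hq]; ring]
  exact add_mem (Ideal.mul_mem_left _ _ h2) h1
end ChowHL

namespace ChowHL
open SimpleFlatMatroid MvPolynomial

variable {E : Type*} [Fintype E] [DecidableEq E] {M : SimpleFlatMatroid E}

/-- the colon ideal. -/
noncomputable def JJ (σ : Finset (FlatVar M)) (T : FlatVar M) : Ideal (ChowPolyR M) :=
  Submodule.comap (LinearMap.mulLeft (ChowPolyR M) (∏ F ∈ σ.erase T, X F)) (chowIdealR M)

theorem mem_JJ {σ : Finset (FlatVar M)} {T : FlatVar M} {q : ChowPolyR M} :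
    q ∈ JJ σ T ↔ (∏ F ∈ σ.erase T, X F) * q ∈ chowIdealR M := Iff.rfl

theorem prv_cases {τ : Finset (FlatVar M)} (hτ : Chn τ) (G : Finset E) :
    (prv τ G = ∅ ∧ ∀ F ∈ τ, ¬ F.1 ⊂ G) ∨
    ∃ P ∈ τ, P.1 = prv τ G ∧ P.1 ⊂ G ∧ ∀ F ∈ τ, F.1 ⊂ G → F.1 ⊆ P.1 := by
  by_cases h : ∀ F ∈ τ, ¬ F.1 ⊂ G
  · left
    refine ⟨?_, h⟩
    rw [← Finset.subset_empty]
    apply Finset.sup_le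
    intro F hF
    rw [if_neg (h F hF)]
  · right
    push Not at h
    obtain ⟨F0, hF0, hF0G⟩ := h
    obtain ⟨P, hP, hmax⟩ := Finset.exists_max_image (τ.filter fun F => F.1 ⊂ G)
      (fun F => F.1.card) ⟨F0, Finset.mem_filter.2 ⟨hF0, hF0G⟩⟩
    rw [Finset.mem_filter] at hP
    have hsub : ∀ F ∈ τ, F.1 ⊂ G → F.1 ⊆ P.1 := by
      intro F hF hFG
      rcases hτ F hF P hP.1 with h1 | h1
      · exact h1
      · rw [Finset.eq_of_subset_of_card_le h1 (hmax F (Finset.mem_filter.2 ⟨hF, hFG⟩))]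
    refine ⟨P, hP.1, (prv_eq hτ (Or.inr ⟨P, hP.1, rfl⟩) hP.2 fun F hF h1 h2 =>
      h1.2 (hsub F hF h2)).symm, hP.2, hsub⟩

theorem prv_flat {τ : Finset (FlatVar M)} (hτ : Chn τ) (G : Finset E) : prv τ G ∈ M.flats := by
  rcases prv_cases hτ G with ⟨h, -⟩ | ⟨P, -, h, -⟩
  · rw [h]; exact M.empty_mem
  · rw [← h]; exact P.2.1

theorem prv_ss {τ : Finset (FlatVar M)} (hτ : Chn τ) (G : FlatVar M) : prv τ G.1 ⊂ G.1 := by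
  rcases prv_cases hτ G.1 with ⟨h, -⟩ | ⟨P, -, h, h', -⟩
  · rw [h]; exact empty_ss G
  · rw [← h]; exact h'

theorem um_add (σ : Finset (FlatVar M)) (g g' : FlatVar M → ℕ) :
    um σ (g + g') = um σ g * um σ g' := by
  simp only [um, ← Finset.prod_mul_distrib, Pi.add_apply, pow_add]

theorem um_single (σ : Finset (FlatVar M)) (F : FlatVar M) (n : ℕ) :
    um σ (Pi.single F n) = uu σ F ^ n := by
  rw [um, Finset.prod_eq_single F]
  · simp
  · intro b _ hb; rw [Pi.single_eq_of_ne hb]; simp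
  · simp

theorem um_zero (σ : Finset (FlatVar M)) : um σ 0 = 1 := by simp [um]

theorem xs_um (σ : Finset (FlatVar M)) (T : FlatVar M) (g : FlatVar M → ℕ) :
    (∏ F ∈ σ.erase T, X F) * um σ g =
      ∏ F : FlatVar M, ((if F ∈ σ.erase T then X F else 1) * uu σ F ^ g F) := by
  rw [Finset.prod_mul_distrib, um]
  congr 1
  rw [Finset.prod_ite_mem, Finset.univ_inter]

theorem X_dvd {σ : Finset (FlatVar M)} {T : FlatVar M} {g : FlatVar M → ℕ}
    {F : FlatVar M} (hF : F ∈ tau σ g) (hFT : F ≠ T) :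
    (X F : ChowPolyR M) ∣ (if F ∈ σ.erase T then X F else 1) * uu σ F ^ g F := by
  by_cases h : F ∈ σ
  · rw [if_pos (Finset.mem_erase.2 ⟨hFT, h⟩)]
    exact Dvd.intro _ rfl
  · have h1 : g F ≠ 0 := by
      rcases mem_tau.1 hF with h1 | h1
      · exact h1
      · exact absurd h1 h
    apply Dvd.dvd.mul_left
    apply dvd_trans _ (dvd_pow_self _ h1)
    rw [uu, if_neg h, dvd_neg]

theorem um_J1 {σ : Finset (FlatVar M)} {T : FlatVar M} (hT : T.1 = Finset.univ)
    {g : FlatVar M → ℕ} (h : ¬ Chn (tau σ g)) : um σ g ∈ JJ σ T := by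
  classical
  unfold Chn at h
  push Not at h
  obtain ⟨F, hF, F', hF', h1, h2⟩ := h
  have hFT : F ≠ T := by rintro rfl; exact h2 (hT ▸ Finset.subset_univ _)
  have hFT' : F' ≠ T := by rintro rfl; exact h1 (hT ▸ Finset.subset_univ _)
  have hne : F ≠ F' := by rintro rfl; exact h1 subset_rfl
  rw [mem_JJ, xs_um]
  refine Ideal.mem_of_dvd _ ?_ (XX_mem h1 h2)
  refine dvd_trans ?_ (Finset.prod_dvd_prod_of_subset {F, F'} _ _ (Finset.subset_univ _))
  rw [Finset.prod_pair hne]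
  exact mul_dvd_mul (X_dvd hF hFT) (X_dvd hF' hFT')

/-- the key nilpotence. -/
theorem um_nil {σ : Finset (FlatVar M)} {T : FlatVar M} (hT : T.1 = Finset.univ)
    {g : FlatVar M → ℕ} (hc : Chn (tau σ g)) (G : FlatVar M) (τ' : FlatVar M → ℕ)
    (hτ' : ∀ F ≠ G, τ' F = g F) :
    hh M G.1 ^ (M.rk G.1 - M.rk (prv (tau σ g) G.1)) * um σ τ' ∈ JJ σ T := by
  classical
  rw [mem_JJ, mul_left_comm, xs_um]
  refine Ideal.mem_of_dvd _ ?_ (nilp_flat (prv_flat hc G.1) G.2.1 (prv_ss hc G))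
  rw [mul_comm]
  apply mul_dvd_mul_left
  rcases prv_cases hc G.1 with ⟨h, -⟩ | ⟨P, hP, h, h', -⟩
  · rw [h, xx, dif_neg (by simp)]; exact one_dvd _
  · rw [← h, xx_val]
    refine dvd_trans ?_ (Finset.dvd_prod_of_mem _ (Finset.mem_univ P))
    have hPG : P ≠ G := by rintro rfl; exact h'.2 subset_rfl
    apply X_dvd
    · rw [mem_tau, hτ' P hPG, ← mem_tau]; exact hP
    · rintro rfl; exact h'.2 (hT ▸ Finset.subset_univ _)

theorem um_split (σ : Finset (FlatVar M)) (g : FlatVar M → ℕ) (G : FlatVar M)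
    (n : ℕ) (h : n ≤ g G) : um σ g = uu σ G ^ n * um σ (Function.update g G (g G - n)) := by
  rw [← um_single, ← um_add]
  congr 1
  funext F
  by_cases hF : F = G
  · subst hF; simp; omega
  · simp [hF]

theorem um_J2 {σ : Finset (FlatVar M)} {T : FlatVar M} (hT : T.1 = Finset.univ)
    {g : FlatVar M → ℕ} (hc : Chn (tau σ g)) (G : FlatVar M) (hG : G ∈ σ)
    (hg : M.rk G.1 - M.rk (prv (tau σ g) G.1) ≤ g G) : um σ g ∈ JJ σ T := by
  classical
  rw [um_split σ g G _ hg]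
  nth_rw 1 [uu]
  rw [if_pos hG]
  apply um_nil hT hc
  intro F hF
  simp [hF]

/-- filtration. -/
noncomputable def Fil (σ : Finset (FlatVar M)) (k W : ℕ) : Submodule ℝ (ChowPolyR M) :=
  Submodule.span ℝ {p | ∃ g : FlatVar M → ℕ, ∑ F, g F = k ∧ W ≤ ∑ F, g F * M.rk F.1 ∧ p = um σ g}

theorem Fil_mul {σ : Finset (FlatVar M)} {k W k' W' : ℕ} {p q : ChowPolyR M} (hp : p ∈ Fil σ k W)
    (hq : q ∈ Fil σ k' W') : p * q ∈ Fil σ (k + k') (W + W') := by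
  have : Fil σ k W * Fil σ k' W' ≤ Fil σ (k + k') (W + W') := by
    rw [Fil, Fil, Submodule.span_mul_span]
    apply Submodule.span_mono
    rintro _ ⟨_, ⟨g, h1, h2, rfl⟩, _, ⟨g', h1', h2', rfl⟩, rfl⟩
    refine ⟨g + g', ?_, ?_, (um_add σ g g').symm⟩
    · simp [Finset.sum_add_distrib, h1, h1']
    · simp only [Pi.add_apply, add_mul, Finset.sum_add_distrib]; omega
  exact this (Submodule.mul_mem_mul hp hq)

theorem Fil_anti {σ : Finset (FlatVar M)} {k W W' : ℕ} (h : W ≤ W') : Fil σ k W' ≤ Fil σ k W := by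
  apply Submodule.span_mono
  rintro _ ⟨g, h1, h2, rfl⟩
  exact ⟨g, h1, h.trans h2, rfl⟩

theorem Fil_one (σ : Finset (FlatVar M)) : 1 ∈ Fil σ 0 0 :=
  Submodule.subset_span ⟨0, by simp, by simp, (um_zero σ).symm⟩

theorem Fil_pow {σ : Finset (FlatVar M)} {k W : ℕ} {p : ChowPolyR M} (hp : p ∈ Fil σ k W) (n : ℕ) :
    p ^ n ∈ Fil σ (n * k) (n * W) := by
  induction n with
  | zero => simpa using Fil_one σ
  | succ n ih => rw [pow_succ, add_mul, add_mul, one_mul, one_mul]; exact Fil_mul ih hp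

theorem Fil_uu (σ : Finset (FlatVar M)) (L : FlatVar M) : uu σ L ∈ Fil σ 1 (M.rk L.1) := by
  classical
  refine Submodule.subset_span ⟨Pi.single L 1, by simp, ?_, by rw [um_single, pow_one]⟩
  rw [Finset.sum_eq_single L] <;> simp +contextual [Pi.single_apply]

theorem Fil_X (σ : Finset (FlatVar M)) (L : FlatVar M) : X L ∈ Fil σ 1 (M.rk L.1) := by
  classical
  obtain ⟨N, hN⟩ : ∃ N, (Finset.univ : Finset E).card - L.1.card = N := ⟨_, rfl⟩
  induction N using Nat.strong_induction_on generalizing L with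
  | _ N ih =>
  have h1 := Fil_uu σ L
  rw [uu] at h1
  split_ifs at h1
  · rw [hh_eq] at h1
    have h2 : BB M L.1 ∈ Fil σ 1 (M.rk L.1) := by
      rw [BB]
      refine Submodule.sum_mem _ fun F _ => ?_
      split_ifs with h
      · exact Fil_anti (rk_lt M L.2.1 F.2.1 h).le (ih _ (hN ▸ card_dec h) F rfl)
      · exact zero_mem _
    have := Submodule.neg_mem _ (Submodule.add_mem _ h1 h2)
    simpa using this
  · simpa using Submodule.neg_mem _ h1

theorem Fil_BB (σ : Finset (FlatVar M)) (L : FlatVar M) : BB M L.1 ∈ Fil σ 1 (M.rk L.1 + 1) := by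
  rw [BB]
  refine Submodule.sum_mem _ fun F _ => ?_
  split_ifs with h
  · exact Fil_anti (rk_lt M L.2.1 F.2.1 h) (Fil_X σ F)
  · exact zero_mem _

theorem Fil_diff (σ : Finset (FlatVar M)) (L : FlatVar M) (n : ℕ) :
    (- X L) ^ n - hh M L.1 ^ n ∈ Fil σ n (n * M.rk L.1 + 1) := by
  have hX : - X L ∈ Fil σ 1 (M.rk L.1) := Submodule.neg_mem _ (Fil_X σ L)
  have hH : hh M L.1 ∈ Fil σ 1 (M.rk L.1) := by
    rw [hh_eq]; exact Submodule.sub_mem _ hX (Fil_anti (by omega) (Fil_BB σ L))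
  induction n with
  | zero => simp
  | succ n ih =>
    have h1 := Fil_mul ih hX
    have h2 := Fil_mul (Fil_pow hH n) (Fil_BB σ L)
    rw [show (- X L : ChowPolyR M) ^ (n+1) - hh M L.1 ^ (n+1) =
      ((- X L) ^ n - hh M L.1 ^ n) * (- X L) + hh M L.1 ^ n * BB M L.1 by rw [hh_eq]; ring]
    apply Submodule.add_mem
    · rw [show (n + 1) * M.rk L.1 + 1 = n * M.rk L.1 + 1 + M.rk L.1 by ring]
      exact h1
    · rw [show (n + 1) * M.rk L.1 + 1 = n * M.rk L.1 + (M.rk L.1 + 1) by ring]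
      rw [mul_one] at h2
      exact h2

open Classical in
/-- index set of the standard monomials in degree `k` -/
noncomputable def Xk (σ : Finset (FlatVar M)) (k : ℕ) : Finset (FlatVar M → ℕ) :=
  (Finset.piAntidiag Finset.univ k).filter fun e => FY σ e

theorem mem_Xk {σ : Finset (FlatVar M)} {k : ℕ} {e : FlatVar M → ℕ} :
    e ∈ Xk σ k ↔ ∑ F, e F = k ∧ FY σ e := by
  classical
  simp [Xk]

theorem Fil_le {σ : Finset (FlatVar M)} {T : FlatVar M} (hT : T.1 = Finset.univ) (k N W : ℕ)
    (h : W + N = k * M.rk Finset.univ + 1) :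
    Fil σ k W ≤ Submodule.span ℝ (Set.range fun e : Xk σ k => um σ e.1) ⊔
      (JJ σ T).restrictScalars ℝ := by
  classical
  induction N generalizing W with
  | zero =>
    rw [Fil, Submodule.span_le]
    rintro _ ⟨g, h1, h2, rfl⟩
    exfalso
    have : ∑ F, g F * M.rk F.1 ≤ ∑ F, g F * M.rk Finset.univ :=
      Finset.sum_le_sum fun F _ => Nat.mul_le_mul_left _
        (rk_le M F.2.1 M.ground_mem (Finset.subset_univ _))
    rw [← Finset.sum_mul, h1] at this
    omega
  | succ N ih =>
    have ih := ih (W + 1) (by omega)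
    conv_lhs => rw [Fil]
    rw [Submodule.span_le]
    rintro _ ⟨g, h1, h2, rfl⟩
    by_cases hc : Chn (tau σ g)
    swap
    · exact Submodule.mem_sup_right (show um σ g ∈ JJ σ T from um_J1 hT hc)
    by_cases hFY : FY σ g
    · exact Submodule.mem_sup_left (Submodule.subset_span ⟨⟨g, mem_Xk.2 ⟨h1, hFY⟩⟩, rfl⟩)
    have : ∃ G, M.rk G.1 - M.rk (prv (tau σ g) G.1) ≤ g G := by
      by_contra hno
      push Not at hno
      refine hFY ⟨hc, fun G _ => ?_⟩
      have := hno G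
      omega
    obtain ⟨G, hG⟩ := this
    by_cases hGσ : G ∈ σ
    · exact Submodule.mem_sup_right (show um σ g ∈ JJ σ T from um_J2 hT hc G hGσ hG)
    set n := M.rk G.1 - M.rk (prv (tau σ g) G.1) with hn
    set g' := Function.update g G (g G - n) with hg'
    have e1 : um σ g = ((- X G) ^ n - hh M G.1 ^ n) * um σ g' + hh M G.1 ^ n * um σ g' := by
      rw [um_split σ g G n hG, uu, if_neg hGσ]; ring
    rw [e1]
    apply Submodule.add_mem
    · apply ih
      have hs1 : ∑ F, g F = n + ∑ F, g' F := by
        rw [Finset.sum_eq_add_sum_sdiff_singleton_of_mem (Finset.mem_univ G),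
          Finset.sum_eq_add_sum_sdiff_singleton_of_mem (Finset.mem_univ G) g']
        have : ∑ x ∈ Finset.univ \ {G}, g' x = ∑ x ∈ Finset.univ \ {G}, g x := by
          apply Finset.sum_congr rfl
          intro x hx; simp at hx; simp [hg', hx]
        rw [this, hg', Function.update_self]; omega
      have hs2 : ∑ F, g F * M.rk F.1 = n * M.rk G.1 + ∑ F, g' F * M.rk F.1 := by
        rw [Finset.sum_eq_add_sum_sdiff_singleton_of_mem (Finset.mem_univ G),
          Finset.sum_eq_add_sum_sdiff_singleton_of_mem (Finset.mem_univ G) fun F => g' F * M.rk F.1]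
        have : ∑ x ∈ Finset.univ \ {G}, g' x * M.rk x.1 = ∑ x ∈ Finset.univ \ {G}, g x * M.rk x.1 := by
          apply Finset.sum_congr rfl
          intro x hx; simp at hx; simp [hg', hx]
        rw [this, hg', Function.update_self, ← add_assoc, ← add_mul]; congr 2; omega
      have hF : um σ g' ∈ Fil σ (∑ F, g' F) (∑ F, g' F * M.rk F.1) :=
        Submodule.subset_span ⟨g', rfl, le_rfl, rfl⟩
      have := Fil_mul (Fil_diff σ G n) hF
      rw [← hs1, h1] at this
      refine Fil_anti ?_ this
      omega
    · apply Submodule.mem_sup_right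
      show _ ∈ JJ σ T
      apply um_nil hT hc
      intro F hF
      simp [hg', hF]

theorem span_um {σ : Finset (FlatVar M)} {T : FlatVar M} (hT : T.1 = Finset.univ) {k : ℕ}
    {p : ChowPolyR M} (hp : p.IsHomogeneous k) :
    ∃ c : Xk σ k → ℝ, p - ∑ e, c e • um σ e.1 ∈ JJ σ T := by
  have h0 : p ∈ Fil σ k 0 := by
    have h1 : homogeneousSubmodule (FlatVar M) ℝ 1 ≤ Fil σ 1 0 := by
      rw [homogeneousSubmodule_one_eq_span_X, Submodule.span_le]
      rintro _ ⟨F, rfl⟩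
      exact Fil_anti (Nat.zero_le _) (Fil_X σ F)
    have h2 : ∀ n, (Fil σ 1 0) ^ n ≤ Fil σ n 0 := by
      intro n
      induction n with
      | zero =>
        rw [pow_zero, Submodule.one_le]; exact Fil_one σ
      | succ n ih =>
        rw [pow_succ, Submodule.mul_le]
        intro a ha b hb
        have h5 : a ∈ Fil σ n 0 := ih ha
        have h6 := Fil_mul h5 hb
        rw [add_zero] at h6
        exact h6
    have h3 : homogeneousSubmodule (FlatVar M) ℝ 1 ^ k ≤ Fil σ 1 0 ^ k := pow_le_pow_left' h1 k
    have h4 : p ∈ homogeneousSubmodule (FlatVar M) ℝ 1 ^ k := by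
      rw [homogeneousSubmodule_one_pow, mem_homogeneousSubmodule]
      exact hp
    exact h2 k (h3 h4)
  have h1 := Fil_le hT k (k * M.rk Finset.univ + 1) 0 (by omega) h0
  obtain ⟨y, hy, z, hz, rfl⟩ := Submodule.mem_sup.1 h1
  obtain ⟨c, rfl⟩ := (Submodule.mem_span_range_iff_exists_fun ℝ).1 hy
  refine ⟨c, ?_⟩
  rw [add_sub_cancel_left]
  exact hz
end ChowHL

namespace ChowHL
open SimpleFlatMatroid MvPolynomial

variable {E : Type*} [Fintype E] [DecidableEq E] {M : SimpleFlatMatroid E}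

/-- the convex functions. -/
noncomputable def psi (M : SimpleFlatMatroid E) (t : ℝ) (j : ℕ) : ℝ :=
  if j = 0 then 0 else (1 - t) * (2 ^ j * t ^ (2 * Mw M j)) + t ^ (2 * Mw M 0) * (j : ℝ) ^ 2

/-- the classes. -/
noncomputable def ww (M : SimpleFlatMatroid E) (t : ℝ) : ChowPolyR M :=
  ∑ F : FlatVar M, psi M t F.1.card • (- X F)

theorem Wb_two : 2 ≤ Wb M := by unfold Wb; omega

theorem Mw_anti {i j : ℕ} (h : i ≤ j) : Mw M j ≤ Mw M i :=
  Nat.pow_le_pow_right (by have := Wb_two (M := M); omega) (by omega)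

theorem Mw_lt {i j : ℕ} (h : i < j) (hj : j ≤ Fintype.card E) : Mw M j < Mw M i :=
  Nat.pow_lt_pow_right (by have := Wb_two (M := M); omega) (by omega)

theorem conv_of_double (g : ℕ → ℝ) (h0 : ∀ j, 0 ≤ g j) (h : ∀ j, 2 * g j ≤ g (j + 1)) {i j l : ℕ}
    (hij : i < j) (hjl : j < l) : g j * (l - i) ≤ g i * (l - j) + g l * (j - i) := by
  obtain ⟨a, rfl⟩ : ∃ a, l = j + a := ⟨l - j, by omega⟩
  have h1 : ∀ a : ℕ, (a + 1) * g j ≤ g (j + a) := by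
    intro a
    induction a with
    | zero => simp
    | succ a ih =>
      have := h (j + a)
      rw [← add_assoc]
      push_cast
      have h3 : 0 ≤ (a:ℝ) * g j := mul_nonneg (Nat.cast_nonneg _) (h0 j)
      nlinarith
  obtain ⟨b, rfl⟩ : ∃ b, j = i + b := ⟨j - i, by omega⟩
  have h2 := h1 a
  have hb : (1:ℝ) ≤ b := by exact_mod_cast (by omega : 1 ≤ b)
  push_cast
  have e1 : 0 ≤ g i * (a:ℝ) := mul_nonneg (h0 i) (Nat.cast_nonneg _)
  have e2 : ((a:ℝ) + 1) * g (i+b) * b ≤ g (i + b + a) * b :=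
    mul_le_mul_of_nonneg_right h2 (by linarith)
  have e3 : 0 ≤ (a:ℝ) * g (i+b) * (b - 1) :=
    mul_nonneg (mul_nonneg (Nat.cast_nonneg _) (h0 _)) (by linarith)
  nlinarith

theorem psi_conv {t : ℝ} (ht0 : 0 < t) (ht1 : t ≤ 1) {i j l : ℕ} (hij : i < j) (hjl : j < l) :
    psi M t j * (l - i) < psi M t i * (l - j) + psi M t l * (j - i) := by
  set g : ℕ → ℝ := fun j => if j = 0 then 0 else 2 ^ j * t ^ (2 * Mw M j) with hg
  have hpsi : ∀ j, psi M t j = (1 - t) * g j + t ^ (2 * Mw M 0) * (j : ℝ) ^ 2 := by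
    intro j
    rw [psi, hg]
    by_cases h : j = 0
    · simp [h]
    · simp [h]
  have h1 := conv_of_double g (fun j => by simp only [hg]; split_ifs <;> positivity) (fun j => by
    simp only [hg]
    by_cases h : j = 0
    · simp [h]; positivity
    · rw [if_neg h, if_neg (by omega), pow_succ]
      have : t ^ (2 * Mw M j) ≤ t ^ (2 * Mw M (j + 1)) :=
        pow_le_pow_of_le_one ht0.le ht1 (by have := Mw_anti (M := M) (Nat.le_succ j); simp at this; omega)
      have h2 : (0:ℝ) < 2 ^ j := by positivity
      nlinarith) hij hjl
  rw [hpsi, hpsi, hpsi]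
  have h2 := mul_le_mul_of_nonneg_left h1 (by linarith : 0 ≤ 1 - t)
  have h3 : (0:ℝ) < t ^ (2 * Mw M 0) := by positivity
  have ha : (i:ℝ) < j := by exact_mod_cast hij
  have hb : (j:ℝ) < l := by exact_mod_cast hjl
  have h4 : 0 < ((l:ℝ) - i) * (l - j) * (j - i) := by
    apply mul_pos (mul_pos _ _) <;> linarith
  have h5 := mul_pos h3 h4
  nlinarith

/-- `κ` -/
noncomputable def kap (M : SimpleFlatMatroid E) (i j : ℕ) (t : ℝ) : ℝ :=
  (1 - t) * 2 ^ j + t ^ (2 * (Mw M 0 - Mw M j)) * (j : ℝ) ^ 2 -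
    if i = 0 then 0 else (1 - t) * 2 ^ i * t ^ (2 * (Mw M i - Mw M j)) +
      t ^ (2 * (Mw M 0 - Mw M j)) * (i : ℝ) ^ 2

theorem kap_cont (i j : ℕ) : Continuous (kap M i j) := by
  unfold kap
  by_cases h : i = 0
  · simp only [h, if_true]; fun_prop
  · simp only [h, if_false]; fun_prop

theorem kap_zero {i j : ℕ} (hij : i < j) (hj : j ≤ Fintype.card E) : kap M i j 0 = 2 ^ j := by
  have h1 := Mw_lt (M := M) hij hj
  have h2 := Mw_lt (M := M) (i := 0) (j := j) (by omega) hj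
  rw [kap, zero_pow (by omega), zero_pow (by omega)]
  split_ifs <;> simp

theorem psi_diff (t : ℝ) {i j : ℕ} (hij : i < j) :
    psi M t j - psi M t i = t ^ (2 * Mw M j) * kap M i j t := by
  have h1 := Mw_anti (M := M) hij.le
  have h2 := Mw_anti (M := M) (Nat.zero_le j)
  have e1 : t ^ (2 * Mw M i) = t ^ (2 * Mw M j) * t ^ (2 * (Mw M i - Mw M j)) := by
    rw [← pow_add]; congr 1; omega
  have e2 : t ^ (2 * Mw M 0) = t ^ (2 * Mw M j) * t ^ (2 * (Mw M 0 - Mw M j)) := by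
    rw [← pow_add]; congr 1; omega
  rw [psi, psi, kap, if_neg (by omega : ¬ j = 0)]
  split_ifs
  · rw [e2]; ring
  · rw [e1, e2]; ring

theorem telesc {σ : Finset (FlatVar M)} (hσ : Chn σ) (f : Finset E → ℝ) (f0 : f ∅ = 0)
    (L : Finset E) : ∑ G ∈ σ, (if G.1 ⊂ L then f G.1 - f (prv σ G.1) else 0) = f (prv σ L) := by
  obtain ⟨N, hN⟩ : ∃ N, L.card = N := ⟨_, rfl⟩
  induction N using Nat.strong_induction_on generalizing L with
  | _ N ih =>
  rcases prv_cases hσ L with ⟨h, h'⟩ | ⟨P, hP, h1, h2, h3⟩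
  · rw [h, f0]
    exact Finset.sum_eq_zero fun G hG => if_neg (h' G hG)
  · have ih' := ih _ (hN ▸ Finset.card_lt_card h2) P.1 rfl
    rw [← h1]
    have : ∀ G ∈ σ, (if G.1 ⊂ L then f G.1 - f (prv σ G.1) else 0) =
        (if G.1 ⊂ P.1 then f G.1 - f (prv σ G.1) else 0) +
        if G = P then f P.1 - f (prv σ P.1) else 0 := by
      intro G hG
      by_cases hGP : G = P
      · subst hGP; simp [h2]
      · rw [if_neg hGP, add_zero]
        have : G.1 ⊂ L ↔ G.1 ⊂ P.1 := by
          constructor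
          · intro h
            exact (h3 G hG h).ssubset_of_ne fun h' => hGP (Subtype.ext h')
          · intro h; exact h.trans h2
        simp only [this]
    rw [Finset.sum_congr rfl this, Finset.sum_add_distrib, ih', Finset.sum_ite_eq', if_pos hP]
    ring

theorem ww_eq {σ : Finset (FlatVar M)} (hσ : Chn σ) (t : ℝ) : ww M t =
    ∑ G : FlatVar M, (t ^ (2 * Mw M G.1.card) * kap M (prv σ G.1).card G.1.card t) • uu σ G := by
  classical
  have h0 : ∀ G : FlatVar M, t ^ (2 * Mw M G.1.card) * kap M (prv σ G.1).card G.1.card t =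
      psi M t G.1.card - psi M t (prv σ G.1).card := fun G =>
    (psi_diff t (Finset.card_lt_card (prv_ss hσ G))).symm
  simp only [h0]
  have hT := telesc hσ (fun F => psi M t F.card) (by simp [psi])
  set c : FlatVar M → ℝ := fun G => psi M t G.1.card - psi M t (prv σ G.1).card with hc
  have h1 : ∀ G : FlatVar M, c G • uu σ G =
      (if G ∈ σ then ∑ L : FlatVar M, (if G.1 ⊂ L.1 then c G else 0) • (- X L) else 0) +
        c G • (- X G : ChowPolyR M) := by
    intro G
    rw [uu]
    split_ifs
    · have : hh M G.1 = ∑ L : FlatVar M, (if G.1 ⊂ L.1 then (1:ℝ) else 0) • (- X L) + (- X G) := by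
        rw [hh_eq, BB, sub_eq_add_neg, add_comm, ← Finset.sum_neg_distrib]
        congr 1
        apply Finset.sum_congr rfl
        intro L _
        split_ifs <;> simp
      rw [this, smul_add, Finset.smul_sum]
      congr 1
      apply Finset.sum_congr rfl
      intro L _
      split_ifs <;> simp
    · rw [zero_add]
  rw [Finset.sum_congr rfl fun G _ => h1 G, Finset.sum_add_distrib, Finset.sum_ite_mem,
    Finset.univ_inter, Finset.sum_comm, ← Finset.sum_add_distrib, ww]
  apply Finset.sum_congr rfl
  intro L _
  rw [← Finset.sum_smul, ← add_smul]
  congr 1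
  rw [hT L.1]
  ring
end ChowHL

namespace ChowHL
open SimpleFlatMatroid MvPolynomial

variable {E : Type*} [Fintype E] [DecidableEq E] {M : SimpleFlatMatroid E}

noncomputable def kp (σ : Finset (FlatVar M)) (G : FlatVar M) (t : ℝ) : ℝ :=
  kap M (prv σ G.1).card G.1.card t

/-- the rescaled Gram matrix. -/
noncomputable def KK (σ : Finset (FlatVar M)) (m : ℕ) (t : ℝ) (e e' : FlatVar M → ℕ) : ℝ :=
  ∑ f ∈ Finset.piAntidiag Finset.univ m, (Nat.multinomial Finset.univ f : ℝ) *
    (∏ G, kp σ G t ^ f G) *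
    (t ^ (exd σ e e' (e + e' + f)).toNat * ll σ (um σ (e + e' + f)))

theorem KK_cont (σ : Finset (FlatVar M)) (m : ℕ) (e e' : FlatVar M → ℕ) :
    Continuous fun t => KK σ m t e e' := by
  unfold KK
  have h : ∀ G, Continuous fun t => kp σ G t := fun G => kap_cont _ _
  refine continuous_finsetSum _ fun f _ => ?_
  refine Continuous.mul (Continuous.mul continuous_const ?_) ?_
  · exact continuous_finsetProd _ fun G _ => (h G).pow _
  · exact (continuous_pow _).mul continuous_const

theorem KK_symm (σ : Finset (FlatVar M)) (m : ℕ) (t : ℝ) (e e' : FlatVar M → ℕ) :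
    KK σ m t e e' = KK σ m t e' e := by
  unfold KK
  apply Finset.sum_congr rfl
  intro f _
  have : exd σ e e' (e + e' + f) = exd σ e' e (e' + e + f) := by
    rw [add_comm e e']
    unfold exd
    apply Finset.sum_congr rfl
    intro G _; ring
  rw [this, add_comm e e']

/-- the scaling exponent -/
def ssx (σ : Finset (FlatVar M)) (e : FlatVar M → ℕ) : ℤ :=
  ∑ G : FlatVar M, (Mw M G.1.card : ℤ) * (2 * e G - full σ (tau σ e) G)

theorem exd_eq (σ : Finset (FlatVar M)) (e e' f : FlatVar M → ℕ) :
    exd σ e e' (e + e' + f) = ssx σ e + ssx σ e' +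
      ((∑ G : FlatVar M, 2 * Mw M G.1.card * f G : ℕ) : ℤ) := by
  unfold exd ssx
  push_cast
  rw [← Finset.sum_add_distrib, ← Finset.sum_add_distrib]
  apply Finset.sum_congr rfl
  intro G _
  simp only [Pi.add_apply]; push_cast; ring

theorem ww_pow {σ : Finset (FlatVar M)} (hσ : Chn σ) (t : ℝ) (m : ℕ) : ww M t ^ m =
    ∑ f ∈ Finset.piAntidiag Finset.univ m, ((Nat.multinomial Finset.univ f : ℝ) *
      (∏ G, kp σ G t ^ f G) * t ^ (∑ G : FlatVar M, 2 * Mw M G.1.card * f G)) • um σ f := by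
  rw [ww_eq hσ, Finset.sum_pow_eq_sum_piAntidiag]
  apply Finset.sum_congr rfl
  intro f _
  simp only [smul_pow, mul_pow, um]
  rw [Finset.prod_smul, Finset.prod_mul_distrib, ← Finset.prod_pow_eq_pow_sum]
  simp only [← pow_mul, kp]
  rw [mul_comm (∏ i : FlatVar M, t ^ _), mul_assoc, mul_smul (Nat.multinomial _ _ : ℝ)]
  simp [smul_eq_C_mul]

theorem exd_nonneg {σ : Finset (FlatVar M)} {T : FlatVar M} (hT : T.1 = Finset.univ) (hTσ : T ∈ σ)
    {e e' : FlatVar M → ℕ} (he : FY σ e) (he' : FY σ e') (f : FlatVar M → ℕ)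
    (h : ll σ (um σ (e + e' + f)) ≠ 0) : 0 < exd σ e e' (e + e' + f) ∨
      (exd σ e e' (e + e' + f) = 0 ∧ e + e' + f = full σ (tau σ e) ∧
        e + e' + f = full σ (tau σ e')) := by
  rcases V1 hT hTσ (e + e' + f) e e' (fun F hF => by simp; omega) (fun F hF => by simp; omega)
    he.1 he'.1 h with h1 | ⟨h1, h2⟩
  · exact Or.inl h1
  · refine Or.inr ⟨?_, h1, h2⟩
    unfold exd
    rw [← h1, ← h2]
    apply Finset.sum_eq_zero
    intro G _; ring

theorem KK_pos {σ : Finset (FlatVar M)} {T : FlatVar M} (hT : T.1 = Finset.univ) (hTσ : T ∈ σ)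
    (hσ : Chn σ) {t : ℝ} (ht : 0 < t) (m : ℕ) {e e' : FlatVar M → ℕ} (he : FY σ e) (he' : FY σ e') :
    KK σ m t e e' = t ^ ssx σ e * t ^ ssx σ e' * ll σ (um σ e * um σ e' * ww M t ^ m) := by
  rw [ww_pow hσ, Finset.mul_sum, map_sum, Finset.mul_sum, KK]
  apply Finset.sum_congr rfl
  intro f _
  rw [mul_smul_comm, map_smul, ← um_add, ← um_add, smul_eq_mul]
  by_cases h : ll σ (um σ (e + e' + f)) = 0
  · rw [h]; ring
  have h0 : 0 ≤ exd σ e e' (e + e' + f) := by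
    rcases exd_nonneg hT hTσ he he' f h with h1 | ⟨h1, -⟩ <;> omega
  have h2 : t ^ (exd σ e e' (e + e' + f)).toNat = t ^ ssx σ e * t ^ ssx σ e' *
      t ^ (∑ G : FlatVar M, 2 * Mw M G.1.card * f G) := by
    rw [← zpow_natCast, Int.toNat_of_nonneg h0, exd_eq, zpow_add₀ ht.ne', zpow_add₀ ht.ne',
      zpow_natCast]
  rw [h2]; ring

/-- monomials -/
noncomputable def mx (g : FlatVar M → ℕ) : ChowPolyR M := ∏ F, X F ^ g F

noncomputable def toF (g : FlatVar M → ℕ) : FlatVar M →₀ ℕ := Finsupp.equivFunOnFinite.symm g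

theorem mx_eq (g : FlatVar M → ℕ) : mx g = monomial (toF g) (1:ℝ) := by
  rw [monomial_eq, Finsupp.prod_fintype _ _ (by simp)]
  simp [mx, toF]

theorem toF_add (g g' : FlatVar M → ℕ) : toF (g + g') = toF g + toF g' := by
  ext F; simp [toF]

theorem toF_inj {g g' : FlatVar M → ℕ} : toF g = toF g' ↔ g = g' :=
  Finsupp.equivFunOnFinite.symm.injective.eq_iff

theorem mx_add (g g' : FlatVar M → ℕ) : (mx (g + g') : ChowPolyR M) = mx g * mx g' := by
  simp only [mx, ← Finset.prod_mul_distrib, Pi.add_apply, pow_add]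

theorem mx_hom (g : FlatVar M → ℕ) : (mx g : ChowPolyR M).IsHomogeneous (∑ F, g F) := by
  rw [mx_eq]
  apply isHomogeneous_monomial
  rw [Finsupp.degree_eq_sum]
  simp [toF]

theorem coeff_mx (φ g : FlatVar M → ℕ) [Decidable (g = φ)] :
    lcoeff ℝ (toF φ) (mx g) = if g = φ then 1 else 0 := by
  classical
  rw [lcoeff_apply, mx_eq, coeff_monomial]
  by_cases h : g = φ
  · simp [h]
  · rw [if_neg h, if_neg (fun h' => h (toF_inj.1 h'))]

theorem coeff_shift (φ ψ : FlatVar M → ℕ) (p : ChowPolyR M) :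
    lcoeff ℝ (toF (ψ + φ)) (mx ψ * p) = lcoeff ℝ (toF φ) p := by
  rw [lcoeff_apply, lcoeff_apply, mx_eq, toF_add, coeff_monomial_mul, one_mul]

/-- the limit class. -/
noncomputable def wR (M : SimpleFlatMatroid E) : ChowPolyR M := ∑ G : FlatVar M, C ((2:ℝ) ^ G.1.card) * X G

theorem wR_hom : (wR M).IsHomogeneous 1 :=
  IsHomogeneous.sum _ _ _ fun i _ => (isHomogeneous_X ℝ i).C_mul _

theorem wR_pow (m : ℕ) : wR M ^ m =
    ∑ f ∈ Finset.piAntidiag Finset.univ m, ((Nat.multinomial Finset.univ f : ℝ) *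
      (∏ G : FlatVar M, ((2:ℝ) ^ G.1.card) ^ f G)) • mx f := by
  rw [wR, Finset.sum_pow_eq_sum_piAntidiag]
  apply Finset.sum_congr rfl
  intro f _
  simp only [mul_pow, mx]
  rw [Finset.prod_mul_distrib, smul_eq_C_mul, C_mul, mul_assoc, map_prod]
  simp

theorem tau_full {σ : Finset (FlatVar M)} {e : FlatVar M → ℕ} (he : Chn (tau σ e)) (G : FlatVar M) :
    G ∈ tau σ e ↔ G ∈ σ ∨ full σ (tau σ e) G ≠ 0 := by
  constructor
  · intro h
    by_cases hG : G ∈ σ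
    · exact Or.inl hG
    · right
      rw [full, if_pos h, if_neg hG]
      have := rk_lt M (prv_flat he G.1) G.2.1 (prv_ss he G)
      omega
  · rintro (h | h)
    · exact mem_tau.2 (Or.inr h)
    · by_contra h'
      exact h (full_notmem h')

theorem tau_eq_of_full {σ : Finset (FlatVar M)} {e e' : FlatVar M → ℕ} (he : Chn (tau σ e))
    (he' : Chn (tau σ e')) (h : full σ (tau σ e) = full σ (tau σ e')) : tau σ e = tau σ e' := by
  ext G
  rw [tau_full he, tau_full he', h]

theorem KK_zero {σ : Finset (FlatVar M)} {T : FlatVar M} (hT : T.1 = Finset.univ) (hTσ : T ∈ σ)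
    (hσ : Chn σ) (m : ℕ) {e e' : FlatVar M → ℕ} (he : FY σ e) (he' : FY σ e') :
    KK σ m 0 e e' = if tau σ e = tau σ e' then (-1) ^ (tau σ e \ σ).card *
      lcoeff ℝ (toF (full σ (tau σ e))) (mx e * mx e' * wR M ^ m) else 0 := by
  classical
  have hsub : σ ⊆ tau σ e := fun F hF => mem_tau.2 (Or.inr hF)
  have hk : ∀ G : FlatVar M, kp σ G 0 = 2 ^ G.1.card := fun G =>
    kap_zero (Finset.card_lt_card (prv_ss hσ G)) (Finset.card_le_univ _)
  have hterm : ∀ f, (0:ℝ) ^ (exd σ e e' (e + e' + f)).toNat * ll σ (um σ (e + e' + f)) =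
      if tau σ e = tau σ e' then (-1) ^ (tau σ e \ σ).card *
        (if e + e' + f = full σ (tau σ e) then 1 else 0) else 0 := by
    intro f
    by_cases h : ll σ (um σ (e + e' + f)) = 0
    · rw [h, mul_zero]
      split_ifs with h1 h2
      · rw [h2, ll_full hT hTσ hsub he.1] at h
        simp at h
      · simp
      · rfl
    · rcases exd_nonneg hT hTσ he he' f h with h1 | ⟨h1, h2, h3⟩
      · rw [zero_pow (by omega), zero_mul]
        split_ifs with h4 h5
        · exfalso
          have : exd σ e e' (e + e' + f) = 0 := by
            unfold exd
            rw [← h4, ← h5]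
            apply Finset.sum_eq_zero
            intro G _; ring
          omega
        · simp
        · rfl
      · rw [h1, if_pos (tau_eq_of_full he.1 he'.1 (h2.symm.trans h3)), if_pos h2, h2,
          ll_full hT hTσ hsub he.1]
        simp
  rw [KK]
  simp only [hterm, hk]
  split_ifs with h
  · rw [wR_pow, Finset.mul_sum, map_sum, Finset.mul_sum]
    apply Finset.sum_congr rfl
    intro f _
    rw [mul_smul_comm, map_smul, ← mx_add, ← mx_add, coeff_mx, smul_eq_mul]
    ring
  · simp
end ChowHL

namespace ChowHL
open SimpleFlatMatroid MvPolynomial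

variable {E : Type*} [Fintype E] [DecidableEq E] {M : SimpleFlatMatroid E}

noncomputable def Yk (σ : Finset (FlatVar M)) (q k : ℕ) : Finset (FlatVar M → ℕ) :=
  (Xk σ (k - q)).filter fun e => ∑ F, e F + q = k

theorem mem_Yk {σ : Finset (FlatVar M)} {q k : ℕ} {e : FlatVar M → ℕ} :
    e ∈ Yk σ q k ↔ ∑ F, e F + q = k ∧ FY σ e := by
  rw [Yk, Finset.mem_filter, mem_Xk]
  constructor
  · rintro ⟨⟨-, h⟩, h'⟩; exact ⟨h', h⟩
  · rintro ⟨h, h'⟩; exact ⟨⟨by omega, h'⟩, h⟩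

def ind (σ τ : Finset (FlatVar M)) : FlatVar M → ℕ := fun G => if G ∈ τ \ σ then 1 else 0

def nn (σ τ : Finset (FlatVar M)) : FlatVar M → ℕ := full σ τ - (ind σ τ + ind σ τ)

def good (σ τ : Finset (FlatVar M)) : Prop :=
  σ ⊆ τ ∧ Chn τ ∧ ∀ G ∈ τ, G ∉ σ → 2 ≤ full σ τ G

theorem good_tau {σ : Finset (FlatVar M)} {e : FlatVar M → ℕ} (he : FY σ e) : good σ (tau σ e) := by
  refine ⟨fun F hF => mem_tau.2 (Or.inr hF), he.1, fun G hG hGσ => ?_⟩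
  have h1 := he.2 G hG
  rw [full, if_pos hG, if_neg hGσ]
  have : e G ≠ 0 := (mem_tau.1 hG).resolve_right hGσ
  omega

theorem full_split {σ τ : Finset (FlatVar M)} (h : good σ τ) :
    full σ τ = ind σ τ + ind σ τ + nn σ τ := by
  funext G
  simp only [nn, ind, Pi.add_apply, Pi.sub_apply]
  split_ifs with hG
  · rw [Finset.mem_sdiff] at hG
    have := h.2.2 G hG.1 hG.2
    omega
  · simp

theorem sum_ind (σ τ : Finset (FlatVar M)) : ∑ G, ind σ τ G = (τ \ σ).card := by
  simp only [ind]
  rw [Finset.sum_ite_mem, Finset.univ_inter, Finset.card_eq_sum_ones]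

theorem ind_split {σ : Finset (FlatVar M)} {e : FlatVar M → ℕ} :
    e = ind σ (tau σ e) + (e - ind σ (tau σ e)) := by
  funext G
  simp only [ind, Pi.add_apply, Pi.sub_apply, Finset.mem_sdiff, mem_tau]
  split_ifs with hG
  · have := hG.1.resolve_right hG.2
    omega
  · simp

theorem e_le {σ : Finset (FlatVar M)} {e : FlatVar M → ℕ} (he : FY σ e) (G : FlatVar M) :
    e G - ind σ (tau σ e) G ≤ nn σ (tau σ e) G := by
  simp only [ind, nn, Pi.add_apply, Pi.sub_apply, full]
  by_cases hG : G ∈ tau σ e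
  · have h1 := he.2 G hG
    by_cases hGσ : G ∈ σ
    · simp [hG, hGσ]; omega
    · simp [hG, hGσ]; omega
  · have : e G = 0 := by
      by_contra h
      exact hG (mem_tau.2 (Or.inl h))
    simp [this]

/-- inverse of the correspondence -/
theorem FY_of_le {σ τ : Finset (FlatVar M)} (h : good σ τ) {a : FlatVar M → ℕ}
    (ha : ∀ G, a G ≤ nn σ τ G) : FY σ (ind σ τ + a) ∧ tau σ (ind σ τ + a) = τ := by
  have ht : tau σ (ind σ τ + a) = τ := by
    ext G
    rw [mem_tau]
    have h1 := ha G
    simp only [ind, nn, Pi.add_apply, Pi.sub_apply, full, Finset.mem_sdiff] at h1 ⊢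
    by_cases hG : G ∈ τ
    · by_cases hGσ : G ∈ σ <;> simp [hG, hGσ]
    · have hGσ : G ∉ σ := fun h' => hG (h.1 h')
      simp [hG, hGσ] at h1 ⊢; exact h1
  refine ⟨?_, ht⟩
  rw [FY, ht]
  refine ⟨h.2.1, fun G hG => ?_⟩
  have h1 := ha G
  have h2 := h.2.2 G hG
  have h3 := rk_lt M (prv_flat h.2.1 G.1) G.2.1 (prv_ss h.2.1 G)
  simp only [ind, nn, Pi.add_apply, Pi.sub_apply, full, Finset.mem_sdiff, if_pos hG] at h1 h2 ⊢
  by_cases hGσ : G ∈ σ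
  · simp [hG, hGσ] at h1 h2 ⊢; omega
  · simp [hG, hGσ] at h1 h2 ⊢; omega

noncomputable def pol (σ : Finset (FlatVar M)) (Y : Finset (FlatVar M → ℕ)) (τ : Finset (FlatVar M))
    (v : Y → ℝ) : ChowPolyR M :=
  ∑ e : Y, if tau σ e.1 = τ then v e • mx (e.1 - ind σ τ) else 0

theorem pol_hom {σ τ : Finset (FlatVar M)} {q k j : ℕ} (v : Yk σ q k → ℝ)
    (hj : j + (τ \ σ).card + q = k) : (pol σ (Yk σ q k) τ v).IsHomogeneous j := by
  unfold pol
  apply IsHomogeneous.sum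
  intro e _
  split_ifs with h
  · rw [smul_eq_C_mul]
    apply IsHomogeneous.C_mul
    have h1 := (mem_Yk.1 e.2).1
    have h2 := congrArg (fun f : FlatVar M → ℕ => ∑ G, f G) (ind_split (σ := σ) (e := e.1))
    simp only [Pi.add_apply, Finset.sum_add_distrib, sum_ind] at h2
    rw [h] at h2
    have h3 := mx_hom (e.1 - ind σ τ)
    rwa [show ∑ F, (e.1 - ind σ τ) F = j by omega] at h3
  · exact isHomogeneous_zero _ _ _

theorem pol_zero {σ τ : Finset (FlatVar M)} {q k : ℕ} (v : Yk σ q k → ℝ)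
    (hj : k < (τ \ σ).card + q) : pol σ (Yk σ q k) τ v = 0 := by
  unfold pol
  apply Finset.sum_eq_zero
  intro e _
  split_ifs with h
  · exfalso
    have h1 := (mem_Yk.1 e.2).1
    have h2 := congrArg (fun f : FlatVar M → ℕ => ∑ G, f G) (ind_split (σ := σ) (e := e.1))
    simp only [Pi.add_apply, Finset.sum_add_distrib, sum_ind] at h2
    rw [h] at h2
    omega
  · rfl

theorem pol_bad {σ τ : Finset (FlatVar M)} {q k : ℕ} (v : Yk σ q k → ℝ)
    (hj : ¬ good σ τ) : pol σ (Yk σ q k) τ v = 0 := by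
  unfold pol
  apply Finset.sum_eq_zero
  intro e _
  split_ifs with h
  · exact absurd (h ▸ good_tau (mem_Yk.1 e.2).2) hj
  · rfl

theorem pol_coeff {σ τ : Finset (FlatVar M)} {q k : ℕ} (v : Yk σ q k → ℝ) (e0 : Yk σ q k)
    (h0 : tau σ e0.1 = τ) :
    lcoeff ℝ (toF (nn σ τ)) (pol σ (Yk σ q k) τ v * mx (nn σ τ - (e0.1 - ind σ τ))) = v e0 := by
  classical
  unfold pol
  rw [Finset.sum_mul, map_sum, Finset.sum_eq_single e0]
  · rw [if_pos h0, smul_mul_assoc, map_smul, ← mx_add, coeff_mx, if_pos, smul_eq_mul, mul_one]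
    funext G
    have := e_le (mem_Yk.1 e0.2).2 G
    rw [h0] at this
    simp only [Pi.add_apply, Pi.sub_apply]
    omega
  · intro e _ hne
    split_ifs with h
    · rw [smul_mul_assoc, map_smul, ← mx_add, coeff_mx, if_neg, smul_zero]
      intro h1
      apply hne
      apply Subtype.ext
      funext G
      have h2 := congrFun h1 G
      have h3 := e_le (mem_Yk.1 e0.2).2 G
      have h4 := e_le (mem_Yk.1 e.2).2 G
      have h5 := congrFun (ind_split (σ := σ) (e := e.1)) G
      have h6 := congrFun (ind_split (σ := σ) (e := e0.1)) G
      rw [h0] at h3 h6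
      rw [h] at h4 h5
      simp only [Pi.add_apply, Pi.sub_apply] at h2 h5 h6
      omega
    · simp
  · simp

theorem prim_mon {σ τ : Finset (FlatVar M)} (hg : good σ τ) {q k j : ℕ} (p : ChowPolyR M)
    (hj : j + (τ \ σ).card + q = k)
    (h : ∀ e : Yk σ q k, tau σ e.1 = τ →
      lcoeff ℝ (toF (nn σ τ)) (mx (e.1 - ind σ τ) * p) = 0)
    (b : ChowPolyR M) (hb : b.IsHomogeneous j) : lcoeff ℝ (toF (nn σ τ)) (b * p) = 0 := by
  classical
  rw [b.as_sum, Finset.sum_mul, map_sum]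
  apply Finset.sum_eq_zero
  intro a ha
  have hdeg : ∑ G, a G = j := by
    have := hb.degree_eq_sum_deg_support ha
    rw [this, ← Finsupp.degree_eq_sum]; rfl
  rw [show monomial a (coeff a b) = coeff a b • mx (M := M) (fun G => a G) by
    rw [mx_eq, smul_monomial, smul_eq_mul, mul_one]; congr 1; ext; simp [toF]]
  rw [smul_mul_assoc, map_smul]
  by_cases hle : ∀ G, a G ≤ nn σ τ G
  · obtain ⟨h1, h2⟩ := FY_of_le hg hle
    have h3 := h ⟨ind σ τ + fun G => a G, mem_Yk.2 ⟨by
      simp only [Pi.add_apply, Finset.sum_add_distrib, sum_ind]; omega, h1⟩⟩ h2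
    simp only [add_tsub_cancel_left] at h3
    rw [h3, smul_zero]
  · rw [mx_eq, lcoeff_apply, coeff_monomial_mul', if_neg, smul_zero]
    intro h'
    exact hle fun G => by simpa [toF] using h' G

theorem deg_nn {σ τ : Finset (FlatVar M)} {T : FlatVar M} (hT : T.1 = Finset.univ) (hTσ : T ∈ σ)
    (hg : good σ τ) {d : ℕ} (hd : σ.card + d = M.rk Finset.univ) :
    (toF (nn σ τ)).degree + 2 * (τ \ σ).card = d := by
  have h1 := sum_full hT hTσ hg.1 hg.2.1
  have h2 := congrArg (fun f : FlatVar M → ℕ => ∑ G, f G) (full_split hg)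
  simp only [Pi.add_apply, Finset.sum_add_distrib, sum_ind] at h2
  rw [Finsupp.degree_eq_sum]
  simp only [toF, Finsupp.equivFunOnFinite_symm_apply_apply]
  omega

theorem KK_row {σ : Finset (FlatVar M)} {T : FlatVar M} (hT : T.1 = Finset.univ) (hTσ : T ∈ σ)
    (hσ : Chn σ) (m : ℕ) {q k : ℕ} (u : Yk σ q k → ℝ) {e' : FlatVar M → ℕ} (he' : FY σ e') :
    ∑ e : Yk σ q k, KK σ m 0 e' e.1 * u e = (-1) ^ (tau σ e' \ σ).card *
      lcoeff ℝ (toF (nn σ (tau σ e'))) (mx (e' - ind σ (tau σ e')) *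
        (pol σ (Yk σ q k) (tau σ e') u * wR M ^ m)) := by
  rw [pol, Finset.sum_mul, Finset.mul_sum, map_sum, Finset.mul_sum]
  apply Finset.sum_congr rfl
  intro e _
  rw [KK_zero hT hTσ hσ m he' (mem_Yk.1 e.2).2]
  by_cases h : tau σ e.1 = tau σ e'
  · rw [if_pos h.symm, if_pos h, smul_mul_assoc, mul_smul_comm, map_smul, smul_eq_mul,
      full_split (good_tau he')]
    have : mx e' * mx e.1 * wR M ^ m = mx (ind σ (tau σ e') + ind σ (tau σ e')) *
        (mx (e' - ind σ (tau σ e')) * (mx (e.1 - ind σ (tau σ e')) * wR M ^ m)) := by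
      rw [← mul_assoc, ← mul_assoc, ← mx_add, ← mx_add, ← mx_add]
      congr 2
      have h1 := ind_split (σ := σ) (e := e')
      have h2 := ind_split (σ := σ) (e := e.1)
      rw [h] at h2
      funext G
      have h1 := congrFun h1 G
      have h2 := congrFun h2 G
      simp only [Pi.add_apply, Pi.sub_apply] at h1 h2 ⊢
      omega
    rw [this, coeff_shift]
    ring
  · rw [if_neg (fun h' => h h'.symm), if_neg h]; simp

theorem KK_quad {σ : Finset (FlatVar M)} {T : FlatVar M} (hT : T.1 = Finset.univ) (hTσ : T ∈ σ)
    (hσ : Chn σ) (m : ℕ) {q k : ℕ} (u : Yk σ q k → ℝ) :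
    ∑ e' : Yk σ q k, u e' * ∑ e : Yk σ q k, KK σ m 0 e'.1 e.1 * u e =
      ∑ τ : Finset (FlatVar M), (-1) ^ (τ \ σ).card *
        lcoeff ℝ (toF (nn σ τ)) (pol σ (Yk σ q k) τ u * pol σ (Yk σ q k) τ u * wR M ^ m) := by
  classical
  have h1 : ∀ τ : Finset (FlatVar M), (-1 : ℝ) ^ (τ \ σ).card *
        lcoeff ℝ (toF (nn σ τ)) (pol σ (Yk σ q k) τ u * pol σ (Yk σ q k) τ u * wR M ^ m) =
      ∑ e' : Yk σ q k, if tau σ e'.1 = τ then u e' * ((-1) ^ (τ \ σ).card *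
      lcoeff ℝ (toF (nn σ τ)) (mx (e'.1 - ind σ τ) *
        (pol σ (Yk σ q k) τ u * wR M ^ m))) else 0 := by
    intro τ
    conv_lhs =>
      rw [mul_assoc (pol σ (Yk σ q k) τ u)]
      arg 2; arg 2; arg 1
      rw [pol]
    rw [Finset.sum_mul, map_sum, Finset.mul_sum]
    apply Finset.sum_congr rfl
    intro e _
    split_ifs
    · rw [smul_mul_assoc, map_smul, smul_eq_mul]; ring
    · simp
  simp only [h1]
  rw [Finset.sum_comm]
  apply Finset.sum_congr rfl
  intro e' _
  rw [Finset.sum_ite_eq, if_pos (Finset.mem_univ _), KK_row hT hTσ hσ m u (mem_Yk.1 e'.2).2]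

set_option maxHeartbeats 1000000 in
theorem tau_term {σ τ : Finset (FlatVar M)} {T : FlatVar M} (hT : T.1 = Finset.univ) (hTσ : T ∈ σ)
    {d k m : ℕ} (hd : σ.card + d = M.rk Finset.univ) (hk : 2 * k + m = d)
    (v : Yk σ 0 k → ℝ) (u : Yk σ 1 k → ℝ)
    (h : ∀ e : Yk σ 1 k, tau σ e.1 = τ →
      lcoeff ℝ (toF (nn σ τ)) (mx (e.1 - ind σ τ) * (pol σ (Yk σ 1 k) τ u * wR M ^ (m + 2))) =
      lcoeff ℝ (toF (nn σ τ)) (mx (e.1 - ind σ τ) * (pol σ (Yk σ 0 k) τ v * wR M ^ (m + 1)))) :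
    0 ≤ (-1) ^ k * ((-1) ^ (τ \ σ).card * lcoeff ℝ (toF (nn σ τ))
          (pol σ (Yk σ 0 k) τ v * pol σ (Yk σ 0 k) τ v * wR M ^ m)) -
        (-1) ^ k * ((-1) ^ (τ \ σ).card * lcoeff ℝ (toF (nn σ τ))
          (pol σ (Yk σ 1 k) τ u * pol σ (Yk σ 1 k) τ u * wR M ^ (m + 2))) ∧
    (u = 0 → lcoeff ℝ (toF (nn σ τ))
          (pol σ (Yk σ 0 k) τ v * pol σ (Yk σ 0 k) τ v * wR M ^ m) = 0 →
      ∀ e : Yk σ 0 k, tau σ e.1 = τ → v e = 0) := by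
  by_cases hg : good σ τ
  swap
  · rw [pol_bad v hg, pol_bad u hg]
    refine ⟨by simp, fun _ _ e he => absurd (he ▸ good_tau (mem_Yk.1 e.2).2) hg⟩
  by_cases hs : k < (τ \ σ).card
  · rw [pol_zero v (by omega), pol_zero u (by omega)]
    refine ⟨by simp, fun _ _ e he => ?_⟩
    rw [← pol_coeff v e he, pol_zero v (by omega)]
    simp
  push Not at hs
  obtain ⟨j, hj⟩ : ∃ j, k = j + (τ \ σ).card := ⟨k - (τ \ σ).card, by omega⟩
  obtain ⟨s, hs'⟩ : ∃ s, (τ \ σ).card = s := ⟨_, rfl⟩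
  have hdeg := deg_nn hT hTσ hg hd
  have hHR : HR (lcoeff ℝ (toF (nn σ τ))) (wR M) (toF (nn σ τ)).degree :=
    HR_coeff (fun G : FlatVar M => (2:ℝ) ^ G.1.card) (fun _ => by positivity) (toF (nn σ τ))
  set V := pol σ (Yk σ 0 k) τ v with hV
  set U := pol σ (Yk σ 1 k) τ u with hU
  set l := lcoeff ℝ (toF (nn σ τ)) with hl
  have hVh : V.IsHomogeneous j := pol_hom v (by omega)
  have hUh : ∀ i, i + 1 = j → U.IsHomogeneous i := fun i hi => pol_hom u (by omega)
  have hwU : (wR M * U).IsHomogeneous j := by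
    rcases Nat.eq_zero_or_pos j with h0 | h0
    · have : U = 0 := pol_zero u (by omega)
      rw [this, mul_zero]; exact isHomogeneous_zero _ _ _
    · obtain ⟨i, rfl⟩ : ∃ i, j = 1 + i := ⟨j - 1, by omega⟩
      exact wR_hom.mul (hUh i (by omega))
  have hprim : ∀ i, i + 1 = j → ∀ b : ChowPolyR M, b.IsHomogeneous i →
      l ((V - wR M * U) * b * wR M ^ (m + 1)) = 0 := by
    intro i hi b hb
    rw [show (V - wR M * U) * b * wR M ^ (m + 1) = b * ((V - wR M * U) * wR M ^ (m + 1)) by ring]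
    refine prim_mon hg (q := 1) (k := k) _ (by omega) (fun e he => ?_) b hb
    have := h e he
    rw [show mx (e.1 - ind σ τ) * ((V - wR M * U) * wR M ^ (m + 1)) =
      mx (e.1 - ind σ τ) * (V * wR M ^ (m + 1)) - mx (e.1 - ind σ τ) * (U * wR M ^ (m + 2)) by ring,
      map_sub, this, sub_self]
  obtain ⟨h1, h2⟩ := hHR j m (by omega) (V - wR M * U) (hVh.sub hwU) hprim
  have hcross : l ((V - wR M * U) * U * wR M ^ (m + 1)) = 0 := by
    rcases Nat.eq_zero_or_pos j with h0 | h0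
    · have : U = 0 := pol_zero u (by omega)
      rw [this]; simp
    · exact hprim (j - 1) (by omega) U (hUh _ (by omega))
  have hquad : l ((V - wR M * U) * (V - wR M * U) * wR M ^ m) =
      l (V * V * wR M ^ m) - l (U * U * wR M ^ (m + 2)) := by
    rw [show (V - wR M * U) * (V - wR M * U) * wR M ^ m = V * V * wR M ^ m -
      U * U * wR M ^ (m + 2) - (V - wR M * U) * U * wR M ^ (m + 1) - (V - wR M * U) * U * wR M ^ (m + 1) by
        ring, map_sub, map_sub, map_sub, hcross, sub_zero, sub_zero]
  constructor
  · have hsign : (-1 : ℝ) ^ k * (-1) ^ (τ \ σ).card = (-1) ^ j := by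
      rw [hj, pow_add, mul_assoc, ← mul_pow]; simp
    rw [hquad] at h1
    rw [← mul_sub, ← mul_sub, ← mul_assoc, hsign]
    exact h1
  · intro hu hz e he
    have hU0 : U = 0 := by rw [hU, hu, pol]; simp
    rw [hU0, mul_zero, sub_zero] at h2
    rw [← pol_coeff v e he]
    apply h2 hz
    have h3 := mx_hom (nn σ τ - (e.1 - ind σ τ))
    convert h3 using 1
    have h4 := (mem_Yk.1 e.2).1
    have h5 := e_le (mem_Yk.1 e.2).2
    have h6 := congrArg (fun f : FlatVar M → ℕ => ∑ G, f G) (ind_split (σ := σ) (e := e.1))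
    rw [he] at h5 h6
    simp only [Pi.add_apply, Finset.sum_add_distrib, sum_ind] at h6
    have h7 : ∑ G, (nn σ τ - (e.1 - ind σ τ)) G + ∑ G, (e.1 - ind σ τ) G = ∑ G, nn σ τ G := by
      rw [← Finset.sum_add_distrib]
      apply Finset.sum_congr rfl
      intro G _
      have := h5 G
      simp only [Pi.sub_apply]; omega
    rw [Finsupp.degree_eq_sum] at hdeg
    simp only [toF, Finsupp.equivFunOnFinite_symm_apply_apply] at hdeg
    omega

end ChowHL

namespace ChowHL
open SimpleFlatMatroid MvPolynomial Matrix
variable {E : Type*} [Fintype E] [DecidableEq E] {M : SimpleFlatMatroid E}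

set_option maxHeartbeats 1000000 in
/-- Nondegeneracy of the limit form. -/
theorem N0 {σ : Finset (FlatVar M)} {T : FlatVar M} (hT : T.1 = Finset.univ) (hTσ : T ∈ σ)
    (hσ : Chn σ) {d q j0 m : ℕ} (hd : σ.card + d = M.rk Finset.univ) (hk : 2 * j0 + m = d)
    (u : Yk σ q (j0 + q) → ℝ)
    (h : ∀ e' : Yk σ q (j0 + q), ∑ e : Yk σ q (j0 + q), KK σ m 0 e'.1 e.1 * u e = 0) : u = 0 := by
  funext e
  obtain ⟨τ, he⟩ : ∃ τ, tau σ e.1 = τ := ⟨_, rfl⟩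
  have hg : good σ τ := he ▸ good_tau (mem_Yk.1 e.2).2
  rw [← pol_coeff u e he, Pi.zero_apply]
  by_cases hs : j0 < (τ \ σ).card
  · rw [pol_zero u (by omega)]; simp
  obtain ⟨j, hj⟩ : ∃ j, j0 = j + (τ \ σ).card := ⟨j0 - (τ \ σ).card, by omega⟩
  have hdeg := deg_nn hT hTσ hg hd
  have hHR : HR (lcoeff ℝ (toF (nn σ τ))) (wR M) (toF (nn σ τ)).degree :=
    HR_coeff (fun G : FlatVar M => (2:ℝ) ^ G.1.card) (fun _ => by positivity) (toF (nn σ τ))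
  have hU : (pol σ (Yk σ q (j0 + q)) τ u).IsHomogeneous j := pol_hom u (by omega)
  set U := pol σ (Yk σ q (j0 + q)) τ u with hUdef
  have hz : ∀ b : ChowPolyR M, b.IsHomogeneous j →
      lcoeff ℝ (toF (nn σ τ)) (b * (U * wR M ^ m)) = 0 := by
    refine fun b hb => prim_mon hg (q := q) (k := j0 + q) _ (by omega) (fun e' he' => ?_) b hb
    have h1 := h e'
    rw [KK_row hT hTσ hσ m u (mem_Yk.1 e'.2).2, he'] at h1
    exact (mul_eq_zero.1 h1).resolve_left (pow_ne_zero _ (by norm_num))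
  obtain ⟨-, h2⟩ := hHR j m (by omega) U hU (fun i hi b hb => by
    rw [show U * b * wR M ^ (m + 1) = (b * wR M) * (U * wR M ^ m) by ring]
    refine hz _ ?_
    rw [← hi]; exact hb.mul wR_hom)
  apply h2 (by rw [mul_assoc]; exact hz _ hU)
  have h3 := mx_hom (nn σ τ - (e.1 - ind σ τ))
  convert h3 using 1
  have h4 := (mem_Yk.1 e.2).1
  have h5 := e_le (mem_Yk.1 e.2).2
  have h6 := congrArg (fun f : FlatVar M → ℕ => ∑ G, f G) (ind_split (σ := σ) (e := e.1))
  rw [he] at h5 h6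
  simp only [Pi.add_apply, Finset.sum_add_distrib, sum_ind] at h6
  have h7 : ∑ G, (nn σ τ - (e.1 - ind σ τ)) G + ∑ G, (e.1 - ind σ τ) G = ∑ G, nn σ τ G := by
    rw [← Finset.sum_add_distrib]
    apply Finset.sum_congr rfl
    intro G _
    have := h5 G
    simp only [Pi.sub_apply]; omega
  rw [Finsupp.degree_eq_sum] at hdeg
  simp only [toF, Finsupp.equivFunOnFinite_symm_apply_apply] at hdeg
  omega

/-- the matrix of the deformed form -/
noncomputable def KM (σ : Finset (FlatVar M)) (m : ℕ) (q q' k : ℕ) (t : ℝ) :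
    Matrix (Yk σ q k) (Yk σ q' k) ℝ := fun e e' => (-1) ^ k * KK σ m t e.1 e'.1

theorem KM_cont (σ : Finset (FlatVar M)) (m q q' k : ℕ) : Continuous (KM σ m q q' k) := by
  refine continuous_pi fun e => continuous_pi fun e' => ?_
  exact continuous_const.mul (KK_cont σ m e.1 e'.1)

theorem KM_tr (σ : Finset (FlatVar M)) (m q q' k : ℕ) (t : ℝ) :
    (KM σ m q q' k t)ᵀ = KM σ m q' q k t := by
  ext e e'
  simp only [transpose_apply, KM]
  rw [KK_symm]

theorem KM_mulVec (σ : Finset (FlatVar M)) (m q q' k : ℕ) (t : ℝ) (u) (e) :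
    (KM σ m q q' k t *ᵥ u) e = (-1) ^ k * ∑ e' : Yk σ q' k, KK σ m t e.1 e'.1 * u e' := by
  simp only [mulVec, dotProduct, KM, Finset.mul_sum, mul_assoc]

theorem KM_zero_iff (σ : Finset (FlatVar M)) (m q q' k : ℕ) (t : ℝ) (u) :
    KM σ m q q' k t *ᵥ u = 0 ↔ ∀ e : Yk σ q k, ∑ e' : Yk σ q' k, KK σ m t e.1 e'.1 * u e' = 0 := by
  rw [funext_iff]
  refine forall_congr' fun e => ?_
  rw [KM_mulVec, Pi.zero_apply, mul_eq_zero]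
  exact or_iff_right (pow_ne_zero _ (by norm_num))

set_option maxHeartbeats 1000000 in
theorem KM_h0 {σ : Finset (FlatVar M)} {T : FlatVar M} (hT : T.1 = Finset.univ) (hTσ : T ∈ σ)
    (hσ : Chn σ) {d k m : ℕ} (hd : σ.card + d = M.rk Finset.univ) (hk : 2 * k + m = d)
    (v : Yk σ 0 k → ℝ) (u : Yk σ 1 k → ℝ)
    (h : KM σ (m+2) 1 1 k 0 *ᵥ u = KM σ (m+1) 1 0 k 0 *ᵥ v) :
    0 ≤ v ⬝ᵥ KM σ m 0 0 k 0 *ᵥ v - u ⬝ᵥ KM σ (m+2) 1 1 k 0 *ᵥ u ∧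
      (v ⬝ᵥ KM σ m 0 0 k 0 *ᵥ v = 0 → u = 0 → v = 0) := by
  have hn : ((-1:ℝ)) ^ k ≠ 0 := pow_ne_zero _ (by norm_num)
  have hq : ∀ (m q : ℕ) (u : Yk σ q k → ℝ), u ⬝ᵥ KM σ m q q k 0 *ᵥ u =
      ∑ τ : Finset (FlatVar M), (-1) ^ k * ((-1) ^ (τ \ σ).card *
        lcoeff ℝ (toF (nn σ τ)) (pol σ (Yk σ q k) τ u * pol σ (Yk σ q k) τ u * wR M ^ m)) := by
    intro m q u
    rw [← Finset.mul_sum, ← KK_quad hT hTσ hσ m u]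
    simp only [dotProduct, KM_mulVec]
    rw [Finset.mul_sum]
    exact Finset.sum_congr rfl fun e _ => by ring
  have hrow : ∀ (τ : Finset (FlatVar M)) (e : Yk σ 1 k), tau σ e.1 = τ →
      lcoeff ℝ (toF (nn σ τ)) (mx (e.1 - ind σ τ) * (pol σ (Yk σ 1 k) τ u * wR M ^ (m + 2))) =
      lcoeff ℝ (toF (nn σ τ)) (mx (e.1 - ind σ τ) * (pol σ (Yk σ 0 k) τ v * wR M ^ (m + 1))) := by
    rintro _ e rfl
    have h1 := congrFun h e
    rw [KM_mulVec, KM_mulVec, KK_row hT hTσ hσ _ u (mem_Yk.1 e.2).2,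
      KK_row hT hTσ hσ _ v (mem_Yk.1 e.2).2] at h1
    exact mul_left_cancel₀ (pow_ne_zero _ (by norm_num)) (mul_left_cancel₀ hn h1)
  have ht := fun τ => tau_term hT hTσ hd hk v u (hrow τ)
  rw [hq, hq]
  constructor
  · rw [← Finset.sum_sub_distrib]
    exact Finset.sum_nonneg fun τ _ => (ht τ).1
  · intro h0 hu
    have hz : ∀ τ, pol σ (Yk σ 1 k) τ u = 0 := fun τ => by rw [hu, pol]; simp
    rw [Finset.sum_eq_zero_iff_of_nonneg] at h0
    · funext e
      refine (ht (tau σ e.1)).2 hu ?_ e rfl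
      have := h0 (tau σ e.1) (Finset.mem_univ _)
      exact (mul_eq_zero.1 ((mul_eq_zero.1 this).resolve_left hn)).resolve_left
        (pow_ne_zero _ (by norm_num))
    · intro τ _
      have := (ht τ).1
      rw [hz] at this
      simpa using this

end ChowHL

namespace ChowHL
open SimpleFlatMatroid MvPolynomial Matrix
variable {E : Type*} [Fintype E] [DecidableEq E] {M : SimpleFlatMatroid E}

/-- Hard Lefschetz property for a functional. -/
def HL {ι : Type*} (l : MvPolynomial ι ℝ →ₗ[ℝ] ℝ) (w : MvPolynomial ι ℝ) (d : ℕ) : Prop :=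
  ∀ k m, 2 * k + m = d → ∀ a : MvPolynomial ι ℝ, a.IsHomogeneous k →
    (∀ b : MvPolynomial ι ℝ, b.IsHomogeneous k → l (a * b * w ^ m) = 0) →
    ∀ c : MvPolynomial ι ℝ, c.IsHomogeneous (k + m) → l (a * c) = 0

theorem uu_hom (σ : Finset (FlatVar M)) (F : FlatVar M) : (uu σ F).IsHomogeneous 1 := by
  unfold uu
  split_ifs
  · unfold hh
    apply IsHomogeneous.sum
    intro L _
    split_ifs
    · exact (isHomogeneous_X _ _).neg
    · exact isHomogeneous_zero _ _ _
  · exact (isHomogeneous_X _ _).neg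

theorem um_hom (σ : Finset (FlatVar M)) (g : FlatVar M → ℕ) : (um σ g).IsHomogeneous (∑ F, g F) := by
  unfold um
  apply IsHomogeneous.prod
  intro F _
  simpa using (uu_hom σ F).pow (g F)

theorem smul_hom {p : ChowPolyR M} {n : ℕ} (hp : p.IsHomogeneous n) (c : ℝ) :
    (c • p).IsHomogeneous n := by
  rw [smul_eq_C_mul]; exact hp.C_mul c

theorem ww_hom (t : ℝ) : (ww M t).IsHomogeneous 1 := by
  unfold ww
  apply IsHomogeneous.sum
  intro F _
  exact smul_hom (isHomogeneous_X _ _).neg _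

/-- rescaled monomials -/
noncomputable def tm (σ : Finset (FlatVar M)) (t : ℝ) (e : FlatVar M → ℕ) : ChowPolyR M :=
  t ^ ssx σ e • um σ e

theorem tm_hom (σ : Finset (FlatVar M)) (t : ℝ) (g : FlatVar M → ℕ) :
    (tm σ t g).IsHomogeneous (∑ F, g F) := smul_hom (um_hom σ g) _

theorem KK_tm {σ : Finset (FlatVar M)} {T : FlatVar M} (hT : T.1 = Finset.univ) (hTσ : T ∈ σ)
    (hσ : Chn σ) {t : ℝ} (ht : 0 < t) (m : ℕ) {e e' : FlatVar M → ℕ} (he : FY σ e) (he' : FY σ e') :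
    KK σ m t e e' = ll σ (tm σ t e * tm σ t e' * ww M t ^ m) := by
  rw [KK_pos hT hTσ hσ ht m he he', tm, tm, smul_mul_smul_comm, smul_mul_assoc, map_smul, smul_eq_mul]

theorem KK_sum {σ : Finset (FlatVar M)} {T : FlatVar M} (hT : T.1 = Finset.univ) (hTσ : T ∈ σ)
    (hσ : Chn σ) {t : ℝ} (ht : 0 < t) (m : ℕ) {q k : ℕ} (u : Yk σ q k → ℝ) {e : FlatVar M → ℕ}
    (he : FY σ e) : ∑ e' : Yk σ q k, KK σ m t e e'.1 * u e' =
      ll σ (tm σ t e * (∑ e' : Yk σ q k, u e' • tm σ t e'.1) * ww M t ^ m) := by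
  rw [Finset.mul_sum, Finset.sum_mul, map_sum]
  apply Finset.sum_congr rfl
  intro e' _
  rw [KK_tm hT hTσ hσ ht m he (mem_Yk.1 e'.2).2, mul_smul_comm, smul_mul_assoc, map_smul, smul_eq_mul,
    mul_comm]

theorem ll_JJ {σ : Finset (FlatVar M)} {T : FlatVar M} (hT : T.1 = Finset.univ) (hTσ : T ∈ σ)
    {p p' : ChowPolyR M} (h : p - p' ∈ JJ σ T) (c : ChowPolyR M) : ll σ (c * p) = ll σ (c * p') := by
  rw [← sub_eq_zero, ← map_sub, ← mul_sub]
  exact ll_ideal hT hTσ (mem_JJ.1 (Ideal.mul_mem_left _ c h))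

theorem span_tm {σ : Finset (FlatVar M)} {T : FlatVar M} (hT : T.1 = Finset.univ) {j q : ℕ} {t : ℝ}
    (ht : 0 < t) {p : ChowPolyR M} (hp : p.IsHomogeneous j) :
    ∃ c : Yk σ q (j + q) → ℝ, p - ∑ e, c e • tm σ t e.1 ∈ JJ σ T := by
  have hX : Yk σ q (j + q) = Xk σ j := by
    ext e; rw [mem_Yk, mem_Xk]; simp
  rw [hX]
  obtain ⟨c, hc⟩ := span_um (σ := σ) hT hp
  refine ⟨fun e => c e * (t ^ ssx σ e.1)⁻¹, ?_⟩
  convert hc using 3 with e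
  rw [tm, smul_smul, mul_assoc, inv_mul_cancel₀ (zpow_ne_zero _ ht.ne'), mul_one]

theorem test_all {σ : Finset (FlatVar M)} {T : FlatVar M} (hT : T.1 = Finset.univ) (hTσ : T ∈ σ)
    {j q : ℕ} {t : ℝ} (ht : 0 < t) (p : ChowPolyR M)
    (h : ∀ e : Yk σ q (j + q), ll σ (tm σ t e.1 * p) = 0) {b : ChowPolyR M} (hb : b.IsHomogeneous j) :
    ll σ (b * p) = 0 := by
  obtain ⟨c, hc⟩ := span_tm (σ := σ) (q := q) hT ht hb
  rw [mul_comm, ll_JJ hT hTσ hc, mul_comm, Finset.sum_mul, map_sum]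
  apply Finset.sum_eq_zero
  intro e _
  rw [smul_mul_assoc, map_smul, h e, smul_zero]

theorem comb_hom {σ : Finset (FlatVar M)} {j q : ℕ} {t : ℝ} (u : Yk σ q (j + q) → ℝ) :
    (∑ e, u e • tm σ t e.1).IsHomogeneous j := by
  apply IsHomogeneous.sum
  intro e _
  have h := tm_hom σ t e.1
  rw [show ∑ F, e.1 F = j by have := (mem_Yk.1 e.2).1; omega] at h
  exact smul_hom h _

theorem exists_small {α : Type*} [Fintype α] (A : ℝ → Matrix α α ℝ) (hA : Continuous A)
    (h0 : ∀ u, A 0 *ᵥ u = 0 → u = 0) : ∃ t : ℝ, 0 < t ∧ ∀ u, A t *ᵥ u = 0 → u = 0 := by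
  classical
  have hdet0 : (A 0).det ≠ 0 := by
    intro h
    obtain ⟨v, hv, hv0⟩ := Matrix.exists_mulVec_eq_zero_iff.2 h
    exact hv (h0 v hv0)
  have hev : ∀ᶠ t in nhds (0:ℝ), (A t).det ≠ 0 := hA.matrix_det.continuousAt.eventually_ne hdet0
  obtain ⟨ε, hε, hb⟩ := Metric.eventually_nhds_iff.1 hev
  refine ⟨ε / 2, by positivity, fun u hu => ?_⟩
  by_contra hne
  refine hb (y := ε / 2) ?_ (Matrix.exists_mulVec_eq_zero_iff.1 ⟨u, hne, hu⟩)
  rw [Real.dist_eq, sub_zero, abs_of_pos (by positivity)]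
  linarith

theorem small_t {σ : Finset (FlatVar M)} {T : FlatVar M} (hT : T.1 = Finset.univ) (hTσ : T ∈ σ)
    (hσ : Chn σ) {d q j0 m : ℕ} (hd : σ.card + d = M.rk Finset.univ) (hk : 2 * j0 + m = d) :
    ∃ t : ℝ, 0 < t ∧ ∀ u : Yk σ q (j0 + q) → ℝ, KM σ m q q (j0 + q) t *ᵥ u = 0 → u = 0 :=
  exists_small _ (KM_cont σ m q q (j0 + q)) fun v hv =>
    N0 hT hTσ hσ hd hk v ((KM_zero_iff σ m q q (j0 + q) 0 v).1 hv)

theorem Knondeg {σ : Finset (FlatVar M)} {T : FlatVar M} (hT : T.1 = Finset.univ) (hTσ : T ∈ σ)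
    (hσ : Chn σ) {d q j0 m : ℕ} (hd : σ.card + d = M.rk Finset.univ) (hk : 2 * j0 + m = d)
    {t : ℝ} (ht : 0 < t) (hHL : HL (ll σ) (ww M t) d) (u : Yk σ q (j0 + q) → ℝ)
    (hu : KM σ m q q (j0 + q) t *ᵥ u = 0) : u = 0 := by
  obtain ⟨t0, ht0, hnd⟩ := small_t (q := q) hT hTσ hσ hd hk
  rw [KM_zero_iff] at hu
  set a := ∑ e' : Yk σ q (j0 + q), u e' • tm σ t e'.1 with ha
  have ha0 := comb_hom (t := t) u
  have h1 : ∀ c : ChowPolyR M, c.IsHomogeneous (j0 + m) → ll σ (a * c) = 0 := by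
    refine hHL j0 m hk a ha0 fun b hb => ?_
    rw [show a * b * ww M t ^ m = b * (a * ww M t ^ m) by ring]
    refine test_all (q := q) hT hTσ ht _ (fun e => ?_) hb
    rw [← mul_assoc, ha, ← KK_sum hT hTσ hσ ht m u (mem_Yk.1 e.2).2]
    exact hu e
  have h2 : (fun e : Yk σ q (j0 + q) => u e * t ^ ssx σ e.1 * (t0 ^ ssx σ e.1)⁻¹) = 0 := by
    apply hnd
    rw [KM_zero_iff]
    intro e
    rw [KK_sum hT hTσ hσ ht0 m _ (mem_Yk.1 e.2).2]
    have : ∑ e' : Yk σ q (j0 + q), (u e' * t ^ ssx σ e'.1 * (t0 ^ ssx σ e'.1)⁻¹) • tm σ t0 e'.1 = a := by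
      rw [ha]
      apply Finset.sum_congr rfl
      intro e' _
      rw [tm, tm, smul_smul, smul_smul, mul_assoc (u e' * _),
        inv_mul_cancel₀ (zpow_ne_zero _ ht0.ne'), mul_one]
    rw [this, mul_comm (tm σ t0 e.1), mul_assoc]
    apply h1
    have h3 := (tm_hom σ t0 e.1).mul ((ww_hom (M := M) t0).pow m)
    rw [show ∑ F, e.1 F = j0 by have := (mem_Yk.1 e.2).1; omega, one_mul] at h3
    exact h3
  funext e
  have h3 := congrFun h2 e
  simp only [Pi.zero_apply, mul_eq_zero, inv_eq_zero] at h3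
  rcases h3 with (h3 | h3) | h3
  · exact h3
  · exact absurd h3 (zpow_ne_zero _ ht.ne')
  · exact absurd h3 (zpow_ne_zero _ ht0.ne')

theorem KM_hc {σ : Finset (FlatVar M)} {T : FlatVar M} (hT : T.1 = Finset.univ) (hTσ : T ∈ σ)
    (hσ : Chn σ) {k m : ℕ} {s : ℝ} (hs : 0 < s) (u : Yk σ 1 k → ℝ) :
    ∃ c, KM σ m 0 0 k s *ᵥ c = (KM σ (m+1) 1 0 k s)ᵀ *ᵥ u ∧
      KM σ (m+1) 1 0 k s *ᵥ c = KM σ (m+2) 1 1 k s *ᵥ u := by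
  obtain ⟨b, hb⟩ : ∃ b, b = ∑ e' : Yk σ 1 k, u e' • tm σ s e'.1 := ⟨_, rfl⟩
  have hwb : (ww M s * b).IsHomogeneous k := by
    rw [hb, Finset.mul_sum]
    apply IsHomogeneous.sum
    intro e _
    rw [mul_smul_comm]
    have h := (ww_hom (M := M) s).mul (tm_hom σ s e.1)
    rw [show 1 + ∑ F, e.1 F = k by have := (mem_Yk.1 e.2).1; omega] at h
    exact smul_hom h _
  obtain ⟨c, hc⟩ : ∃ c : Yk σ 0 k → ℝ, ww M s * b - ∑ e, c e • tm σ s e.1 ∈ JJ σ T :=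
    span_tm (q := 0) hT hs hwb
  obtain ⟨p, hp⟩ : ∃ p, p = ∑ e : Yk σ 0 k, c e • tm σ s e.1 := ⟨_, rfl⟩
  rw [← hp] at hc
  have key : ∀ (x : ChowPolyR M) (n : ℕ), ll σ (x * p * ww M s ^ n) = ll σ (x * b * ww M s ^ (n+1)) := by
    intro x n
    rw [mul_right_comm, ← ll_JJ hT hTσ hc]
    exact congrArg _ (by ring)
  refine ⟨c, ?_, ?_⟩
  · rw [KM_tr]
    funext e
    rw [KM_mulVec, KM_mulVec]
    refine congrArg _ ?_
    rw [KK_sum hT hTσ hσ hs m c (mem_Yk.1 e.2).2, KK_sum hT hTσ hσ hs (m+1) u (mem_Yk.1 e.2).2,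
      ← hb, ← hp, key]
  · funext e
    rw [KM_mulVec, KM_mulVec]
    refine congrArg _ ?_
    rw [KK_sum hT hTσ hσ hs (m+1) c (mem_Yk.1 e.2).2, KK_sum hT hTσ hσ hs (m+2) u (mem_Yk.1 e.2).2,
      ← hb, ← hp, key]

set_option maxHeartbeats 1000000 in
theorem HR_of_HL {σ : Finset (FlatVar M)} {T : FlatVar M} (hT : T.1 = Finset.univ) (hTσ : T ∈ σ)
    (hσ : Chn σ) {d : ℕ} (hd : σ.card + d = M.rk Finset.univ)
    (hHL : ∀ t : ℝ, 0 < t → t ≤ 1 → HL (ll σ) (ww M t) d) {t : ℝ} (ht : 0 < t) (ht1 : t ≤ 1) :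
    HR (ll σ) (ww M t) d := by
  classical
  intro k m hk a ha hprim
  have hpath := path_lemma (KM σ m 0 0 k) (KM σ (m+1) 1 0 k) (KM σ (m+2) 1 1 k) (KM_cont _ _ _ _ _)
    (KM_cont _ _ _ _ _) (KM_cont _ _ _ _ _) (fun t => KM_tr _ _ _ _ _ _) (fun t => KM_tr _ _ _ _ _ _)
    (by
      intro s hs u hu
      rcases k with _ | j
      · funext e
        have := (mem_Yk.1 e.2).1
        omega
      · rcases hs.1.eq_or_lt with h0 | h0
        · rw [← h0, KM_zero_iff] at hu
          exact N0 hT hTσ hσ (j0 := j) hd (by omega) u hu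
        · exact Knondeg hT hTσ hσ (j0 := j) hd (by omega) h0 (hHL s h0 hs.2) u hu)
    (fun s hs u hu => Knondeg (q := 0) hT hTσ hσ hd hk hs.1 (hHL s hs.1 hs.2) u hu)
    (by
      intro s hs u
      exact KM_hc hT hTσ hσ hs.1 u)
    (fun v u h => KM_h0 hT hTσ hσ hd hk v u h) t ⟨ht.le, ht1⟩
  obtain ⟨v, hv⟩ : ∃ v : Yk σ 0 k → ℝ, a - ∑ e, v e • tm σ t e.1 ∈ JJ σ T := span_tm (q := 0) hT ht ha
  by_cases hv0 : v = 0
  · have : ∀ c, ll σ (a * c) = 0 := by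
      intro c
      rw [mul_comm, ll_JJ hT hTσ hv, hv0]; simp
    rw [mul_assoc, this]
    exact ⟨by simp, fun _ c _ => this c⟩
  have hB : KM σ (m+1) 1 0 k t *ᵥ v = 0 := by
    rw [KM_zero_iff]
    intro e
    rw [KK_sum hT hTσ hσ ht (m+1) v (mem_Yk.1 e.2).2, mul_right_comm, ← ll_JJ hT hTσ hv,
      mul_comm _ a, ← mul_assoc]
    exact hprim _ (mem_Yk.1 e.2).1 _ (tm_hom σ t e.1)
  have hpos := hpath v hv0 hB
  have hval : v ⬝ᵥ KM σ m 0 0 k t *ᵥ v = (-1) ^ k * ll σ (a * a * ww M t ^ m) := by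
    obtain ⟨p, hp⟩ : ∃ p, p = ∑ e : Yk σ 0 k, v e • tm σ t e.1 := ⟨_, rfl⟩
    rw [← hp] at hv
    have h1 : ll σ (a * a * ww M t ^ m) = ll σ (p * p * ww M t ^ m) := by
      rw [mul_right_comm, ll_JJ hT hTσ hv,
        show a * ww M t ^ m * p = ww M t ^ m * p * a by ring, ll_JJ hT hTσ hv]
      exact congrArg _ (by ring)
    rw [h1]
    conv_rhs => rw [mul_assoc, hp, Finset.sum_mul, map_sum, Finset.mul_sum]
    simp only [dotProduct, KM_mulVec]
    apply Finset.sum_congr rfl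
    intro e _
    rw [KK_sum hT hTσ hσ ht m v (mem_Yk.1 e.2).2, smul_mul_assoc, map_smul, smul_eq_mul,
      ← mul_assoc (tm σ t e.1), ← mul_assoc, mul_comm (v e), mul_assoc]
  rw [hval] at hpos
  refine ⟨hpos.le, fun h => ?_⟩
  rw [h] at hpos
  simp at hpos

end ChowHL

namespace ChowHL
open SimpleFlatMatroid MvPolynomial
variable {E : Type*} [Fintype E] [DecidableEq E] {M : SimpleFlatMatroid E}

/-- piecewise linear interpolation along a chain -/
theorem interp {σ : Finset (FlatVar M)} (hσ : Chn σ) (f : Finset E → ℝ) (hf : f ∅ = 0) :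
    ∃ lam : E → ℝ, ∀ N ∈ σ, ∀ G : Finset E, prv σ N.1 ⊆ G → G ⊆ N.1 →
      ∑ a ∈ G, lam a = f (prv σ N.1) + (f N.1 - f (prv σ N.1)) /
        ((N.1.card : ℝ) - ((prv σ N.1).card : ℝ)) * ((G.card : ℝ) - ((prv σ N.1).card : ℝ)) := by
  classical
  obtain ⟨sl, hsl⟩ : ∃ sl : FlatVar M → ℝ, sl = fun N => (f N.1 - f (prv σ N.1)) /
        ((N.1.card : ℝ) - ((prv σ N.1).card : ℝ)) := ⟨_, rfl⟩
  have hcmp : ∀ N ∈ σ, ∀ N' ∈ σ, N' ≠ N → (N'.1 ⊆ prv σ N.1 ∨ N.1 ⊆ prv σ N'.1) := by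
    intro N hN N' hN' hne
    have hne' : N'.1 ≠ N.1 := fun h => hne (Subtype.ext h)
    have key : ∀ A ∈ σ, ∀ B ∈ σ, A.1 ⊂ B.1 → A.1 ⊆ prv σ B.1 := by
      intro A hA B hB hAB
      rcases prv_cases hσ B.1 with ⟨-, h⟩ | ⟨P, hP, h1, -, h3⟩
      · exact absurd hAB (h A hA)
      · rw [← h1]; exact h3 A hA hAB
    rcases hσ N hN N' hN' with h | h
    · exact Or.inr (key N hN N' hN' (h.ssubset_of_ne hne'.symm))
    · exact Or.inl (key N' hN' N hN (h.ssubset_of_ne hne'))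
  obtain ⟨lam, hlam⟩ : ∃ lam : E → ℝ, lam = fun a => ∑ N ∈ σ, if a ∈ N.1 \ prv σ N.1 then sl N else 0 :=
    ⟨_, rfl⟩
  have hsum : ∀ G : Finset E, ∑ a ∈ G, lam a = ∑ N ∈ σ, ((G ∩ (N.1 \ prv σ N.1)).card : ℝ) * sl N := by
    intro G
    rw [hlam, Finset.sum_comm]
    apply Finset.sum_congr rfl
    intro N _
    rw [Finset.sum_ite_mem, Finset.sum_const, nsmul_eq_mul]
  have hstep : ∀ N ∈ σ, ∀ G : Finset E, prv σ N.1 ⊆ G → G ⊆ N.1 →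
      ∑ a ∈ G, lam a = ∑ a ∈ prv σ N.1, lam a +
        sl N * ((G.card : ℝ) - ((prv σ N.1).card : ℝ)) := by
    intro N hN G h1 h2
    rw [hsum, hsum, ← Finset.add_sum_erase σ _ hN, ← Finset.add_sum_erase σ _ hN]
    have e1 : G ∩ (N.1 \ prv σ N.1) = G \ prv σ N.1 := by
      ext x; simp only [Finset.mem_inter, Finset.mem_sdiff]
      exact ⟨fun h => ⟨h.1, h.2.2⟩, fun h => ⟨h.1, h2 h.1, h.2⟩⟩
    have e2 : prv σ N.1 ∩ (N.1 \ prv σ N.1) = ∅ := by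
      ext x; simp only [Finset.mem_inter, Finset.mem_sdiff, Finset.notMem_empty, iff_false]
      exact fun h => h.2.2 h.1
    have e3 : ∑ N' ∈ σ.erase N, ((G ∩ (N'.1 \ prv σ N'.1)).card : ℝ) * sl N' =
        ∑ N' ∈ σ.erase N, ((prv σ N.1 ∩ (N'.1 \ prv σ N'.1)).card : ℝ) * sl N' := by
      apply Finset.sum_congr rfl
      intro N' hN'
      obtain ⟨hne, hN'⟩ := Finset.mem_erase.1 hN'
      congr 3
      ext x; simp only [Finset.mem_inter, Finset.mem_sdiff]
      rcases hcmp N hN N' hN' hne with h | h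
      · exact ⟨fun hx => ⟨h hx.2.1, hx.2⟩, fun hx => ⟨h1 hx.1, hx.2⟩⟩
      · exact ⟨fun hx => absurd (h (h2 hx.1)) hx.2.2, fun hx => ⟨h1 hx.1, hx.2⟩⟩
    rw [e1, e2, e3, Finset.cast_card_sdiff h1]
    simp
    ring
  have hval : ∀ n, ∀ N ∈ σ, N.1.card = n → ∑ a ∈ N.1, lam a = f N.1 ∧
      ∑ a ∈ prv σ N.1, lam a = f (prv σ N.1) := by
    intro n
    induction n using Nat.strong_induction_on with
    | _ n ih =>
      intro N hN hn
      have hp : ∑ a ∈ prv σ N.1, lam a = f (prv σ N.1) := by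
        rcases prv_cases hσ N.1 with ⟨h, -⟩ | ⟨P, hP, h1, h2, -⟩
        · rw [h, hf, Finset.sum_empty]
        · rw [← h1]
          exact (ih _ (hn ▸ Finset.card_lt_card h2) P hP rfl).1
      have hss := prv_ss hσ N
      have hc : ((N.1.card : ℝ) - ((prv σ N.1).card : ℝ)) ≠ 0 := by
        have : ((prv σ N.1).card : ℝ) < N.1.card := by exact_mod_cast Finset.card_lt_card hss
        linarith
      refine ⟨?_, hp⟩
      rw [hstep N hN N.1 hss.1 subset_rfl, hp, hsl]
      field_simp
      ring
  refine ⟨lam, fun N hN G h1 h2 => ?_⟩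
  rw [hstep N hN G h1 h2, (hval _ N hN rfl).2, hsl]

theorem lam_mem (lam : E → ℝ) : ∑ F : FlatVar M, (∑ a ∈ F.1, lam a) • (X F : ChowPolyR M) ∈ chowIdealR M := by
  have h : ∑ F : FlatVar M, (∑ a ∈ F.1, lam a) • (X F : ChowPolyR M) = ∑ a, C (lam a) * LL M a := by
    simp only [LL, Finset.mul_sum, Finset.sum_smul]
    rw [Finset.sum_comm]
    apply Finset.sum_congr rfl
    intro F _
    rw [← Finset.sum_filter_add_sum_filter_not Finset.univ (fun a => a ∈ F.1)]
    rw [Finset.sum_eq_zero (s := Finset.univ.filter fun a => a ∉ F.1), add_zero]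
    · rw [show Finset.univ.filter (fun a => a ∈ F.1) = F.1 by ext; simp]
      apply Finset.sum_congr rfl
      intro a ha
      rw [if_pos ha, smul_eq_C_mul]
    · intro a ha
      rw [if_neg (Finset.mem_filter.1 ha).2, mul_zero]
  rw [h]
  exact Ideal.sum_mem _ fun a _ => Ideal.mul_mem_left _ _ (LL_mem a)

theorem ll_I {σ : Finset (FlatVar M)} {T : FlatVar M} (hT : T.1 = Finset.univ) (hTσ : T ∈ σ)
    {q : ChowPolyR M} (h : q ∈ chowIdealR M) (p : ChowPolyR M) : ll σ (q * p) = 0 :=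
  ll_ideal hT hTσ (Ideal.mul_mem_left _ _ (Ideal.mul_mem_right _ _ h))

/-- flats compatible with the chain -/
def Cmp (σ : Finset (FlatVar M)) (F : FlatVar M) : Prop := ∀ G ∈ σ, F.1 ⊆ G.1 ∨ G.1 ⊆ F.1

theorem ll_inc {σ : Finset (FlatVar M)} {T : FlatVar M} (hT : T.1 = Finset.univ) (hTσ : T ∈ σ)
    {F : FlatVar M} (h : ¬ Cmp σ F) (p : ChowPolyR M) : ll σ (X F * p) = 0 := by
  unfold Cmp at h
  push Not at h
  obtain ⟨G, hG, h1, h2⟩ := h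
  have hne : G ≠ T := by
    rintro rfl
    exact h1 (hT ▸ Finset.subset_univ _)
  refine ll_ideal hT hTσ ?_
  rw [← Finset.mul_prod_erase _ _ (Finset.mem_erase.2 ⟨hne, hG⟩)]
  rw [show X G * (∏ F ∈ (σ.erase T).erase G, X F) * (X F * p) =
    (∏ F ∈ (σ.erase T).erase G, X F) * p * (X F * X G) by ring]
  exact Ideal.mul_mem_left _ _ (XX_mem h1 h2)

theorem Cmp_gap {σ : Finset (FlatVar M)} {T : FlatVar M} (hT : T.1 = Finset.univ) (hTσ : T ∈ σ)
    (hσ : Chn σ) {F : FlatVar M} (h : Cmp σ F) (hF : F ∉ σ) :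
    ∃ N ∈ σ, prv σ N.1 ⊂ F.1 ∧ F.1 ⊂ N.1 := by
  classical
  obtain ⟨N, hN, hmin⟩ := Finset.exists_min_image (σ.filter fun N => F.1 ⊆ N.1) (fun N => N.1.card)
    ⟨T, Finset.mem_filter.2 ⟨hTσ, hT ▸ Finset.subset_univ _⟩⟩
  obtain ⟨hN, hFN⟩ := Finset.mem_filter.1 hN
  refine ⟨N, hN, ?_, hFN.ssubset_of_ne fun h => hF (Subtype.ext h ▸ hN)⟩
  rcases prv_cases hσ N.1 with ⟨h1, -⟩ | ⟨P, hP, h1, h2, -⟩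
  · rw [h1]; exact empty_ss F
  · rw [← h1]
    have hnot : ¬ F.1 ⊆ P.1 := fun h3 =>
      absurd (hmin P (Finset.mem_filter.2 ⟨hP, h3⟩)) (not_le.2 (Finset.card_lt_card h2))
    exact ((h P hP).resolve_left hnot).ssubset_of_ne fun h4 => hnot h4.symm.subset

/-- The class w restricted to the star of the chain is a positive combination of the link. -/
theorem ww_local {σ : Finset (FlatVar M)} {T : FlatVar M} (hT : T.1 = Finset.univ) (hTσ : T ∈ σ)
    (hσ : Chn σ) {t : ℝ} (ht : 0 < t) (ht1 : t ≤ 1) :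
    ∃ c : FlatVar M → ℝ, (∀ F, Cmp σ F → F ∉ σ → 0 < c F) ∧
      (∀ F, ¬ (Cmp σ F ∧ F ∉ σ) → c F = 0) ∧
      ∀ p, ll σ (ww M t * p) = ∑ F, c F * ll σ (X F * p) := by
  classical
  obtain ⟨lam, hlam⟩ := interp hσ (fun G => psi M t G.card) (by simp [psi])
  refine ⟨fun F => if Cmp σ F ∧ F ∉ σ then ∑ a ∈ F.1, lam a - psi M t F.1.card else 0, ?_, ?_, ?_⟩
  · intro F h1 h2
    beta_reduce
    rw [if_pos ⟨h1, h2⟩]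
    obtain ⟨N, hN, hP, hFN⟩ := Cmp_gap hT hTσ hσ h1 h2
    rw [hlam N hN F.1 hP.1 hFN.1]
    have e1 := Finset.card_lt_card hP
    have e2 := Finset.card_lt_card hFN
    have hc := psi_conv (M := M) ht ht1 e1 e2
    have e3 : ((prv σ N.1).card : ℝ) < F.1.card := by exact_mod_cast e1
    have e4 : (F.1.card : ℝ) < N.1.card := by exact_mod_cast e2
    have e5 : 0 < (N.1.card : ℝ) - (prv σ N.1).card := by linarith
    have e6 : psi M t (prv σ N.1).card + (psi M t N.1.card - psi M t (prv σ N.1).card) /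
        ((N.1.card : ℝ) - (prv σ N.1).card) * (F.1.card - (prv σ N.1).card) - psi M t F.1.card =
        (psi M t (prv σ N.1).card * (N.1.card - F.1.card) + psi M t N.1.card * (F.1.card - (prv σ N.1).card)
          - psi M t F.1.card * (N.1.card - (prv σ N.1).card)) / (N.1.card - (prv σ N.1).card) := by
      field_simp
      ring
    rw [e6]
    exact div_pos (by linarith) e5
  · intro F h
    exact if_neg h
  · intro p
    have h1 : ww M t + ∑ F : FlatVar M, (∑ a ∈ F.1, lam a) • (X F : ChowPolyR M) =
        ∑ F : FlatVar M, (∑ a ∈ F.1, lam a - psi M t F.1.card) • (X F : ChowPolyR M) := by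
      rw [ww, ← Finset.sum_add_distrib]
      apply Finset.sum_congr rfl
      intro F _
      rw [sub_smul, smul_neg]; ring
    have h2 : ll σ (ww M t * p) = ll σ ((∑ F : FlatVar M, (∑ a ∈ F.1, lam a - psi M t F.1.card) •
        (X F : ChowPolyR M)) * p) := by
      rw [← h1, add_mul, map_add, ll_I hT hTσ (lam_mem lam), add_zero]
    rw [h2, Finset.sum_mul, map_sum]
    apply Finset.sum_congr rfl
    intro F _
    rw [smul_mul_assoc, map_smul, smul_eq_mul]
    beta_reduce
    by_cases hc : Cmp σ F
    · by_cases hF : F ∈ σ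
      · rw [if_neg (by tauto), hlam F hF F.1 (prv_ss hσ F).1 subset_rfl]
        have : ((prv σ F.1).card : ℝ) < F.1.card := by exact_mod_cast Finset.card_lt_card (prv_ss hσ F)
        have e5 : (F.1.card : ℝ) - (prv σ F.1).card ≠ 0 := by linarith
        rw [div_mul_cancel₀ _ e5]
        ring
      · rw [if_pos ⟨hc, hF⟩]
    · rw [ll_inc hT hTσ hc, mul_zero, mul_zero]

theorem null_sigma {σ : Finset (FlatVar M)} {T : FlatVar M} (hT : T.1 = Finset.univ) (hTσ : T ∈ σ)
    (hσ : Chn σ) (p : ChowPolyR M) (h : ∀ F, Cmp σ F → F ∉ σ → ll σ (X F * p) = 0) (F : FlatVar M) :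
    ll σ (X F * p) = 0 := by
  classical
  by_cases hc : Cmp σ F
  swap
  · exact ll_inc hT hTσ hc p
  by_cases hF : F ∈ σ
  swap
  · exact h F hc hF
  obtain ⟨lam, hlam⟩ := interp hσ (fun G => if G = F.1 then (1:ℝ) else 0) (if_neg (Ne.symm F.2.2))
  have h1 := ll_I hT hTσ (lam_mem (M := M) lam) p
  rw [Finset.sum_mul, map_sum, Finset.sum_eq_single F] at h1
  · rw [smul_mul_assoc, map_smul, smul_eq_mul] at h1
    refine (mul_eq_zero.1 h1).resolve_left ?_
    rw [hlam F hF F.1 (prv_ss hσ F).1 subset_rfl]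
    have : ((prv σ F.1).card : ℝ) < F.1.card := by exact_mod_cast Finset.card_lt_card (prv_ss hσ F)
    have e5 : (F.1.card : ℝ) - (prv σ F.1).card ≠ 0 := by linarith
    rw [div_mul_cancel₀ _ e5]
    simp
  · intro G _ hne
    rw [smul_mul_assoc, map_smul, smul_eq_mul]
    by_cases hG : G ∈ σ
    · rw [hlam G hG G.1 (prv_ss hσ G).1 subset_rfl]
      have : ((prv σ G.1).card : ℝ) < G.1.card := by exact_mod_cast Finset.card_lt_card (prv_ss hσ G)
      have e5 : (G.1.card : ℝ) - (prv σ G.1).card ≠ 0 := by linarith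
      rw [div_mul_cancel₀ _ e5]
      have : ¬ G.1 = F.1 := fun h => hne (Subtype.ext h)
      simp [this]
    · by_cases hcG : Cmp σ G
      · rw [h G hcG hG, mul_zero]
      · rw [ll_inc hT hTσ hcG, mul_zero]
  · exact fun h => absurd (Finset.mem_univ _) h

theorem null_up {σ : Finset (FlatVar M)} (a : ChowPolyR M) (n : ℕ)
    (h : ∀ F (c : ChowPolyR M), c.IsHomogeneous n → ll σ (X F * (a * c)) = 0) (c : ChowPolyR M)
    (hc : c.IsHomogeneous (n + 1)) : ll σ (a * c) = 0 := by
  rw [c.as_sum, Finset.mul_sum, map_sum]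
  apply Finset.sum_eq_zero
  intro s hs
  have hdeg : s.degree = n + 1 := (hc.degree_eq_sum_deg_support hs).symm
  obtain ⟨F, hF⟩ : ∃ F, s F ≠ 0 := by
    by_contra hcon
    push Not at hcon
    have : s = 0 := Finsupp.ext hcon
    rw [this] at hdeg; simp at hdeg
  obtain ⟨s', rfl⟩ : ∃ s', s = Finsupp.single F 1 + s' :=
    ⟨s - Finsupp.single F 1, by
      rw [add_tsub_cancel_of_le]
      simpa [Finsupp.single_le_iff] using Nat.one_le_iff_ne_zero.2 hF⟩
  have h1 : monomial (Finsupp.single F 1 + s') (coeff (Finsupp.single F 1 + s') c) =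
      X F * monomial s' (coeff (Finsupp.single F 1 + s') c) := by
    rw [X, monomial_mul, one_mul]
  rw [h1, mul_left_comm]
  apply h
  apply isHomogeneous_monomial
  rw [map_add, Finsupp.degree_single] at hdeg
  omega

theorem HL_step {σ : Finset (FlatVar M)} {T : FlatVar M} (hT : T.1 = Finset.univ) (hTσ : T ∈ σ)
    (hσ : Chn σ) {d : ℕ} {t : ℝ} (ht : 0 < t) (ht1 : t ≤ 1)
    (ih : ∀ F, Cmp σ F → F ∉ σ → ∀ d', d' + 1 = d → HR (ll (insert F σ)) (ww M t) d') :
    HL (ll σ) (ww M t) d := by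
  intro k m hk a ha h0 c hc
  rcases m with _ | m
  · simpa using h0 c hc
  obtain ⟨cf, hpos, hzero, hcf⟩ := ww_local hT hTσ hσ ht ht1
  have hHR : ∀ F, Cmp σ F → F ∉ σ → 0 ≤ (-1) ^ k * ll σ (X F * (a * a * ww M t ^ m)) ∧
      (ll σ (X F * (a * a * ww M t ^ m)) = 0 → ∀ c : ChowPolyR M, c.IsHomogeneous (k + m) →
        ll σ (X F * (a * c)) = 0) := by
    intro F hF hFσ
    have := ih F hF hFσ (2 * k + m) (by omega) k m rfl a ha (by
      intro j hj b hb
      rw [ll_insert hFσ, show X F * (a * b * ww M t ^ (m + 1)) = a * (X F * b) * ww M t ^ (m + 1) by ring]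
      apply h0
      rw [← hj, add_comm]
      exact (isHomogeneous_X _ _).mul hb)
    simpa only [ll_insert hFσ] using this
  have hsum : ∑ F, cf F * ((-1) ^ k * ll σ (X F * (a * a * ww M t ^ m))) = 0 := by
    have h1 := h0 a ha
    rw [pow_succ', show a * a * (ww M t * ww M t ^ m) = ww M t * (a * a * ww M t ^ m) by ring, hcf] at h1
    calc _ = (-1) ^ k * ∑ F, cf F * ll σ (X F * (a * a * ww M t ^ m)) := by
          rw [Finset.mul_sum]; exact Finset.sum_congr rfl fun F _ => by ring
      _ = 0 := by rw [h1, mul_zero]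
  rw [Finset.sum_eq_zero_iff_of_nonneg] at hsum
  · refine null_up a (k + m) (fun F c' hc' => ?_) c hc
    refine null_sigma hT hTσ hσ _ (fun F hF hFσ => (hHR F hF hFσ).2 ?_ c' hc') F
    have h2 := (mul_eq_zero.1 (hsum F (Finset.mem_univ _))).resolve_left (hpos F hF hFσ).ne'
    exact (mul_eq_zero.1 h2).resolve_left (pow_ne_zero _ (by norm_num))
  · intro F _
    by_cases h : Cmp σ F ∧ F ∉ σ
    · exact mul_nonneg (hpos F h.1 h.2).le (hHR F h.1 h.2).1
    · rw [hzero F h, zero_mul]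

theorem main_HR {T : FlatVar M} (hT : T.1 = Finset.univ) (d : ℕ) : ∀ σ : Finset (FlatVar M), T ∈ σ →
    Chn σ → σ.card + d = M.rk Finset.univ →
    (∀ t : ℝ, 0 < t → t ≤ 1 → HL (ll σ) (ww M t) d) ∧
    (∀ t : ℝ, 0 < t → t ≤ 1 → HR (ll σ) (ww M t) d) := by
  induction d with
  | zero =>
    intro σ hTσ hσ hd
    have h1 : ∀ t : ℝ, 0 < t → t ≤ 1 → HL (ll σ) (ww M t) 0 := fun t ht ht1 =>
      HL_step hT hTσ hσ ht ht1 fun F _ _ d' hd' => absurd hd' (Nat.succ_ne_zero _)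
    exact ⟨h1, fun t ht ht1 => HR_of_HL hT hTσ hσ hd h1 ht ht1⟩
  | succ d ih =>
    intro σ hTσ hσ hd
    have h1 : ∀ t : ℝ, 0 < t → t ≤ 1 → HL (ll σ) (ww M t) (d + 1) := fun t ht ht1 =>
      HL_step hT hTσ hσ ht ht1 fun F hF hFσ d' hd' => by
        obtain rfl : d' = d := by omega
        refine (ih (insert F σ) (Finset.mem_insert_of_mem hTσ) ?_ ?_).2 t ht ht1
        · intro A hA B hB
          rcases Finset.mem_insert.1 hA with hA' | hA' <;>
            rcases Finset.mem_insert.1 hB with hB' | hB'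
          · rw [hA', hB']; exact Or.inl subset_rfl
          · rw [hA']; exact hF B hB'
          · rw [hB']; exact (hF A hA').symm
          · exact hσ A hA' B hB'
        · rw [Finset.card_insert_of_notMem hFσ]; omega
    exact ⟨h1, fun t ht ht1 => HR_of_HL hT hTσ hσ hd h1 ht ht1⟩

end ChowHL

namespace ChowHL
open SimpleFlatMatroid MvPolynomial
variable {E : Type*} [Fintype E] [DecidableEq E] {M : SimpleFlatMatroid E}

theorem psi_one (j : ℕ) : psi M 1 j = (j : ℝ) ^ 2 := by
  unfold psi
  split_ifs with h
  · simp [h]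
  · simp

theorem omega_ww : ∑ F : FlatVar M, (((F.1.card * ((Finset.univ : Finset E) \ F.1).card : ℕ) : ℝ)) •
    (X F : ChowPolyR M) - ww M 1 ∈ chowIdealR M := by
  convert lam_mem (M := M) (fun _ => (Fintype.card E : ℝ)) using 1
  rw [ww, ← Finset.sum_sub_distrib]
  apply Finset.sum_congr rfl
  intro F _
  rw [psi_one, smul_neg, sub_neg_eq_add, ← add_smul]
  congr 1
  have h : (((Finset.univ : Finset E) \ F.1).card : ℝ) = Fintype.card E - F.1.card := by
    rw [Finset.cast_card_sdiff (Finset.subset_univ _), Finset.card_univ]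
  rw [Nat.cast_mul, h, Finset.sum_const, nsmul_eq_mul]
  ring

theorem inj_key {r : ℕ} (hr : M.rk Finset.univ = r + 1) {k : ℕ} (hk : 2 * k < r) {p : ChowPolyR M}
    (hp : p.IsHomogeneous k) (h : p * ww M 1 ∈ chowIdealR M) : p ∈ chowIdealR M := by
  classical
  have hne : (Finset.univ : Finset E) ≠ ∅ := by
    intro h0
    rw [h0, M.rk_empty] at hr
    omega
  obtain ⟨T, hT⟩ : ∃ T : FlatVar M, T.1 = Finset.univ := ⟨⟨Finset.univ, M.ground_mem, hne⟩, rfl⟩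
  have hTσ : T ∈ ({T} : Finset (FlatVar M)) := Finset.mem_singleton_self T
  have hσ : Chn ({T} : Finset (FlatVar M)) := by
    intro A hA B hB
    rw [Finset.mem_singleton.1 hA, Finset.mem_singleton.1 hB]
    exact Or.inl subset_rfl
  have hd : ({T} : Finset (FlatVar M)).card + r = M.rk Finset.univ := by
    rw [Finset.card_singleton, hr, add_comm]
  have hHL := (main_HR hT r {T} hTσ hσ hd).1 1 one_pos le_rfl
  obtain ⟨m, hm⟩ : ∃ m, 2 * k + (m + 1) = r := ⟨r - 2 * k - 1, by omega⟩
  obtain ⟨c, hc⟩ : ∃ c : Yk {T} 0 (k + 0) → ℝ, p - ∑ e, c e • tm {T} 1 e.1 ∈ JJ {T} T :=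
    span_tm (q := 0) hT one_pos hp
  have hc0 : c = 0 := by
    refine Knondeg hT hTσ hσ hd hm one_pos hHL c ?_
    rw [KM_zero_iff]
    intro e
    rw [KK_sum hT hTσ hσ one_pos (m + 1) c (mem_Yk.1 e.2).2, mul_right_comm, ← ll_JJ hT hTσ hc,
      show tm {T} 1 e.1 * ww M 1 ^ (m + 1) * p = p * ww M 1 * (tm {T} 1 e.1 * ww M 1 ^ m) by ring]
    exact ll_I hT hTσ h _
  rw [hc0] at hc
  have h2 := mem_JJ.1 hc
  simpa using h2

theorem omega_fixed (g : Equiv.Perm E) (hg : M.IsAut g) :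
    autRenameR M g hg (∑ F : FlatVar M, (((F.1.card * ((Finset.univ : Finset E) \ F.1).card : ℕ) : ℝ)) •
      (X F : ChowPolyR M)) =
    ∑ F : FlatVar M, (((F.1.card * ((Finset.univ : Finset E) \ F.1).card : ℕ) : ℝ)) •
      (X F : ChowPolyR M) := by
  obtain ⟨f, hf⟩ : ∃ f : FlatVar M → FlatVar M, f = fun F : FlatVar M =>
    (⟨F.1.image g, hg F.1 F.2.1, by
        simpa [Finset.image_eq_empty] using F.2.2⟩ : FlatVar M) := ⟨_, rfl⟩
  have hinj : Function.Injective f := by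
    intro A B hAB
    rw [hf] at hAB
    have := congrArg Subtype.val hAB
    exact Subtype.ext (Finset.image_injective g.injective this)
  have hbij : Function.Bijective f := Finite.injective_iff_bijective.1 hinj
  have h1 : autRenameR M g hg = rename f := by rw [hf]; rfl
  rw [h1, map_sum, ← hbij.sum_comp (fun F : FlatVar M =>
    (((F.1.card * ((Finset.univ : Finset E) \ F.1).card : ℕ) : ℝ)) • (X F : ChowPolyR M))]
  apply Finset.sum_congr rfl
  intro F _
  have hcard : (f F).1.card = F.1.card := by
    rw [hf]; exact Finset.card_image_of_injective _ g.injective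
  rw [map_smul, rename_X, Finset.card_sdiff_of_subset (Finset.subset_univ _),
    Finset.card_sdiff_of_subset (Finset.subset_univ _), hcard]

theorem omega_hom : (∑ F : FlatVar M, (((F.1.card * ((Finset.univ : Finset E) \ F.1).card : ℕ) : ℝ)) •
      (X F : ChowPolyR M)).IsHomogeneous 1 := by
  apply IsHomogeneous.sum
  intro F _
  exact smul_hom (isHomogeneous_X _ _) _

end ChowHL

open SimpleFlatMatroid in
/-- For a finite simple matroid `M` of rank `r+1`: the element
`ω = Σ_{∅ ≠ F ∈ 𝓕} |F|·|E∖F|·x_F` of `A¹_ℝ` is fixed by every automorphism of `M`, and for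
every `k` with `2k < r` multiplication by `ω` is an injective `ℝ`-linear `G`-equivariant map
`A^k_ℝ → A^{k+1}_ℝ`. -/
theorem chow_fixed_lefschetz_element {E : Type*} [Fintype E] [DecidableEq E]
    (M : SimpleFlatMatroid E) (r : ℕ) (hr : M.rk Finset.univ = r + 1) :
    ∀ omegaPoly : ChowPolyR M,
      omegaPoly = ∑ F : FlatVar M,
          (((F.1.card * ((Finset.univ : Finset E) \ F.1).card : ℕ) : ℝ)) • MvPolynomial.X F →
      (chowMkR M omegaPoly ∈ chowCompR M 1) ∧
      (∀ (g : Equiv.Perm E) (hg : M.IsAut g),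
          chowMkR M (autRenameR M g hg omegaPoly) = chowMkR M omegaPoly) ∧
      (∀ k : ℕ, 2 * k < r →
        ∃ φ : chowCompR M k →ₗ[ℝ] chowCompR M (k + 1),
          Function.Injective φ ∧
          (∀ x : chowCompR M k,
              ((φ x : chowCompR M (k + 1)) : ChowRingR M)
                = (x : ChowRingR M) * chowMkR M omegaPoly) ∧
          (∀ (g : Equiv.Perm E) (hg : M.IsAut g) (p : ChowPolyR M),
              chowMkR M (autRenameR M g hg (p * omegaPoly))
                = chowMkR M (autRenameR M g hg p) * chowMkR M omegaPoly)) := by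
  intro omegaPoly hom
  have hfix : ∀ (g : Equiv.Perm E) (hg : M.IsAut g), autRenameR M g hg omegaPoly = omegaPoly := by
    intro g hg
    rw [hom]
    exact ChowHL.omega_fixed g hg
  have hhom : omegaPoly.IsHomogeneous 1 := by
    rw [hom]
    exact ChowHL.omega_hom
  have hww : omegaPoly - ChowHL.ww M 1 ∈ chowIdealR M := by
    rw [hom]
    exact ChowHL.omega_ww
  refine ⟨Submodule.mem_map_of_mem (f := (chowMkR M).toLinearMap) hhom, fun g hg => by rw [hfix],
    fun k hk => ?_⟩
  have hmaps : ∀ x ∈ chowCompR M k,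
      LinearMap.mulRight ℝ (chowMkR M omegaPoly) x ∈ chowCompR M (k + 1) := by
    rintro _ ⟨p, hp, rfl⟩
    refine ⟨p * omegaPoly, MvPolynomial.IsHomogeneous.mul hp hhom, ?_⟩
    simp
  refine ⟨(LinearMap.mulRight ℝ (chowMkR M omegaPoly)).restrict hmaps, ?_, fun x => rfl, ?_⟩
  · rw [injective_iff_map_eq_zero]
    rintro ⟨_, p, hp, rfl⟩ hx
    have hx' : chowMkR M (p * omegaPoly) = 0 := by
      rw [map_mul]
      exact congrArg Subtype.val hx
    have h1 : p * omegaPoly ∈ chowIdealR M := Ideal.Quotient.eq_zero_iff_mem.1 hx'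
    have h2 : p * ChowHL.ww M 1 ∈ chowIdealR M := by
      have h3 := Ideal.sub_mem _ h1 (Ideal.mul_mem_left _ p hww)
      rwa [← mul_sub, sub_sub_cancel] at h3
    apply Subtype.ext
    exact Ideal.Quotient.eq_zero_iff_mem.2 (ChowHL.inj_key hr hk hp h2)
  · intro g hg p
    rw [map_mul, map_mul, hfix]
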